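/- arXiv:math/0301097 — 4 statements merged into one kernel-verified Lean document; each statement's English description precedes it below -/
import Mathlib

section
/- Let ω be a C² real-valued function on a neighborhood of b ∈ ℝ^N with ∇ω(b) = 0 and det ∇²ω(b) ≠ 0. Then there exist positive constants θ₁ and θ₂ such that |∇ω(x)| ≥ θ₁ |ω(x) − ω(b)|^{1/2} for all x in the ball B_{θ₂}(b). -/
open MeasureTheory Set Filter Topology

noncomputable section

/-- `Euc N` is the Euclidean space `ℝ^N`. -/
abbrev Euc (N : ℕ) := EuclideanSpace ℝ (Fin N)

lemma norm_gradient_eq_norm_fderiv {E : Type*} [NormedAddCommGroup E] [InnerProductSpace ℝ E]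
    [CompleteSpace E] (f : E → ℝ) (x : E) : ‖gradient f x‖ = ‖fderiv ℝ f x‖ := by
  rw [← toDual_gradient, LinearIsometryEquiv.norm_map]

lemma differentiableAt_gradient_of_contDiffAt {E : Type*} [NormedAddCommGroup E]
    [InnerProductSpace ℝ E] [CompleteSpace E] {f : E → ℝ} {b : E} (hf : ContDiffAt ℝ 2 f b) :
    DifferentiableAt ℝ (gradient f) b :=
  (InnerProductSpace.toDual ℝ E).symm.toContinuousLinearEquiv.differentiableAt.comp b
    ((hf.fderiv_right (m := 1) (by norm_num)).differentiableAt one_ne_zero)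

/-- If the derivative of `f` is `O(x - b)` near `b`, then `f x - f b` is `O(‖x - b‖ ^ 2)`. -/
lemma isBigO_sub_sq_of_fderiv_isBigO {E F : Type*} [NormedAddCommGroup E] [NormedSpace ℝ E]
    [NormedAddCommGroup F] [NormedSpace ℝ F] {f : E → F} {b : E}
    (hf : ∀ᶠ x in 𝓝 b, DifferentiableAt ℝ f x) (hO : fderiv ℝ f =O[𝓝 b] (· - b)) :
    (f · - f b) =O[𝓝 b] (fun x ↦ ‖x - b‖ ^ 2) := by
  obtain ⟨C, hC, hb⟩ := hO.exists_pos
  obtain ⟨r, hr, hball⟩ := Metric.eventually_nhds_iff_ball.1 (hf.and hb.bound)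
  refine Asymptotics.IsBigO.of_bound C ?_
  filter_upwards [Metric.ball_mem_nhds b hr] with x hx
  have hsub : Metric.closedBall b ‖x - b‖ ⊆ Metric.ball b r :=
    Metric.closedBall_subset_ball (by simpa [dist_eq_norm] using hx)
  have hmv := (convex_closedBall b ‖x - b‖).norm_image_sub_le_of_norm_fderiv_le (𝕜 := ℝ)
    (C := C * ‖x - b‖) (fun y hy ↦ (hball y (hsub hy)).1)
    (fun y hy ↦ (hball y (hsub hy)).2.trans (by gcongr; simpa [dist_eq_norm] using hy))
    (Metric.mem_closedBall_self (norm_nonneg _)) (by simp [dist_eq_norm] : x ∈ _)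
  simpa [pow_two, mul_assoc] using hmv

/-- if `ω` is C² near `b`, `∇ω(b) = 0` and `det ∇²ω(b) ≠ 0`, then
`|∇ω(x)| ≥ θ₁ |ω(x) − ω(b)|^{1/2}` on a small ball `B_{θ₂}(b)`. -/
theorem gradient_lower_bound_near_nondegenerate_critical_point
    {N : ℕ} (ω : Euc N → ℝ) (b : Euc N)
    (hω : ∃ U ∈ 𝓝 b, ContDiffOn ℝ 2 ω U)
    (hcrit : gradient ω b = 0)
    (hdet : (fderiv ℝ (gradient ω) b).det ≠ 0) :
    ∃ θ₁ > (0:ℝ), ∃ θ₂ > (0:ℝ), ∀ x ∈ Metric.ball b θ₂,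
      θ₁ * |ω x - ω b| ^ ((1:ℝ)/2) ≤ ‖gradient ω x‖ := by
  obtain ⟨U, hU, hωU⟩ := hω
  have hc : ContDiffAt ℝ 2 ω b := hωU.contDiffAt hU
  have hG : HasFDerivAt (gradient ω) (fderiv ℝ (gradient ω) b) b :=
    (differentiableAt_gradient_of_contDiffAt hc).hasFDerivAt
  have hupper : fderiv ℝ ω =O[𝓝 b] (· - b) := by
    refine Asymptotics.IsBigO.of_norm_left ?_
    simpa [hcrit, norm_gradient_eq_norm_fderiv] using hG.isBigO_sub.norm_left
  have hdiff : ∀ᶠ x in 𝓝 b, DifferentiableAt ℝ ω x :=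
    (hc.eventually (by simp)).mono fun x hx ↦ hx.differentiableAt two_ne_zero
  have hlower : (· - b) =O[𝓝 b] gradient ω := by
    have hind : IsInducing (fderiv ℝ (gradient ω) b) :=
      (ContinuousLinearMap.toContinuousLinearEquivOfDetNeZero _ hdet).toHomeomorph.isInducing
    simpa [hcrit] using (hG.isTheta_sub hind).isBigO_symm
  have hsq : (ω · - ω b) =O[𝓝 b] (fun x ↦ ‖gradient ω x‖ ^ 2) :=
    (isBigO_sub_sq_of_fderiv_isBigO hdiff hupper).trans (hlower.norm_norm.pow 2)
  obtain ⟨C, hC, hb⟩ := hsq.exists_pos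
  obtain ⟨r, hr, hball⟩ := Metric.eventually_nhds_iff_ball.1 hb.bound
  refine ⟨(√C)⁻¹, by positivity, r, hr, fun x hx ↦ ?_⟩
  have hx' : |ω x - ω b| ≤ C * ‖gradient ω x‖ ^ 2 := by simpa using hball x hx
  rw [← Real.sqrt_eq_rpow, inv_mul_le_iff₀ (by positivity)]
  calc √|ω x - ω b| ≤ √(C * ‖gradient ω x‖ ^ 2) := Real.sqrt_le_sqrt hx'
    _ = √C * ‖gradient ω x‖ := by rw [Real.sqrt_mul hC.le, Real.sqrt_sq (norm_nonneg _)]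
end
end

section
/- Let ω : ℝ^N → ℝ be C² and suppose there exist an increasing function Ψ : ℝ → (0,∞) with |x| ≤ Ψ(ω(x)) for all x ∈ ℝ^N, and a positive function φ with |∇ω(x)| ≤ φ(|x|) for all x and ∫_α^{+∞} φ(t)^{-1} dt = +∞ for some α > 0. Then for every b ∈ ℝ^N the gradient flow y'(t) = −∇ω(y(t)), y(0) = b, has a unique solution defined on [0,+∞), and this solution is bounded in ℝ^N uniformly for t ∈ [0,∞). If in addition either every critical point of ω is nondegenerate or ω is real-analytic in a neighborhood of each of its critical points, then y(t) converges, as t → +∞, to a critical point of ω. -/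
open MeasureTheory Set Filter Topology

noncomputable section

section LogDerivation

open Polynomial DualNumber

lemma norm_add_lt_of_lt {K : Type*} [NormedField K] [IsUltrametricDist K] {a b : K}
    {r : ℝ} (ha : ‖a‖ < r) (hb : ‖b‖ < r) : ‖a + b‖ < r :=
  (IsUltrametricDist.norm_add_le_max a b).trans_lt (max_lt ha hb)

lemma norm_sum_lt_of_forall_lt {K ι : Type*} [NormedField K] [IsUltrametricDist K]
    (s : Finset ι) {f : ι → K} {r : ℝ} (hr : 0 < r) (h : ∀ i ∈ s, ‖f i‖ < r) :
    ‖∑ i ∈ s, f i‖ < r := by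
  classical
  induction s using Finset.induction_on with
  | empty => simpa using hr
  | insert a s ha ih =>
    rw [Finset.sum_insert ha]
    exact norm_add_lt_of_lt (h a (by simp)) (ih fun i hi => h i (by simp [hi]))

lemma norm_sub_le_of_le_of_le {K : Type*} [NormedField K] [IsUltrametricDist K] {a b : K}
    {r : ℝ} (ha : ‖a‖ ≤ r) (hb : ‖b‖ ≤ r) : ‖a - b‖ ≤ r := by
  rw [sub_eq_add_neg]
  exact (IsUltrametricDist.norm_add_le_max a (-b)).trans (max_le ha (by rwa [norm_neg]))

variable {K : Type*} [NormedField K] [Algebra ℝ K]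

/-- A dual number `a + b ε` over a nonarchimedean field is *logarithmic* if it vanishes or if
`b / a` is congruent to the valuation `-log ‖a‖` of `a` modulo the maximal ideal. -/
def IsLogDual (z : K[ε]) : Prop :=
  z = 0 ∨ ‖z.snd - (-Real.log ‖z.fst‖) • z.fst‖ < ‖z.fst‖

lemma real_smul_eq (r : ℝ) (a : K) : r • a = algebraMap ℝ K r * a := Algebra.smul_def r a

lemma norm_real_smul_le (hr : ∀ r : ℝ, ‖algebraMap ℝ K r‖ ≤ 1) (r : ℝ) (a : K) :
    ‖r • a‖ ≤ ‖a‖ := by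
  rw [Algebra.smul_def, norm_mul]
  exact mul_le_of_le_one_left (norm_nonneg _) (hr r)

lemma norm_algebraMap_real (hr : ∀ r : ℝ, ‖algebraMap ℝ K r‖ ≤ 1) {r : ℝ} (h : r ≠ 0) :
    ‖algebraMap ℝ K r‖ = 1 := by
  refine le_antisymm (hr r) ?_
  have h1 : ‖algebraMap ℝ K r‖ * ‖algebraMap ℝ K r⁻¹‖ = 1 := by
    rw [← norm_mul, ← map_mul, mul_inv_cancel₀ h, map_one, norm_one]
  nlinarith [hr r⁻¹, norm_nonneg (algebraMap ℝ K r), norm_nonneg (algebraMap ℝ K r⁻¹)]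

lemma IsLogDual.fst_ne_zero {z : K[ε]} (hz : IsLogDual z) (h0 : z ≠ 0) : z.fst ≠ 0 := by
  rcases hz with h | h
  · exact absurd h h0
  · exact norm_pos_iff.1 ((norm_nonneg _).trans_lt h)

lemma IsLogDual.eq_zero {z : K[ε]} (hz : IsLogDual z) (h0 : z.fst = 0) : z = 0 := by
  by_contra h
  exact hz.fst_ne_zero h h0

variable [IsUltrametricDist K]

lemma IsLogDual.norm_snd_le (hr : ∀ r : ℝ, ‖algebraMap ℝ K r‖ ≤ 1) {z : K[ε]}
    (hz : IsLogDual z) : ‖z.snd‖ ≤ ‖z.fst‖ := by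
  rcases hz with rfl | h
  · simp
  · have := IsUltrametricDist.norm_add_le_max (z.snd - (-Real.log ‖z.fst‖) • z.fst)
      ((-Real.log ‖z.fst‖) • z.fst)
    rw [sub_add_cancel] at this
    exact this.trans (max_le h.le (norm_real_smul_le hr _ _))

lemma IsLogDual.norm_sub_lt (hr : ∀ r : ℝ, ‖algebraMap ℝ K r‖ ≤ 1) {z : K[ε]}
    (hz : IsLogDual z) {ρ : ℝ} (hρ : 0 < ρ) (h : ‖z.fst‖ ≤ ρ) :
    ‖z.snd - (-Real.log ρ) • z.fst‖ < ρ := by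
  rcases h.eq_or_lt with h | h
  · rcases hz with rfl | hz
    · simpa using hρ
    · rwa [h] at hz
  · rw [sub_eq_add_neg]
    refine norm_add_lt_of_lt ((hz.norm_snd_le hr).trans_lt h) ?_
    rw [norm_neg]
    exact (norm_real_smul_le hr _ _).trans_lt h

lemma IsLogDual.add (hr : ∀ r : ℝ, ‖algebraMap ℝ K r‖ ≤ 1) {e h : K[ε]}
    (he : IsLogDual e) (hh : IsLogDual h) (hle : ‖e.fst‖ ≤ ‖(e + h).fst‖) :
    IsLogDual (e + h) := by
  by_cases h0 : (e + h).fst = 0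
  · left
    have he0 : e.fst = 0 := by simpa [h0] using hle
    have hh0 : h.fst = 0 := by simpa [he0] using h0
    rw [he.eq_zero he0, hh.eq_zero hh0, add_zero]
  · right
    have hρ := norm_pos_iff.2 h0
    have hhle : ‖h.fst‖ ≤ ‖(e + h).fst‖ := by
      have : h.fst = (e + h).fst - e.fst := by simp
      rw [this]
      exact norm_sub_le_of_le_of_le le_rfl hle
    have := norm_add_lt_of_lt (he.norm_sub_lt hr hρ hle) (hh.norm_sub_lt hr hρ hhle)
    refine lt_of_eq_of_lt ?_ this
    congr 1
    simp only [TrivSqZeroExt.snd_add, TrivSqZeroExt.fst_add, smul_add]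
    ring

lemma IsLogDual.mul {z w : K[ε]} (hz : IsLogDual z) (hw : IsLogDual w) : IsLogDual (z * w) := by
  by_cases hz0 : z = 0
  · left; simp [hz0]
  by_cases hw0 : w = 0
  · left; simp [hw0]
  have h1 := norm_pos_iff.2 (hz.fst_ne_zero hz0)
  have h2 := norm_pos_iff.2 (hw.fst_ne_zero hw0)
  replace hz := hz.resolve_left hz0
  replace hw := hw.resolve_left hw0
  right
  have key : (z * w).snd - (-Real.log ‖(z * w).fst‖) • (z * w).fst =
      z.fst * (w.snd - (-Real.log ‖w.fst‖) • w.fst) +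
      w.fst * (z.snd - (-Real.log ‖z.fst‖) • z.fst) := by
    simp only [TrivSqZeroExt.snd_mul, TrivSqZeroExt.fst_mul, norm_mul,
      Real.log_mul h1.ne' h2.ne', real_smul_eq, map_neg, map_add, smul_eq_mul,
      MulOpposite.smul_eq_mul_unop, MulOpposite.unop_op]
    ring
  rw [key, TrivSqZeroExt.fst_mul, norm_mul]
  refine norm_add_lt_of_lt ?_ ?_
  · rw [norm_mul]; exact mul_lt_mul_of_pos_left hw h1
  · rw [norm_mul, mul_comm]; exact mul_lt_mul_of_pos_right hz h2

lemma IsLogDual.of_mul {z w : K[ε]} (hzw : IsLogDual (z * w)) (hw : IsLogDual w)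
    (hw0 : w.fst ≠ 0) : IsLogDual z := by
  have hinv : IsLogDual w⁻¹ := by
    right
    have h := hw.resolve_left (fun h => hw0 (by simp [h]))
    have h2 := norm_pos_iff.2 hw0
    have key : w⁻¹.snd - (-Real.log ‖w⁻¹.fst‖) • w⁻¹.fst =
        - (w.fst⁻¹ * w.fst⁻¹) * (w.snd - (-Real.log ‖w.fst‖) • w.fst) := by
      simp only [TrivSqZeroExt.snd_inv, TrivSqZeroExt.fst_inv, norm_inv, Real.log_inv,
        real_smul_eq, map_neg, smul_eq_mul, MulOpposite.smul_eq_mul_unop, MulOpposite.unop_op]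
      field_simp
      ring
    rw [key, norm_mul, TrivSqZeroExt.fst_inv, norm_neg, norm_mul, norm_inv]
    calc _ < ‖w.fst‖⁻¹ * ‖w.fst‖⁻¹ * ‖w.fst‖ := mul_lt_mul_of_pos_left h (by positivity)
      _ = _ := by field_simp
  have := hzw.mul hinv
  rwa [mul_assoc, TrivSqZeroExt.mul_inv_cancel hw0, mul_one] at this

end LogDerivation

section LogDerivationExtension

open Polynomial DualNumber

variable {K : Type*} [NormedField K] [Algebra ℝ K] [IsUltrametricDist K]

/-- In a nonarchimedean extension of a complete field, the coefficients of the minimal polynomial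
of `x` are bounded by powers of `‖x‖`. -/
lemma norm_coeff_minpoly_le {K : Type*} [NormedField K] [IsUltrametricDist K]
    (F : Subfield K) [CompleteSpace F] {x : K}
    (hx : IsIntegral F x) (i : ℕ) (hi : i < (minpoly F x).natDegree) :
    ‖(minpoly F x).coeff i‖ ≤ ‖x‖ ^ ((minpoly F x).natDegree - i) := by
  by_cases hF : ∃ a : F, a ≠ 0 ∧ ‖a‖ ≠ 1
  · let _ : NontriviallyNormedField F := NontriviallyNormedField.ofNormNeOne hF
    let _ : NormedAlgebra F K :=
      ⟨fun a b => by rw [Algebra.smul_def, norm_mul]; rfl⟩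
    have _ : IsUltrametricDist F :=
      ⟨fun a b c => IsUltrametricDist.dist_triangle_max (a : K) b c⟩
    let L := IntermediateField.adjoin F {x}
    have hfin : FiniteDimensional F L := IntermediateField.adjoin.finiteDimensional hx
    have hsp : ‖x‖ = spectralNorm F K x := by
      have h1 := NormedAlgebra.norm_eq_spectralNorm F (IntermediateField.AdjoinSimple.gen F x)
      rw [spectralNorm.eq_of_tower (L := K)] at h1
      exact h1
    have h2 : spectralValueTerms (minpoly F x) i ≤ ‖x‖ := by
      rw [hsp]
      exact le_ciSup (spectralValueTerms_bddAbove _) i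
    rw [spectralValueTerms_of_lt_natDegree _ hi] at h2
    have h3 : (0 : ℝ) < ((minpoly F x).natDegree - i : ℕ) := by
      exact_mod_cast Nat.sub_pos_of_lt hi
    rw [← Nat.cast_sub hi.le, one_div] at h2
    have h4 := Real.rpow_le_rpow (by positivity) h2 h3.le
    rwa [← Real.rpow_mul (norm_nonneg _), inv_mul_cancel₀ h3.ne', Real.rpow_one,
      Real.rpow_natCast] at h4
  · push Not at hF
    have hle : ∀ a : F, ‖a‖ ≤ 1 := fun a => by
      by_cases h : a = 0
      · simp [h]
      · exact (hF a h).le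
    by_cases hx0 : x = 0
    · subst hx0
      rw [minpoly.zero] at hi ⊢
      simp only [natDegree_X, Nat.lt_one_iff] at hi
      simp [hi]
    have hx1 : 1 ≤ ‖x‖ := by
      by_contra! hlt
      have h0 : (minpoly F x).coeff 0 ≠ 0 := minpoly.coeff_zero_ne_zero hx hx0
      have h1 := minpoly.aeval F x
      rw [aeval_eq_sum_range, Finset.sum_range_succ'] at h1
      have h2 : ‖∑ k ∈ Finset.range (minpoly F x).natDegree,
          (minpoly F x).coeff (k + 1) • x ^ (k + 1)‖ < 1 := by
        refine norm_sum_lt_of_forall_lt _ one_pos fun k _ => ?_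
        rw [Algebra.smul_def, norm_mul, norm_pow]
        exact (mul_le_of_le_one_left (by positivity) (hle _)).trans_lt
          (pow_lt_one₀ (norm_nonneg _) hlt k.succ_ne_zero)
      have h3 : ‖(minpoly F x).coeff 0 • x ^ 0‖ = 1 := by
        rw [pow_zero, Algebra.smul_def, mul_one]
        exact hF _ h0
      rw [add_eq_zero_iff_neg_eq] at h1
      rw [← h1, norm_neg] at h3
      exact h2.ne h3
    exact (hle _).trans (one_le_pow₀ hx1)

lemma polynomial_induction_of_roots {F : Type*} [Field F] {d : ℕ}
    (hd : ∀ Q : F[X], 0 < Q.natDegree → Q.natDegree < d → ∃ a : F, Q.IsRoot a) {p : F[X] → Prop}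
    (hC : ∀ a, p (C a)) (hmul : ∀ a Q, Q ≠ 0 → p Q → p ((X - C a) * Q)) (Q : F[X])
    (hQ : Q.natDegree < d) : p Q := by
  induction hn : Q.natDegree generalizing Q with
  | zero =>
    rw [eq_C_of_natDegree_eq_zero hn]
    exact hC _
  | succ n ih =>
    obtain ⟨a, ha⟩ := hd Q (by omega) hQ
    obtain ⟨R, rfl⟩ := dvd_iff_isRoot.2 ha
    have hR : R ≠ 0 := by rintro rfl; simp at hn
    rw [natDegree_mul (X_sub_C_ne_zero a) hR, natDegree_X_sub_C] at hn hQ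
    exact hmul a R hR (ih R (by omega) (by omega))

lemma fst_eval₂ {K : Type*} [NormedField K] {F : Subfield K} {s : F →+* K[ε]}
    (hs : ∀ a, (s a).fst = a) (z : K[ε]) (Q : F[X]) : (Q.eval₂ s z).fst = aeval z.fst Q := by
  have h := Polynomial.hom_eval₂ Q s (TrivSqZeroExt.fstHom K K K).toRingHom z
  rw [aeval_def]
  refine h.trans ?_
  congr 1
  ext a
  exact hs a

lemma le_norm_aeval {K : Type*} [NormedField K] {F : Subfield K} {d : ℕ}
    (hd : ∀ Q : F[X], 0 < Q.natDegree → Q.natDegree < d → ∃ a : F, Q.IsRoot a) {x : K}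
    (hx : ∀ q : F, ‖x‖ ≤ ‖x - q‖) (Q : F[X]) (hQ : Q.natDegree < d) :
    ‖Q.leadingCoeff‖ * ‖x‖ ^ Q.natDegree ≤ ‖aeval x Q‖ := by
  refine polynomial_induction_of_roots
    (p := fun Q => ‖Q.leadingCoeff‖ * ‖x‖ ^ Q.natDegree ≤ ‖aeval x Q‖) hd (fun a => ?_)
    (fun a Q h0 h => ?_) Q hQ
  · simp only [leadingCoeff_C, natDegree_C, pow_zero, mul_one, aeval_C]
    exact le_rfl
  · rw [natDegree_mul (X_sub_C_ne_zero a) h0, leadingCoeff_mul, map_mul, norm_mul, norm_mul,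
      natDegree_X_sub_C, leadingCoeff_X_sub_C, norm_one, one_mul, pow_add, pow_one]
    calc _ = ‖x‖ * (‖Q.leadingCoeff‖ * ‖x‖ ^ Q.natDegree) := by ring
      _ ≤ ‖x - a‖ * ‖aeval x Q‖ := by gcongr; exact hx a
      _ = _ := by rw [map_sub, aeval_X, aeval_C]; rfl

/-- The dual number lying over an algebraic element is determined by its minimal polynomial. -/
lemma exists_eval₂_eq_zero {K : Type*} [NormedField K] {F : Subfield K} {s : F →+* K[ε]}
    (hs : ∀ a, (s a).fst = a) {x : K} {P : F[X]} (hx : aeval x P = 0)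
    (hx' : aeval x (derivative P) ≠ 0) :
    ∃ y : K, P.eval₂ s (TrivSqZeroExt.inl x + TrivSqZeroExt.inr y) = 0 ∧
      y * aeval x (derivative P) =
        - ∑ i ∈ Finset.range (P.natDegree + 1), (s (P.coeff i)).snd * x ^ i := by
  set A := P.eval₂ s (TrivSqZeroExt.inl x) with hA
  have hA1 : A.fst = 0 := by rw [hA, fst_eval₂ hs, TrivSqZeroExt.fst_inl, hx]
  have hA2 : A.snd = ∑ i ∈ Finset.range (P.natDegree + 1), (s (P.coeff i)).snd * x ^ i := by
    rw [hA, eval₂_eq_sum_range, TrivSqZeroExt.snd_sum]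
    refine Finset.sum_congr rfl fun i _ => ?_
    rw [TrivSqZeroExt.inl_pow, TrivSqZeroExt.snd_mul]
    simp [mul_comm]
  refine ⟨-A.snd / aeval x (derivative P), ?_, ?_⟩
  · rw [eval₂_eq_eval_map, eval_add_of_sq_eq_zero, derivative_map, ← eval₂_eq_eval_map,
      ← eval₂_eq_eval_map, ← hA]
    · ext
      · simp [hA1]
      · simp [fst_eval₂ hs]
        field_simp
        simp
    · ext <;> simp [pow_two]
  · rw [← hA2]
    field_simp

lemma isLogDual_eval₂ {F : Subfield K} {s : F →+* K[ε]} (hg : ∀ a, IsLogDual (s a)) {d : ℕ}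
    (hd : ∀ Q : F[X], 0 < Q.natDegree → Q.natDegree < d → ∃ a : F, Q.IsRoot a) {z : K[ε]}
    (hz : ∀ q, IsLogDual (z - s q)) (Q : F[X]) (hQ : Q.natDegree < d) :
    IsLogDual (Q.eval₂ s z) := by
  refine polynomial_induction_of_roots (p := fun Q => IsLogDual (Q.eval₂ s z)) hd
    (fun a => by simpa using hg a) (fun a Q _ h => ?_) Q hQ
  rw [eval₂_mul, eval₂_sub, eval₂_X, eval₂_C]
  exact (hz a).mul h

lemma isLogDual_sub_of_best_approximation (hr : ∀ r : ℝ, ‖algebraMap ℝ K r‖ ≤ 1)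
    {F : Subfield K} {s : F →+* K[ε]} (hs : ∀ a, (s a).fst = a) (hg : ∀ a, IsLogDual (s a))
    {z : K[ε]} (h : ∀ q : F, ∃ q' : F, ‖z.fst - q'‖ ≤ ‖z.fst - q‖ ∧ IsLogDual (z - s q'))
    (q : F) : IsLogDual (z - s q) := by
  obtain ⟨q', hle, hq'⟩ := h q
  have := hq'.add hr (hg (q' - q)) (by simpa [hs] using hle)
  simpa using this

end LogDerivationExtension

section LogDerivationAdjunction

open Polynomial DualNumber

lemma coeff_comp_X_add_C_pred {F : Type*} [Field F] {P : F[X]} (hP : P.Monic)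
    (hd : 0 < P.natDegree) (q : F) :
    (P.comp (X + C q)).coeff (P.natDegree - 1) =
      P.coeff (P.natDegree - 1) + P.natDegree * q := by
  obtain ⟨n, hn⟩ := Nat.exists_eq_succ_of_ne_zero hd.ne'
  have h1 : P.coeff (1 + n) = 1 := by rw [add_comm, ← Nat.succ_eq_add_one, ← hn]; exact hP
  rw [← taylor_apply, taylor_coeff, eval_eq_sum_range' (n := 2), hn]
  · simp [Finset.sum_range_succ, hasseDeriv_coeff, add_comm 1 n, add_comm 1 n ▸ h1]
  · exact (natDegree_hasseDeriv_le _ _).trans_lt (by omega)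

variable {K : Type*} [NormedField K] [Algebra ℝ K] [IsUltrametricDist K]

lemma exists_isLogDual_algebraic (hr : ∀ r : ℝ, ‖algebraMap ℝ K r‖ ≤ 1) [IsAlgClosed K]
    {F : Subfield K} [CompleteSpace F] {s : F →+* K[ε]} (hs : ∀ a, (s a).fst = a)
    (hg : ∀ a, IsLogDual (s a)) (h : ∃ x : K, x ∉ F ∧ IsIntegral F x) :
    ∃ z : K[ε], z.fst ∉ F ∧ ∀ Q : F[X], IsLogDual (Q.eval₂ s z) := by
  classical
  have _ : CharZero K := charZero_of_injective_algebraMap (algebraMap ℝ K).injective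
  have hex : ∃ n, ∃ x : K, x ∉ F ∧ IsIntegral F x ∧ (minpoly F x).natDegree = n := by
    obtain ⟨x, h1, h2⟩ := h
    exact ⟨_, x, h1, h2, rfl⟩
  obtain ⟨d, ⟨x₁, hx₁F, hx₁, hd₁⟩, hmin⟩ : ∃ d, (∃ x : K, x ∉ F ∧ IsIntegral F x ∧
      (minpoly F x).natDegree = d) ∧
      ∀ x : K, x ∉ F → IsIntegral F x → d ≤ (minpoly F x).natDegree :=
    ⟨Nat.find hex, Nat.find_spec hex, fun x h1 h2 => Nat.find_min' hex ⟨x, h1, h2, rfl⟩⟩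
  have hroot : ∀ Q : F[X], 0 < Q.natDegree → Q.natDegree < d → ∃ a : F, Q.IsRoot a := by
    intro Q h0 h1
    obtain ⟨r, hrr⟩ := IsAlgClosed.exists_aeval_eq_zero K Q (natDegree_pos_iff_degree_pos.1 h0).ne'
    have hQ0 : Q ≠ 0 := by rintro rfl; simp at h0
    have hint : IsIntegral F r := IsAlgebraic.isIntegral ⟨Q, hQ0, hrr⟩
    have hrF : r ∈ F := by
      by_contra hrF
      have := natDegree_le_of_dvd (minpoly.dvd F r hrr) hQ0
      have := hmin r hrF hint
      omega
    refine ⟨⟨r, hrF⟩, ?_⟩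
    have h2 : aeval (algebraMap F K ⟨r, hrF⟩) Q = 0 := hrr
    rw [aeval_algebraMap_apply, map_eq_zero] at h2
    simpa [IsRoot] using h2
  have hd0 : 0 < d := hd₁ ▸ minpoly.natDegree_pos hx₁
  have hdF : (d : F) ≠ 0 := by
    intro h
    have : ((d : F) : K) = 0 := by rw [h]; rfl
    simp at this
    omega
  set c : F := (minpoly F x₁).coeff (d - 1) / d with hc
  set x : K := x₁ - algebraMap F K (-c) with hxdef
  have hxF : x ∉ F := by
    intro h
    apply hx₁F
    have : x₁ = x + algebraMap F K (-c) := by rw [hxdef]; ring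
    rw [this]
    exact F.add_mem h (-c).2
  have hx : IsIntegral F x := hx₁.sub isIntegral_algebraMap
  have hshift : ∀ (w : K), IsIntegral F w → ∀ q : F, minpoly F (w - algebraMap F K q) =
      (minpoly F w).comp (X + C q) := fun w hw q => minpoly.sub_algebraMap w q
  have hdeg : ∀ q : F, (minpoly F (x - algebraMap F K q)).natDegree = d := by
    intro q
    rw [hshift x hx, natDegree_comp, natDegree_X_add_C, mul_one, hxdef, hshift x₁ hx₁,
      natDegree_comp, natDegree_X_add_C, mul_one, hd₁]
  have hdx : (minpoly F x).natDegree = d := by simpa using hdeg 0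
  have hcx : (minpoly F x).coeff (d - 1) = 0 := by
    have := coeff_comp_X_add_C_pred (minpoly.monic hx₁) (by omega) (-c)
    rw [hxdef, hshift x₁ hx₁, ← hd₁, this, hd₁, hc]
    field_simp
    ring
  have hint : ∀ q : F, IsIntegral F (x - algebraMap F K q) := fun q => hx.sub isIntegral_algebraMap
  have hbest : ∀ q : F, ‖x‖ ≤ ‖x - q‖ := by
    intro q
    have h1 := norm_coeff_minpoly_le F (hint q) (d - 1) (by rw [hdeg]; omega)
    have h2 := coeff_comp_X_add_C_pred (minpoly.monic hx) (by omega) q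
    rw [hdeg, hshift x hx, show d - (d - 1) = 1 by omega, pow_one] at h1
    rw [hdx, hcx, zero_add] at h2
    rw [h2] at h1
    have h3 : ‖((d : F) * q : F)‖ = ‖(q : K)‖ := by
      have h4 : ‖((d : F) * q : F)‖ = ‖(d : K) * (q : K)‖ := rfl
      rw [h4, norm_mul, ← map_natCast (algebraMap ℝ K),
        norm_algebraMap_real hr (by exact_mod_cast hd0.ne'), one_mul]
    rw [h3] at h1
    calc ‖x‖ = ‖(x - q) + q‖ := by rw [sub_add_cancel]
      _ ≤ max ‖x - q‖ ‖(q : K)‖ := IsUltrametricDist.norm_add_le_max _ _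
      _ ≤ _ := max_le le_rfl h1
  set P := minpoly F x with hP
  have hPm : P.Monic := minpoly.monic hx
  set ρ := ‖x‖ with hρdef
  have hρ : 0 < ρ := by
    refine norm_pos_iff.2 fun h => hxF ?_
    rw [h]; exact F.zero_mem
  have hder : ρ ^ (d - 1) ≤ ‖aeval x (derivative P)‖ := by
    have h1 : (derivative P).natDegree = d - 1 := by
      rw [natDegree_derivative, hdx]
    have h2 : (derivative P).leadingCoeff = d := by
      rw [leadingCoeff, h1, coeff_derivative, Nat.sub_add_cancel hd0, ← hdx, hPm.coeff_natDegree]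
      rw [hdx]
      have : ((d - 1 : ℕ) : F) + 1 = d := by
        exact_mod_cast congrArg (Nat.cast (R := F)) (Nat.sub_add_cancel hd0)
      rw [this, one_mul]
    have h3 := le_norm_aeval hroot hbest (derivative P) (by omega)
    have h4 : ‖(d : F)‖ = 1 := by
      have h4 : ‖(d : F)‖ = ‖(d : K)‖ := rfl
      rw [h4, ← map_natCast (algebraMap ℝ K),
        norm_algebraMap_real hr (by exact_mod_cast hd0.ne')]
    rwa [h2, h1, h4, one_mul] at h3
  have hder0 : aeval x (derivative P) ≠ 0 := norm_pos_iff.1 ((pow_pos hρ _).trans_le hder)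
  obtain ⟨y, hy0, hy⟩ := exists_eval₂_eq_zero (P := P) hs (minpoly.aeval F x) hder0
  set z : K[ε] := TrivSqZeroExt.inl x + TrivSqZeroExt.inr y with hz
  have hzf : z.fst = x := by simp [hz]
  have hzs : z.snd = y := by simp [hz]
  have hzgood : IsLogDual z := by
    right
    rw [hzf, hzs]
    set γ : K := algebraMap ℝ K (-Real.log ρ) with hγ
    have e0 : ∑ i ∈ Finset.range (d + 1), (P.coeff i : K) * x ^ i = 0 := by
      have := minpoly.aeval F x
      rw [aeval_eq_sum_range, ← hP, hdx] at this
      exact this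
    have e1 : x * aeval x (derivative P) =
        ∑ i ∈ Finset.range (d + 1), (i : K) * ((P.coeff i : K) * x ^ i) := by
      rw [aeval_eq_sum_range' (n := d), Finset.sum_range_succ', Finset.mul_sum]
      · simp only [Nat.cast_zero, zero_mul, add_zero]
        refine Finset.sum_congr rfl fun i _ => ?_
        rw [coeff_derivative, Algebra.smul_def]
        have : algebraMap F K (P.coeff (i + 1) * (i + 1)) = (P.coeff (i + 1) : K) * (i + 1) := by
          rw [map_mul, map_add, map_natCast, map_one]; rfl
        rw [this]
        push_cast
        ring
      · exact (natDegree_derivative_lt (by omega)).trans_eq hdx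
    have e2 : (y - γ * x) * aeval x (derivative P) =
        - ∑ i ∈ Finset.range d, ((s (P.coeff i)).snd -
          (-Real.log (ρ ^ (d - i))) • (s (P.coeff i)).fst) * x ^ i := by
      have e3 : ∀ i ∈ Finset.range d, ((s (P.coeff i)).snd -
          (-Real.log (ρ ^ (d - i))) • (s (P.coeff i)).fst) * x ^ i =
          (s (P.coeff i)).snd * x ^ i - γ * d * ((P.coeff i : K) * x ^ i) +
            γ * (i * ((P.coeff i : K) * x ^ i)) := by
        intro i hi
        have hid : i ≤ d := (Finset.mem_range.1 hi).le
        rw [hs, Real.log_pow, Nat.cast_sub hid, real_smul_eq, hγ]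
        simp only [map_neg, map_mul, map_sub, map_natCast]
        ring
      rw [Finset.sum_congr rfl e3, Finset.sum_add_distrib, Finset.sum_sub_distrib,
        ← Finset.mul_sum, ← Finset.mul_sum]
      rw [Finset.sum_range_succ] at e0 e1
      rw [hdx, Finset.sum_range_succ] at hy
      have hcd : P.coeff d = 1 := by rw [← hdx]; exact hPm
      rw [hcd, map_one, TrivSqZeroExt.snd_one, zero_mul, add_zero] at hy
      rw [sub_mul, hy, mul_assoc, e1]
      linear_combination -(γ * d) * e0
    have e4 : ‖(y - γ * x) * aeval x (derivative P)‖ < ρ ^ d := by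
      rw [e2, norm_neg]
      refine norm_sum_lt_of_forall_lt _ (by positivity) fun i hi => ?_
      have hid : i < d := Finset.mem_range.1 hi
      have h5 : ‖(s (P.coeff i)).fst‖ ≤ ρ ^ (d - i) := by
        rw [hs]
        have := norm_coeff_minpoly_le F hx i (by rw [← hP, hdx]; exact hid)
        rwa [← hP, hdx] at this
      have h6 := (hg (P.coeff i)).norm_sub_lt hr (pow_pos hρ _) h5
      rw [norm_mul, norm_pow, ← hρdef]
      calc _ < ρ ^ (d - i) * ρ ^ i := by gcongr
        _ = _ := by rw [← pow_add, Nat.sub_add_cancel hid.le]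
    rw [norm_mul] at e4
    rw [real_smul_eq]
    by_contra! h7
    have : ρ * ρ ^ (d - 1) ≤ ‖y - γ * x‖ * ‖aeval x (derivative P)‖ := by gcongr
    rw [← pow_succ', Nat.sub_add_cancel hd0] at this
    linarith
  have hall := isLogDual_sub_of_best_approximation hr hs hg (z := z)
    (fun q => ⟨0, by rw [hzf]; simpa using hbest q, by simpa using hzgood⟩)
  refine ⟨z, by rwa [hzf], fun Q => ?_⟩
  rw [← modByMonic_add_div Q P, eval₂_add, eval₂_mul, hy0, zero_mul, add_zero]
  exact isLogDual_eval₂ hg hroot hall _ (by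
    rw [← hdx]; exact natDegree_modByMonic_lt _ hPm (fun h => by rw [h] at hdx; simp at hdx; omega))

lemma exists_isLogDual_transcendental (hr : ∀ r : ℝ, ‖algebraMap ℝ K r‖ ≤ 1)
    (hsph : ∀ (c : ℕ → K) (ρ : ℕ → ℝ), Antitone ρ → (∀ i j, i ≤ j → ‖c j - c i‖ < ρ i) →
      ∃ y, ∀ i, ‖y - c i‖ ≤ ρ i)
    {F : Subfield K} {s : F →+* K[ε]} (hs : ∀ a, (s a).fst = a)
    (hg : ∀ a, IsLogDual (s a)) (hroot : ∀ Q : F[X], 0 < Q.natDegree → ∃ a : F, Q.IsRoot a)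
    {x : K} (hx : x ∉ F) :
    ∃ z : K[ε], z.fst = x ∧ ∀ Q : F[X], IsLogDual (Q.eval₂ s z) := by
  have hne : ∀ q : F, x - q ≠ 0 := fun q h => hx (by rw [sub_eq_zero.1 h]; exact q.2)
  suffices ∃ y : K, ∀ q : F, ∃ q' : F, ‖x - q'‖ ≤ ‖x - q‖ ∧
      ‖y - ((s q').snd + (-Real.log ‖x - q'‖) • (x - q'))‖ < ‖x - q'‖ by
    obtain ⟨y, hy⟩ := this
    refine ⟨TrivSqZeroExt.inl x + TrivSqZeroExt.inr y, by simp, fun Q => ?_⟩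
    refine isLogDual_eval₂ hg (d := Q.natDegree + 1) (fun Q h _ => hroot Q h)
      (isLogDual_sub_of_best_approximation hr hs hg fun q => ?_) Q (Nat.lt_succ_self _)
    obtain ⟨q', h1, h2⟩ := hy q
    refine ⟨q', by simpa using h1, Or.inr ?_⟩
    simp only [TrivSqZeroExt.snd_sub, TrivSqZeroExt.fst_sub, TrivSqZeroExt.fst_add,
      TrivSqZeroExt.snd_add, TrivSqZeroExt.fst_inl, TrivSqZeroExt.fst_inr, TrivSqZeroExt.snd_inl,
      TrivSqZeroExt.snd_inr, zero_add, add_zero, hs]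
    rwa [sub_sub]
  by_cases hatt : ∃ q₀ : F, ∀ q : F, ‖x - q₀‖ ≤ ‖x - q‖
  · obtain ⟨q₀, h₀⟩ := hatt
    refine ⟨(s q₀).snd + (-Real.log ‖x - q₀‖) • (x - q₀), fun q => ⟨q₀, h₀ q, ?_⟩⟩
    rw [sub_self, norm_zero]
    exact norm_pos_iff.2 (hne q₀)
  · push Not at hatt
    set S : Set ℝ := range fun q : F => ‖x - q‖ with hS
    have hbdd : BddBelow S := ⟨0, by rintro _ ⟨q, rfl⟩; exact norm_nonneg _⟩
    obtain ⟨u, hu, hlim, hmem⟩ := exists_seq_tendsto_sInf (range_nonempty _) hbdd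
    choose q hq using hmem
    have hlt : ∀ a : F, ∀ᶠ i in atTop, u i < ‖x - a‖ := by
      intro a
      obtain ⟨b, hb⟩ := hatt a
      exact hlim.eventually_lt_const ((csInf_le hbdd ⟨b, rfl⟩).trans_lt hb)
    set c : ℕ → K := fun i => (s (q i)).snd + (-Real.log (u i)) • (x - q i) with hc
    have hcc : ∀ i j, i ≤ j → ‖c j - c i‖ < u i := by
      intro i j hij
      have hpos : 0 < u i := by rw [← hq i]; exact norm_pos_iff.2 (hne _)
      have h1 : ‖(s (q j - q i)).fst‖ ≤ u i := by
        have : (s (q j - q i)).fst = (x - q i) - (x - q j) := by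
          rw [hs]; simp
        rw [this]
        refine norm_sub_le_of_le_of_le (hq i).le ?_
        exact (hq j).le.trans (hu hij)
      have h2 := (hg (q j - q i)).norm_sub_lt hr hpos h1
      have h3 : ‖(-Real.log (u j) - -Real.log (u i)) • (x - (q j : K))‖ < u i := by
        rcases (hu hij).eq_or_lt with h | h
        · rw [h, sub_self, zero_smul, norm_zero]; exact hpos
        · exact (norm_real_smul_le hr _ _).trans_lt ((hq j).trans_lt h)
      refine lt_of_eq_of_lt ?_ (norm_add_lt_of_lt h2 h3)
      congr 1
      rw [hs]
      simp only [hc, map_sub, TrivSqZeroExt.snd_sub, real_smul_eq, map_neg, AddSubgroupClass.coe_sub]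
      ring
    obtain ⟨y, hy⟩ := hsph c u hu hcc
    refine ⟨y, fun a => ?_⟩
    obtain ⟨i, hi⟩ := (hlt a).exists
    refine ⟨q i, (hq i).le.trans hi.le, ?_⟩
    obtain ⟨j, hj, hij⟩ := ((hlt (q i)).and (eventually_ge_atTop i)).exists
    have e : ‖x - (q i : K)‖ = u i := hq i
    rw [e] at hj ⊢
    have := norm_add_lt_of_lt ((hy j).trans_lt hj) (hcc i j hij)
    rwa [sub_add_sub_cancel] at this

end LogDerivationAdjunction

section LogDerivationMaximal

open Polynomial DualNumber

variable {K : Type*} [NormedField K] [Algebra ℝ K] [IsUltrametricDist K]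

lemma isLogDual_of_mem_closure (hr : ∀ r : ℝ, ‖algebraMap ℝ K r‖ ≤ 1) {G : Set K[ε]}
    (hG : ∀ z ∈ G, IsLogDual z) {z : K[ε]} (hz : z ∈ closure G) : IsLogDual z := by
  have key : ∀ e : ℝ, 0 < e → ∃ w ∈ G, ‖z.fst - w.fst‖ < e ∧ ‖z.snd - w.snd‖ < e := by
    intro e he
    have h1 : ∀ᶠ w in 𝓝 z, ‖z.fst - w.fst‖ < e := by
      have : Tendsto (fun w : K[ε] => ‖z.fst - w.fst‖) (𝓝 z) (𝓝 ‖z.fst - z.fst‖) :=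
        ((continuous_const.sub TrivSqZeroExt.continuous_fst).norm).tendsto z
      exact this.eventually_lt_const (by simpa using he)
    have h2 : ∀ᶠ w in 𝓝 z, ‖z.snd - w.snd‖ < e := by
      have : Tendsto (fun w : K[ε] => ‖z.snd - w.snd‖) (𝓝 z) (𝓝 ‖z.snd - z.snd‖) :=
        ((continuous_const.sub TrivSqZeroExt.continuous_snd).norm).tendsto z
      exact this.eventually_lt_const (by simpa using he)
    obtain ⟨w, hw, h1, h2⟩ :=
      ((mem_closure_iff_frequently.1 hz).and_eventually (h1.and h2)).exists
    exact ⟨w, hw, h1, h2⟩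
  by_cases h0 : z.fst = 0
  · left
    ext
    · simpa using h0
    · rw [TrivSqZeroExt.snd_zero, ← norm_le_zero_iff]
      refine le_of_forall_gt_imp_ge_of_dense fun e he => ?_
      obtain ⟨w, hw, h1, h2⟩ := key e he
      rw [h0, zero_sub, norm_neg] at h1
      have := norm_add_lt_of_lt h2 (((hG w hw).norm_snd_le hr).trans_lt h1)
      rw [sub_add_cancel] at this
      exact this.le
  · right
    have hρ := norm_pos_iff.2 h0
    obtain ⟨w, hw, h1, h2⟩ := key _ hρ
    have h3 : ‖w.fst‖ ≤ ‖z.fst‖ := by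
      have := norm_sub_le_of_le_of_le (le_refl ‖z.fst‖) h1.le
      rwa [sub_sub_cancel] at this
    have h4 := norm_add_lt_of_lt (norm_add_lt_of_lt h2
      ((norm_real_smul_le hr (Real.log ‖z.fst‖) _).trans_lt h1)) ((hG w hw).norm_sub_lt hr hρ h3)
    convert h4 using 2
    simp only [real_smul_eq, map_neg]
    ring

theorem exists_subring_isLogDual (hr : ∀ r : ℝ, ‖algebraMap ℝ K r‖ ≤ 1)
    (hsph : ∀ (c : ℕ → K) (ρ : ℕ → ℝ), Antitone ρ → (∀ i j, i ≤ j → ‖c j - c i‖ < ρ i) →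
      ∃ y, ∀ i, ‖y - c i‖ ≤ ρ i)
    [IsAlgClosed K] [CompleteSpace K] (G₀ : Subring K[ε]) (h₀ : ∀ z ∈ G₀, IsLogDual z) :
    ∃ G : Subring K[ε], G₀ ≤ G ∧ (∀ z ∈ G, IsLogDual z) ∧
      ∀ x : K, ∃ y : K, TrivSqZeroExt.inl x + TrivSqZeroExt.inr y ∈ G := by
  obtain ⟨G, hG₀, hmax⟩ := zorn_le_nonempty₀ {G : Subring K[ε] | ∀ z ∈ G, IsLogDual z}
    (fun c hc hchain G₁ hG₁ => ⟨sSup c, fun z hz => by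
      obtain ⟨G, hG, hzG⟩ := (Subring.mem_sSup_of_directedOn ⟨G₁, hG₁⟩ hchain.directedOn).1 hz
      exact hc hG z hzG, fun G hG => le_sSup hG⟩) G₀ h₀
  have hG : ∀ z ∈ G, IsLogDual z := hmax.prop
  refine ⟨G, hG₀, hG, ?_⟩
  have hinv : ∀ b ∈ G, b.fst ≠ 0 → b⁻¹ ∈ G := by
    let G' : Subring K[ε] :=
      { carrier := {z | ∃ b ∈ G, b.fst ≠ 0 ∧ z * b ∈ G}
        mul_mem' := by
          rintro z w ⟨b, hb, hb0, hzb⟩ ⟨c, hc, hc0, hwc⟩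
          refine ⟨b * c, G.mul_mem hb hc, by simp [hb0, hc0], ?_⟩
          rw [mul_mul_mul_comm]
          exact G.mul_mem hzb hwc
        one_mem' := ⟨1, G.one_mem, by simp, by simp⟩
        add_mem' := by
          rintro z w ⟨b, hb, hb0, hzb⟩ ⟨c, hc, hc0, hwc⟩
          refine ⟨b * c, G.mul_mem hb hc, by simp [hb0, hc0], ?_⟩
          have : (z + w) * (b * c) = z * b * c + w * c * b := by ring
          rw [this]
          exact G.add_mem (G.mul_mem hzb hc) (G.mul_mem hwc hb)
        zero_mem' := ⟨1, G.one_mem, by simp, by simp⟩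
        neg_mem' := by
          rintro z ⟨b, hb, hb0, hzb⟩
          exact ⟨b, hb, hb0, by simpa using hzb⟩ }
    have hle : G' ≤ G := hmax.le_of_ge (y := G')
      (fun z ⟨b, hb, hb0, hzb⟩ => (hG _ hzb).of_mul (hG b hb) hb0)
      (fun z hz => ⟨1, G.one_mem, by simp, by simpa using hz⟩)
    intro b hb hb0
    refine hle ⟨b, hb, hb0, ?_⟩
    rw [TrivSqZeroExt.inv_mul_cancel hb0]
    exact G.one_mem
  let F : Subfield K :=
    { (G.map (TrivSqZeroExt.fstHom K K K).toRingHom) with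
      inv_mem' := by
        rintro _ ⟨b, hb, rfl⟩
        by_cases hb0 : b.fst = 0
        · refine ⟨0, G.zero_mem, ?_⟩
          change TrivSqZeroExt.fst 0 = b.fst⁻¹
          simp [hb0]
        · exact ⟨b⁻¹, hinv b hb hb0, TrivSqZeroExt.fst_inv b⟩ }
  have hmem : ∀ a : F, ∃ z ∈ G, z.fst = a := fun a => a.2
  choose s' hs'G hs' using hmem
  have huniq : ∀ z ∈ G, ∀ w ∈ G, z.fst = w.fst → z = w := fun z hz w hw h =>
    sub_eq_zero.1 ((hG _ (G.sub_mem hz hw)).eq_zero (by simp [h]))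
  let s : F →+* K[ε] :=
    { toFun := s'
      map_one' := huniq _ (hs'G _) _ G.one_mem (by rw [hs']; rfl)
      map_zero' := huniq _ (hs'G _) _ G.zero_mem (by rw [hs']; rfl)
      map_mul' := fun a b => huniq _ (hs'G _) _ (G.mul_mem (hs'G a) (hs'G b))
        (by rw [TrivSqZeroExt.fst_mul, hs', hs', hs']; rfl)
      map_add' := fun a b => huniq _ (hs'G _) _ (G.add_mem (hs'G a) (hs'G b))
        (by rw [TrivSqZeroExt.fst_add, hs', hs', hs']; rfl) }
  have hs : ∀ a, (s a).fst = a := hs'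
  have hsG : ∀ a, s a ∈ G := hs'G
  have hg : ∀ a, IsLogDual (s a) := fun a => hG _ (hsG a)
  have hFG : ∀ z ∈ G, ∃ a : F, s a = z := fun z hz =>
    ⟨⟨z.fst, z, hz, rfl⟩, huniq _ (hsG _) _ hz (hs _)⟩
  have hclosed : IsClosed (G : Set K[ε]) := by
    have := hmax.le_of_ge (y := G.topologicalClosure)
      (fun z hz => isLogDual_of_mem_closure hr hG hz) G.le_topologicalClosure
    exact isClosed_of_closure_subset this
  have hFclosed : IsClosed (F : Set K) := by
    refine isClosed_of_closure_subset fun x hx => ?_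
    obtain ⟨u, hu, hlim⟩ := mem_closure_iff_seq_limit.1 hx
    have hcau : CauchySeq fun n => (s ⟨u n, hu n⟩).snd := by
      rw [Metric.cauchySeq_iff]
      intro e he
      obtain ⟨N, hN⟩ := Metric.cauchySeq_iff.1 hlim.cauchySeq e he
      refine ⟨N, fun m hm n hn => lt_of_le_of_lt ?_ (hN m hm n hn)⟩
      have := (hg (⟨u m, hu m⟩ - ⟨u n, hu n⟩)).norm_snd_le hr
      rw [hs, map_sub, TrivSqZeroExt.snd_sub] at this
      rw [dist_eq_norm, dist_eq_norm]
      exact this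
    obtain ⟨y, hy⟩ := cauchySeq_tendsto_of_complete hcau
    have : Tendsto (fun n => s ⟨u n, hu n⟩) atTop
        (𝓝 (TrivSqZeroExt.inl x + TrivSqZeroExt.inr y)) := by
      have h1 := ((TrivSqZeroExt.continuous_inl (R := K) (M := K)).tendsto x).comp hlim
      have h2 := ((TrivSqZeroExt.continuous_inr (R := K) (M := K)).tendsto y).comp hy
      refine (h1.add h2).congr fun n => ?_
      ext <;> simp [hs]
    exact ⟨_, hclosed.mem_of_tendsto this (Eventually.of_forall fun n => hsG _), by
      change TrivSqZeroExt.fst _ = x; simp⟩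
  have _ : CompleteSpace F := hFclosed.completeSpace_coe
  have hadj : ∀ z : K[ε], (∀ Q : F[X], IsLogDual (Q.eval₂ s z)) → z.fst ∈ F := by
    intro z hz
    have hle : (eval₂RingHom s z).range ≤ G := hmax.le_of_ge (y := (eval₂RingHom s z).range)
      (by rintro _ ⟨Q, rfl⟩; exact hz Q) (fun w hw => by
        obtain ⟨a, rfl⟩ := hFG w hw
        exact ⟨C a, by simp⟩)
    exact ⟨z, hle ⟨X, by simp⟩, rfl⟩
  have halg : ∀ x : K, IsIntegral F x → x ∈ F := by
    intro x hx
    by_contra hxF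
    obtain ⟨z, hzF, hz⟩ := exists_isLogDual_algebraic hr hs hg ⟨x, hxF, hx⟩
    exact hzF (hadj z hz)
  have hroot : ∀ Q : F[X], 0 < Q.natDegree → ∃ a : F, Q.IsRoot a := by
    intro Q h0
    obtain ⟨r, hrr⟩ := IsAlgClosed.exists_aeval_eq_zero K Q (natDegree_pos_iff_degree_pos.1 h0).ne'
    have hQ0 : Q ≠ 0 := by rintro rfl; simp at h0
    have hrF : r ∈ F := halg r (IsAlgebraic.isIntegral ⟨Q, hQ0, hrr⟩)
    refine ⟨⟨r, hrF⟩, ?_⟩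
    have h2 : aeval (algebraMap F K ⟨r, hrF⟩) Q = 0 := hrr
    rw [aeval_algebraMap_apply, map_eq_zero] at h2
    simpa [IsRoot] using h2
  intro x
  have hxF : x ∈ F := by
    by_contra hxF
    obtain ⟨z, rfl, hz⟩ := exists_isLogDual_transcendental hr hsph hs hg hroot hxF
    exact hxF (hadj z hz)
  refine ⟨(s ⟨x, hxF⟩).snd, ?_⟩
  convert hsG ⟨x, hxF⟩
  ext <;> simp [hs]

end LogDerivationMaximal

section AsymptoticField

/-- A sequence of positive exponents tending to zero, used to measure the size of complex sequences
by `‖a k‖ ^ rate k`. -/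
structure AsympScale where
  /-- The exponents. -/
  rate : ℕ → ℝ
  pos : ∀ k, 0 < rate k
  tendsto : Tendsto rate atTop (𝓝 0)

namespace AsympScale

variable (σ : AsympScale)

lemma tendsto_hyperfilter : Tendsto σ.rate (hyperfilter ℕ) (𝓝 0) :=
  σ.tendsto.mono_left Nat.hyperfilter_le_atTop

lemma tendsto_const_rpow {c : ℝ} (hc : 0 < c) :
    Tendsto (fun k => c ^ σ.rate k) (hyperfilter ℕ) (𝓝 1) := by
  have := (Real.continuous_const_rpow hc.ne').tendsto 0
  rw [Real.rpow_zero] at this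
  exact this.comp σ.tendsto_hyperfilter

/-- The sequence `a` has a size bounded with respect to the scale. -/
def IsModerate (a : ℕ → ℂ) : Prop :=
  ∃ C : ℝ, ∀ᶠ k in hyperfilter ℕ, ‖a k‖ ^ σ.rate k ≤ C

/-- The size of a sequence. -/
def size (a : ℕ → ℂ) : ℝ := limUnder (hyperfilter ℕ : Filter ℕ) fun k => ‖a k‖ ^ σ.rate k

variable {σ}

lemma IsModerate.tendsto {a : ℕ → ℂ} (ha : σ.IsModerate a) :
    Tendsto (fun k => ‖a k‖ ^ σ.rate k) (hyperfilter ℕ) (𝓝 (σ.size a)) := by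
  obtain ⟨C, hC⟩ := ha
  refine tendsto_nhds_limUnder ?_
  have hmem : ∀ᶠ k in hyperfilter ℕ, ‖a k‖ ^ σ.rate k ∈ Icc 0 C :=
    hC.mono fun k hk => ⟨by positivity, hk⟩
  obtain ⟨x, -, hx⟩ := isCompact_Icc.ultrafilter_le_nhds
    ((hyperfilter ℕ).map fun k => ‖a k‖ ^ σ.rate k) (le_principal_iff.2 hmem)
  exact ⟨x, hx⟩

lemma size_eq_of_tendsto {a : ℕ → ℂ} {x : ℝ}
    (h : Tendsto (fun k => ‖a k‖ ^ σ.rate k) (hyperfilter ℕ) (𝓝 x)) : σ.size a = x :=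
  h.limUnder_eq

lemma isModerate_of_tendsto {a : ℕ → ℂ} {x : ℝ}
    (h : Tendsto (fun k => ‖a k‖ ^ σ.rate k) (hyperfilter ℕ) (𝓝 x)) : σ.IsModerate a :=
  ⟨x + 1, (h.eventually_lt_const (lt_add_one x)).mono fun _ => le_of_lt⟩

lemma tendsto_const {c : ℂ} (hc : c ≠ 0) :
    Tendsto (fun k => ‖(fun _ => c : ℕ → ℂ) k‖ ^ σ.rate k) (hyperfilter ℕ) (𝓝 1) :=
  σ.tendsto_const_rpow (norm_pos_iff.2 hc)

lemma tendsto_of_eventually_eq_zero {a : ℕ → ℂ} (h : ∀ᶠ k in hyperfilter ℕ, a k = 0) :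
    Tendsto (fun k => ‖a k‖ ^ σ.rate k) (hyperfilter ℕ) (𝓝 0) := by
  refine tendsto_const_nhds.congr' (h.mono fun k hk => ?_)
  simp only [hk, norm_zero, Real.zero_rpow (σ.pos k).ne']

lemma isModerate_const (c : ℂ) : σ.IsModerate fun _ => c := by
  by_cases hc : c = 0
  · exact isModerate_of_tendsto (tendsto_of_eventually_eq_zero (Eventually.of_forall fun _ => hc))
  · exact isModerate_of_tendsto (tendsto_const hc)

lemma size_const {c : ℂ} (hc : c ≠ 0) : σ.size (fun _ => c) = 1 :=
  size_eq_of_tendsto (tendsto_const hc)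

lemma IsModerate.of_le {a b : ℕ → ℂ} (hb : σ.IsModerate b)
    (h : ∀ᶠ k in hyperfilter ℕ, ‖a k‖ ≤ ‖b k‖) : σ.IsModerate a := by
  obtain ⟨C, hC⟩ := hb
  refine ⟨C, ?_⟩
  filter_upwards [hC, h] with k h1 h2
  exact (Real.rpow_le_rpow (norm_nonneg _) h2 (σ.pos k).le).trans h1

lemma IsModerate.tendsto_mul {a b : ℕ → ℂ} (ha : σ.IsModerate a) (hb : σ.IsModerate b) :
    Tendsto (fun k => ‖(a * b) k‖ ^ σ.rate k) (hyperfilter ℕ) (𝓝 (σ.size a * σ.size b)) := by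
  refine (ha.tendsto.mul hb.tendsto).congr fun k => ?_
  rw [Pi.mul_apply, norm_mul, Real.mul_rpow (norm_nonneg _) (norm_nonneg _)]

lemma IsModerate.mul {a b : ℕ → ℂ} (ha : σ.IsModerate a) (hb : σ.IsModerate b) :
    σ.IsModerate (a * b) := isModerate_of_tendsto (ha.tendsto_mul hb)

lemma IsModerate.size_mul {a b : ℕ → ℂ} (ha : σ.IsModerate a) (hb : σ.IsModerate b) :
    σ.size (a * b) = σ.size a * σ.size b := size_eq_of_tendsto (ha.tendsto_mul hb)

lemma norm_add_rpow_le {r : ℝ} (hr : 0 < r) (x y : ℂ) :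
    ‖x + y‖ ^ r ≤ 2 ^ r * max (‖x‖ ^ r) (‖y‖ ^ r) := by
  have h1 : ‖x + y‖ ≤ 2 * max ‖x‖ ‖y‖ := by
    have := norm_add_le x y
    have := le_max_left ‖x‖ ‖y‖
    have := le_max_right ‖x‖ ‖y‖
    linarith
  have h2 : (max ‖x‖ ‖y‖) ^ r = max (‖x‖ ^ r) (‖y‖ ^ r) := by
    rcases le_total ‖x‖ ‖y‖ with h | h
    · rw [max_eq_right h, max_eq_right (Real.rpow_le_rpow (norm_nonneg _) h hr.le)]
    · rw [max_eq_left h, max_eq_left (Real.rpow_le_rpow (norm_nonneg _) h hr.le)]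
  rw [← h2, ← Real.mul_rpow (by norm_num) (by positivity)]
  exact Real.rpow_le_rpow (norm_nonneg _) h1 hr.le

lemma IsModerate.tendsto_max {a b : ℕ → ℂ} (ha : σ.IsModerate a) (hb : σ.IsModerate b) :
    Tendsto (fun k => (2 : ℝ) ^ σ.rate k * max (‖a k‖ ^ σ.rate k) (‖b k‖ ^ σ.rate k))
      (hyperfilter ℕ) (𝓝 (max (σ.size a) (σ.size b))) := by
  simpa using (σ.tendsto_const_rpow two_pos).mul (ha.tendsto.max hb.tendsto)

lemma IsModerate.add {a b : ℕ → ℂ} (ha : σ.IsModerate a) (hb : σ.IsModerate b) :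
    σ.IsModerate (a + b) :=
  ⟨_, ((ha.tendsto_max hb).eventually_lt_const (lt_add_one _)).mono fun k hk =>
    (norm_add_rpow_le (σ.pos k) (a k) (b k)).trans hk.le⟩

lemma IsModerate.size_add_le {a b : ℕ → ℂ} (ha : σ.IsModerate a) (hb : σ.IsModerate b) :
    σ.size (a + b) ≤ max (σ.size a) (σ.size b) :=
  le_of_tendsto_of_tendsto (ha.add hb).tendsto (ha.tendsto_max hb)
    (Eventually.of_forall fun k => norm_add_rpow_le (σ.pos k) (a k) (b k))

lemma IsModerate.neg {a : ℕ → ℂ} (ha : σ.IsModerate a) : σ.IsModerate (-a) :=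
  ha.of_le (Eventually.of_forall fun k => by simp)

lemma IsModerate.size_nonneg {a : ℕ → ℂ} (ha : σ.IsModerate a) : 0 ≤ σ.size a :=
  ge_of_tendsto ha.tendsto (Eventually.of_forall fun k => by positivity)

lemma IsModerate.tendsto_inv {a : ℕ → ℂ} (ha : σ.IsModerate a) (h : σ.size a ≠ 0) :
    Tendsto (fun k => ‖a⁻¹ k‖ ^ σ.rate k) (hyperfilter ℕ) (𝓝 (σ.size a)⁻¹) := by
  refine (ha.tendsto.inv₀ h).congr fun k => ?_
  rw [Pi.inv_apply, norm_inv, Real.inv_rpow (norm_nonneg _)]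

lemma IsModerate.eventually_ne_zero {a : ℕ → ℂ} (ha : σ.IsModerate a) (h : σ.size a ≠ 0) :
    ∀ᶠ k in hyperfilter ℕ, a k ≠ 0 :=
  (ha.tendsto.eventually_ne h).mono fun k hk h0 => hk (by
    rw [h0, norm_zero, Real.zero_rpow (σ.pos k).ne'])

variable (σ)

/-- The ring of moderate sequences. -/
def moderate : Subring (ℕ → ℂ) where
  carrier := {a | σ.IsModerate a}
  mul_mem' ha hb := ha.mul hb
  one_mem' := isModerate_const 1
  add_mem' ha hb := ha.add hb
  zero_mem' := isModerate_const 0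
  neg_mem' ha := ha.neg

/-- The ideal of moderate sequences of size zero. -/
def negligible : Ideal σ.moderate where
  carrier := {a | σ.size a = 0}
  add_mem' {a b} ha hb := by
    have := IsModerate.size_add_le a.2 b.2
    rw [ha, hb, max_self] at this
    exact le_antisymm this (a.2.add b.2).size_nonneg
  zero_mem' := size_eq_of_tendsto (tendsto_of_eventually_eq_zero (Eventually.of_forall fun _ => rfl))
  smul_mem' c a ha := by
    change σ.size (c.1 * a.1) = 0
    rw [IsModerate.size_mul c.2 a.2, ha, mul_zero]

lemma mem_negligible {a : σ.moderate} : a ∈ σ.negligible ↔ σ.size a = 0 := Iff.rfl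

lemma negligible_of_eventually_eq_zero {a : σ.moderate}
    (h : ∀ᶠ k in hyperfilter ℕ, (a : ℕ → ℂ) k = 0) : a ∈ σ.negligible :=
  size_eq_of_tendsto (tendsto_of_eventually_eq_zero h)

/-- The field of moderate sequences modulo negligible ones. -/
def Quot : Type := σ.moderate ⧸ σ.negligible

instance instCommRingQuot : CommRing σ.Quot :=
  inferInstanceAs (CommRing (σ.moderate ⧸ σ.negligible))

/-- The class of a moderate sequence. -/
def cls : σ.moderate →+* σ.Quot := Ideal.Quotient.mk σ.negligible

lemma cls_surjective : Function.Surjective σ.cls := Ideal.Quotient.mk_surjective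

lemma cls_eq_zero {a : σ.moderate} : σ.cls a = 0 ↔ σ.size a = 0 :=
  Ideal.Quotient.eq_zero_iff_mem

lemma cls_eq_of_eventually {a b : σ.moderate}
    (h : ∀ᶠ k in hyperfilter ℕ, (a : ℕ → ℂ) k = (b : ℕ → ℂ) k) : σ.cls a = σ.cls b := by
  rw [← sub_eq_zero, ← map_sub, cls_eq_zero]
  exact σ.negligible_of_eventually_eq_zero (h.mono fun k hk => sub_eq_zero.2 hk)

instance instFieldQuot : Field σ.Quot :=
  IsField.toField
    { exists_pair_ne := ⟨0, 1, fun h => by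
        have := σ.cls_eq_zero.1 ((map_one σ.cls).trans h.symm)
        have h1 : σ.size ((1 : σ.moderate) : ℕ → ℂ) = 1 := size_const one_ne_zero
        rw [h1] at this
        exact one_ne_zero this⟩
      mul_comm := mul_comm
      mul_inv_cancel := by
        intro x hx
        obtain ⟨a, rfl⟩ := σ.cls_surjective x
        have ha : σ.size a ≠ 0 := fun h => hx (σ.cls_eq_zero.2 h)
        refine ⟨σ.cls ⟨(a : ℕ → ℂ)⁻¹, isModerate_of_tendsto (a.2.tendsto_inv ha)⟩, ?_⟩
        rw [← map_mul, ← map_one σ.cls]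
        refine σ.cls_eq_of_eventually ((a.2.eventually_ne_zero ha).mono fun k hk => ?_)
        exact mul_inv_cancel₀ hk }

lemma size_eq_of_sub_mem {a b : σ.moderate} (h : a - b ∈ σ.negligible) :
    σ.size a = σ.size b := by
  have key : ∀ a b : σ.moderate, a - b ∈ σ.negligible → σ.size a ≤ σ.size b := by
    intro a b h
    have h1 := IsModerate.size_add_le (a - b).2 b.2
    have h2 : ((a - b : σ.moderate) : ℕ → ℂ) + b = a := by simp
    rw [h2, (σ.mem_negligible).1 h] at h1
    exact h1.trans (max_le b.2.size_nonneg le_rfl)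
  refine le_antisymm (key a b h) (key b a ?_)
  rw [← neg_sub]
  exact neg_mem h

/-- The absolute value on the field of moderate sequences modulo negligible ones. -/
def quotAbs : AbsoluteValue σ.Quot ℝ where
  toFun := Quotient.lift (fun a : σ.moderate => σ.size a) fun a b h =>
    σ.size_eq_of_sub_mem ((Submodule.quotientRel_def _).1 h)
  nonneg' x := by
    obtain ⟨a, rfl⟩ := σ.cls_surjective x
    exact a.2.size_nonneg
  add_le' x y := by
    obtain ⟨a, rfl⟩ := σ.cls_surjective x
    obtain ⟨b, rfl⟩ := σ.cls_surjective y
    exact (IsModerate.size_add_le a.2 b.2).trans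
      (max_le_add_of_nonneg a.2.size_nonneg b.2.size_nonneg)
  map_mul' x y := by
    obtain ⟨a, rfl⟩ := σ.cls_surjective x
    obtain ⟨b, rfl⟩ := σ.cls_surjective y
    exact IsModerate.size_mul a.2 b.2
  eq_zero' x := by
    obtain ⟨a, rfl⟩ := σ.cls_surjective x
    exact σ.cls_eq_zero.symm

instance instNormedFieldQuot : NormedField σ.Quot := σ.quotAbs.toNormedField

lemma norm_cls (a : σ.moderate) : ‖σ.cls a‖ = σ.size a := rfl

instance instIsUltrametricDistQuot : IsUltrametricDist σ.Quot :=
  IsUltrametricDist.isUltrametricDist_of_forall_norm_add_le_max_norm fun x y => by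
    obtain ⟨a, rfl⟩ := σ.cls_surjective x
    obtain ⟨b, rfl⟩ := σ.cls_surjective y
    exact IsModerate.size_add_le a.2 b.2

/-- Constant sequences. -/
def const : ℂ →+* σ.moderate where
  toFun c := ⟨fun _ => c, isModerate_const c⟩
  map_one' := rfl
  map_mul' _ _ := rfl
  map_zero' := rfl
  map_add' _ _ := rfl

instance instAlgebraQuot : Algebra ℝ σ.Quot :=
  ((σ.cls.comp σ.const).comp (algebraMap ℝ ℂ)).toAlgebra

lemma norm_algebraMap_quot_le (r : ℝ) : ‖algebraMap ℝ σ.Quot r‖ ≤ 1 := by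
  by_cases hr : r = 0
  · simp [hr]
  · exact (size_const (Complex.ofReal_ne_zero.2 hr)).le

lemma quot_spherically_complete (c : ℕ → σ.Quot) (ρ : ℕ → ℝ)
    (h : ∀ i j, i ≤ j → ‖c j - c i‖ < ρ i) : ∃ y, ∀ i, ‖y - c i‖ ≤ ρ i := by
  choose a ha using fun i => σ.cls_surjective (c i)
  have hlt : ∀ i j, i ≤ j → ∀ᶠ k in hyperfilter ℕ,
      ‖(a j : ℕ → ℂ) k - (a i : ℕ → ℂ) k‖ ^ σ.rate k < ρ i := by
    intro i j hij
    have h1 := h i j hij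
    rw [← ha, ← ha, ← map_sub, norm_cls] at h1
    exact (a j - a i).2.tendsto.eventually_lt_const h1
  classical
  let P : ℕ → ℕ → Prop := fun k m => ∀ i j, i ≤ j → j ≤ m →
      ‖(a j : ℕ → ℂ) k - (a i : ℕ → ℂ) k‖ ^ σ.rate k < ρ i
  have hP0 : ∀ k, P k 0 := by
    intro k i j hij hj
    obtain rfl : j = 0 := by omega
    obtain rfl : i = 0 := by omega
    rw [sub_self, norm_zero, Real.zero_rpow (σ.pos k).ne']
    exact (norm_nonneg _).trans_lt (h 0 0 le_rfl)
  have hPev : ∀ m, ∀ᶠ k in hyperfilter ℕ, P k m := by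
    intro m
    have : ∀ᶠ k in hyperfilter ℕ, ∀ j ∈ Finset.range (m + 1), ∀ i ∈ Finset.range (j + 1),
        ‖(a j : ℕ → ℂ) k - (a i : ℕ → ℂ) k‖ ^ σ.rate k < ρ i := by
      refine (Finset.eventually_all _).2 fun j _ => (Finset.eventually_all _).2 fun i hi => ?_
      exact hlt i j (by simpa [Nat.lt_succ_iff] using hi)
    filter_upwards [this] with k hk i j hij hj
    exact hk j (by simpa [Nat.lt_succ_iff] using hj) i (by simpa [Nat.lt_succ_iff] using hij)
  let m : ℕ → ℕ := fun k => Nat.findGreatest (P k) k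
  have hm : ∀ k, P k (m k) := fun k => Nat.findGreatest_spec (Nat.zero_le k) (hP0 k)
  let b : ℕ → ℂ := fun k => (a (m k) : ℕ → ℂ) k
  have hb : ∀ i, ∀ᶠ k in hyperfilter ℕ, ‖b k - (a i : ℕ → ℂ) k‖ ^ σ.rate k < ρ i := by
    intro i
    filter_upwards [hPev i, Nat.hyperfilter_le_atTop (eventually_ge_atTop i)] with k hk hik
    exact hm k i (m k) (Nat.le_findGreatest hik hk) le_rfl
  have hmod : ∀ i, σ.IsModerate (b - a i) := fun i => ⟨ρ i, (hb i).mono fun k hk => hk.le⟩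
  have hbm : σ.IsModerate b := by
    have := (hmod 0).add (a 0).2
    rwa [sub_add_cancel] at this
  refine ⟨σ.cls ⟨b, hbm⟩, fun i => ?_⟩
  rw [← ha, ← map_sub, norm_cls]
  exact le_of_tendsto (hmod i).tendsto ((hb i).mono fun k hk => hk.le)

instance instCompleteSpaceQuot : CompleteSpace σ.Quot := by
  refine Metric.complete_of_convergent_controlled_sequences (fun n => 1 / ((n : ℝ) + 1))
    (fun n => by positivity) fun u hu => ?_
  obtain ⟨y, hy⟩ := σ.quot_spherically_complete u (fun n => 1 / ((n : ℝ) + 1)) fun i j hij => by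
    rw [← dist_eq_norm]
    exact hu i j i hij le_rfl
  refine ⟨y, tendsto_iff_norm_sub_tendsto_zero.2 ?_⟩
  refine squeeze_zero (fun n => norm_nonneg _) (fun n => ?_) tendsto_one_div_add_atTop_nhds_zero_nat
  rw [norm_sub_rev]
  exact hy n

open Polynomial in
instance instIsAlgClosedQuot : IsAlgClosed σ.Quot := by
  refine IsAlgClosed.of_exists_root _ fun p hp hirr => ?_
  set n := p.natDegree with hn
  have hn0 : n ≠ 0 := hirr.natDegree_pos.ne'
  choose b hb using fun i => σ.cls_surjective (p.coeff i)
  have hroot : ∀ k, ∃ z : ℂ, z ^ n + ∑ i ∈ Finset.range n, (b i : ℕ → ℂ) k * z ^ i = 0 := by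
    intro k
    set q : ℂ[X] := X ^ n + ∑ i ∈ Finset.range n, C ((b i : ℕ → ℂ) k) * X ^ i with hq
    have hdeg : (∑ i ∈ Finset.range n, C ((b i : ℕ → ℂ) k) * X ^ i : ℂ[X]).degree < n := by
      refine (degree_sum_le _ _).trans_lt ((Finset.sup_lt_iff (WithBot.bot_lt_coe n)).2 fun i hi => ?_)
      exact (degree_C_mul_X_pow_le _ _).trans_lt (Nat.cast_lt.2 (Finset.mem_range.1 hi))
    have hqd : q.degree = n := by
      rw [hq, degree_add_eq_left_of_degree_lt (by rwa [degree_X_pow]), degree_X_pow]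
    obtain ⟨z, hz⟩ := IsAlgClosed.exists_root q (by rw [hqd]; exact_mod_cast hn0)
    refine ⟨z, ?_⟩
    simpa [IsRoot, hq, eval_finsetSum] using hz
  choose z hz using hroot
  have hsum : σ.IsModerate (fun k => ((1 + ∑ i ∈ Finset.range n, ‖(b i : ℕ → ℂ) k‖ : ℝ) : ℂ)) := by
    have h1 : ∀ i, (fun k => ((‖(b i : ℕ → ℂ) k‖ : ℝ) : ℂ)) ∈ σ.moderate := fun i =>
      (b i).2.of_le (Eventually.of_forall fun k => by simp)
    have := σ.moderate.add_mem σ.moderate.one_mem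
      (σ.moderate.sum_mem (t := Finset.range n) fun i _ => h1 i)
    refine IsModerate.of_le this (Eventually.of_forall fun k => ?_)
    simp [Finset.sum_apply]
  have hzm : σ.IsModerate z := by
    refine hsum.of_le (Eventually.of_forall fun k => ?_)
    have hS : 0 ≤ ∑ i ∈ Finset.range n, ‖(b i : ℕ → ℂ) k‖ :=
      Finset.sum_nonneg fun i _ => norm_nonneg _
    rw [Complex.norm_real, Real.norm_of_nonneg (by positivity)]
    rcases le_total ‖z k‖ 1 with h | h
    · linarith
    · have h1 : ‖z k‖ ^ n ≤ (∑ i ∈ Finset.range n, ‖(b i : ℕ → ℂ) k‖) * ‖z k‖ ^ (n - 1) := by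
        rw [← norm_pow, eq_neg_of_add_eq_zero_left (hz k), norm_neg, Finset.sum_mul]
        refine norm_sum_le_of_le _ fun i hi => ?_
        rw [norm_mul, norm_pow]
        gcongr
        have := Finset.mem_range.1 hi; omega
      obtain ⟨m, hm⟩ := Nat.exists_eq_succ_of_ne_zero hn0
      rw [hm, Nat.succ_sub_one, pow_succ, mul_comm] at h1
      have := le_of_mul_le_mul_right h1 (by positivity)
      rw [hm]
      linarith
  refine ⟨σ.cls ⟨z, hzm⟩, ?_⟩
  rw [eval_eq_sum_range, Finset.sum_range_succ, ← hn, hp.coeff_natDegree, one_mul]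
  simp_rw [← hb, ← map_pow, ← map_mul]
  rw [← map_sum, ← map_add, cls_eq_zero]
  refine σ.negligible_of_eventually_eq_zero (Eventually.of_forall fun k => ?_)
  rw [← hz k, add_comm]
  simp [Finset.sum_apply]

end AsympScale

end AsymptoticField

section WeierstrassPreparation

open BoundedContinuousFunction

lemma FormalMultilinearSeries.norm_changeOriginSeries_le {E F : Type*} [NormedAddCommGroup E]
    [NormedSpace ℝ E] [NormedAddCommGroup F] [NormedSpace ℝ F]
    (p : FormalMultilinearSeries ℝ E F) (m l : ℕ) :
    ‖p.changeOriginSeries m l‖ ≤ 2 ^ (m + l) * ‖p (m + l)‖ := by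
  have h := p.nnnorm_changeOriginSeries_le_tsum m l
  rw [tsum_fintype, Finset.sum_const, nsmul_eq_mul, Finset.card_univ,
    Fintype.card_finset_len, Fintype.card_fin] at h
  have h' : ‖p.changeOriginSeries m l‖ ≤ ((m + l).choose l : ℝ) * ‖p (m + l)‖ := by
    exact_mod_cast h
  refine h'.trans ?_
  gcongr
  exact_mod_cast Nat.choose_le_two_pow _ _

/-- The multilinear maps collecting, for all `m`, the coefficient of degree `m` in the last variable
and degree `l` in the remaining ones. -/
lemma exists_coefficient_series {E : Type*} [NormedAddCommGroup E] [NormedSpace ℝ E]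
    (p : FormalMultilinearSeries ℝ (E × ℝ) ℝ) {ρ C : ℝ} (hρ : 0 < ρ)
    (hC : ∀ m l, ‖p.changeOriginSeries m l‖ * ρ ^ m * ρ ^ l ≤ C) :
    ∃ q : FormalMultilinearSeries ℝ E (ℕ →ᵇ ℝ), (∀ l, ‖q l‖ * ρ ^ l ≤ C) ∧
      ∀ l (x : E) m, q l (fun _ => x) m =
        ρ ^ m * p.changeOriginSeries m l (fun _ => (x, 0)) (fun _ => (0, 1)) := by
  have hone : ‖((0, 1) : E × ℝ)‖ = 1 := by simp [Prod.norm_def]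
  have hbound : ∀ l (x : Fin l → E) (m : ℕ),
      ‖ρ ^ m * p.changeOriginSeries m l (fun i => (x i, 0)) (fun _ => (0, 1))‖ ≤
        C / ρ ^ l * ∏ i, ‖x i‖ := by
    intro l x m
    have h1 : ‖p.changeOriginSeries m l (fun i => (x i, 0)) (fun _ => (0, 1))‖ ≤
        ‖p.changeOriginSeries m l‖ * ∏ i, ‖x i‖ := by
      refine (ContinuousMultilinearMap.le_opNorm _ _).trans ?_
      rw [hone, Finset.prod_const_one, mul_one]
      refine (ContinuousMultilinearMap.le_opNorm _ _).trans_eq ?_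
      congr 1
      exact Finset.prod_congr rfl fun i _ => by simp [Prod.norm_def]
    rw [norm_mul, norm_pow, Real.norm_of_nonneg hρ.le, div_mul_eq_mul_div,
      le_div_iff₀ (by positivity)]
    calc _ ≤ ρ ^ m * (‖p.changeOriginSeries m l‖ * ∏ i, ‖x i‖) * ρ ^ l := by gcongr
      _ = (‖p.changeOriginSeries m l‖ * ρ ^ m * ρ ^ l) * ∏ i, ‖x i‖ := by ring
      _ ≤ _ := mul_le_mul_of_nonneg_right (hC m l) (Finset.prod_nonneg fun i _ => norm_nonneg _)
  have hC0 : 0 ≤ C := le_trans (by positivity) (hC 0 0)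
  let L : ∀ m l, E [×l]→L[ℝ] ℝ := fun m l =>
    ρ ^ m • (ContinuousMultilinearMap.apply ℝ (fun _ : Fin m => E × ℝ) ℝ
      (fun _ => ((0 : E), (1 : ℝ)))).compContinuousMultilinearMap
      ((p.changeOriginSeries m l).compContinuousLinearMap fun _ => ContinuousLinearMap.inl ℝ E ℝ)
  have hL : ∀ m l (x : Fin l → E), L m l x =
      ρ ^ m * p.changeOriginSeries m l (fun i => (x i, 0)) (fun _ => (0, 1)) := fun m l x => rfl
  let q : FormalMultilinearSeries ℝ E (ℕ →ᵇ ℝ) := fun l =>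
    MultilinearMap.mkContinuous
      { toFun := fun x => ofNormedAddCommGroupDiscrete (fun m => L m l x) (C / ρ ^ l * ∏ i, ‖x i‖)
          fun m => by rw [hL]; exact hbound l x m
        map_update_add' := fun x i a b => by ext m; exact (L m l).map_update_add x i a b
        map_update_smul' := fun x i c a => by ext m; exact (L m l).map_update_smul x i c a }
      (C / ρ ^ l) fun x => by
        refine (norm_le (by positivity)).2 fun m => ?_
        exact hbound l x m
  refine ⟨q, fun l => ?_, fun l x m => rfl⟩
  rw [← le_div_iff₀ (by positivity)]
  exact MultilinearMap.mkContinuous_norm_le _ (by positivity) _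

/-- The Taylor coefficients of an analytic function with respect to its last variable depend
analytically, as a bounded sequence, on the other variables. -/
lemma AnalyticAt.exists_analytic_coefficients {E : Type*} [NormedAddCommGroup E] [NormedSpace ℝ E]
    {g : E × ℝ → ℝ} (hg : AnalyticAt ℝ g 0) :
    ∃ ρ > 0, ∃ F : E → (ℕ →ᵇ ℝ), AnalyticAt ℝ F 0 ∧
      ∀ᶠ w in 𝓝 (0 : E × ℝ), HasSum (fun m => F w.1 m * (w.2 / ρ) ^ m) (g w) := by
  obtain ⟨p, R, hp⟩ := hg
  obtain ⟨r₀, h0, hr₀⟩ := ENNReal.lt_iff_exists_nnreal_btwn.1 hp.r_pos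
  have h0' : (0 : ℝ) < r₀ := by exact_mod_cast h0
  set ρ : NNReal := r₀ / 4 with hρdef
  have hρ : (0 : ℝ) < ρ := by rw [hρdef]; push_cast; positivity
  have h4 : (r₀ : ℝ) = 4 * ρ := by rw [hρdef]; push_cast; ring
  have hρR : (ρ : ENNReal) + ρ < R := by
    refine lt_of_le_of_lt ?_ hr₀
    rw [← ENNReal.coe_add, ENNReal.coe_le_coe, ← NNReal.coe_le_coe, NNReal.coe_add]
    linarith
  obtain ⟨C, hC0, hC⟩ := p.norm_mul_pow_le_of_lt_radius (hr₀.trans_le hp.r_le)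
  have hC' : ∀ m l, ‖p.changeOriginSeries m l‖ * (ρ : ℝ) ^ m * (ρ : ℝ) ^ l ≤ C := by
    intro m l
    calc _ ≤ 2 ^ (m + l) * ‖p (m + l)‖ * (ρ : ℝ) ^ m * (ρ : ℝ) ^ l := by
          gcongr; exact p.norm_changeOriginSeries_le m l
      _ = ‖p (m + l)‖ * (2 * ρ : ℝ) ^ (m + l) := by rw [mul_pow, pow_add (ρ : ℝ)]; ring
      _ ≤ ‖p (m + l)‖ * (r₀ : ℝ) ^ (m + l) := by gcongr; linarith
      _ ≤ C := hC _
  obtain ⟨q, hq, hqa⟩ := exists_coefficient_series p hρ hC'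
  have hqr : (ρ : ENNReal) ≤ q.radius := q.le_radius_of_bound C hq
  have hρpos : (0 : ENNReal) < ρ := by exact_mod_cast hρ
  have hF := q.hasFPowerSeriesOnBall (hρpos.trans_le hqr)
  refine ⟨ρ, hρ, q.sum, hF.analyticAt, ?_⟩
  have hnear : ∀ᶠ w in 𝓝 (0 : E × ℝ), ‖w‖ₑ < ρ := by
    have : Tendsto (fun w : E × ℝ => ‖w‖ₑ) (𝓝 0) (𝓝 0) := by
      simpa using (continuous_enorm (E := E × ℝ)).tendsto 0
    exact this.eventually_lt_const hρpos
  filter_upwards [hnear] with w hw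
  have hx : ‖((w.1, 0) : E × ℝ)‖ₑ < ρ := by
    refine lt_of_le_of_lt ?_ hw
    rw [enorm_le_iff_norm_le]
    simp [Prod.norm_def]
  have hx1 : ‖w.1‖ₑ < ρ := by
    refine lt_of_le_of_lt ?_ hx
    rw [enorm_le_iff_norm_le]
    simp [Prod.norm_def]
  have hz : ‖((0, w.2) : E × ℝ)‖ₑ < ρ := by
    refine lt_of_le_of_lt ?_ hw
    rw [enorm_le_iff_norm_le]
    simp [Prod.norm_def]
  have hxR : ‖((w.1, 0) : E × ℝ)‖ₑ < R := hx.trans_le (le_self_add.trans hρR.le)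
  have hcoef : ∀ m, q.sum w.1 m = (ρ : ℝ) ^ m * p.changeOrigin (w.1, 0) m (fun _ => (0, 1)) := by
    intro m
    have h1 : HasSum (fun l => q l fun _ => w.1) (q.sum w.1) := by
      have := hF.hasSum (y := w.1) (by simpa using hx1.trans_le hqr)
      simpa using this
    have h2 := h1.mapL (evalCLM ℝ m)
    have h3 : HasSum (fun l => p.changeOriginSeries m l fun _ => (w.1, 0))
        (p.changeOrigin (w.1, 0) m) := by
      refine (p.changeOriginSeries m).hasSum ?_
      have := (hxR.trans_le hp.r_le).trans_le (p.le_changeOriginSeries_radius m)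
      simpa using this
    have h4 := (h3.mapL (ContinuousMultilinearMap.apply ℝ (fun _ : Fin m => E × ℝ) ℝ
      (fun _ => ((0 : E), (1 : ℝ))))).mul_left ((ρ : ℝ) ^ m)
    exact h2.unique (h4.congr_fun fun l => hqa l w.1 m)
  have hsum := (hp.changeOrigin hxR).hasSum (y := (0, w.2)) (by
    rw [Metric.mem_eball, edist_zero_right]
    refine hz.trans_le ?_
    rw [← ENNReal.add_sub_cancel_right (a := (ρ : ENNReal)) (b := ρ) ENNReal.coe_ne_top]
    exact tsub_le_tsub hρR.le hx.le)
  rw [zero_add, Prod.mk_add_mk, add_zero, zero_add] at hsum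
  refine hsum.congr_fun fun m => ?_
  have hsmul : ((fun _ => (0, w.2)) : Fin m → E × ℝ) = fun _ => w.2 • ((0 : E), (1 : ℝ)) := by
    ext i <;> simp
  rw [hcoef, hsmul, ContinuousMultilinearMap.map_smul_univ, Finset.prod_const, Finset.card_univ,
    Fintype.card_fin, smul_eq_mul, div_pow]
  field_simp

end WeierstrassPreparation

section WeierstrassPreparation

open BoundedContinuousFunction

/-- A power series with bounded coefficients in a Banach space has an analytic sum. -/
lemma exists_analyticAt_hasSum_pow_smul {W : Type*} [NormedAddCommGroup W] [NormedSpace ℝ W]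
    [CompleteSpace W] (c : ℕ → W) (hc : ∀ m, ‖c m‖ ≤ 1) : ∃ V : ℝ → W, AnalyticAt ℝ V 0 ∧
    ∀ᶠ ζ in 𝓝 (0 : ℝ), HasSum (fun m => ζ ^ m • c m) (V ζ) := by
  let p : FormalMultilinearSeries ℝ ℝ W := fun m => ContinuousMultilinearMap.mkPiRing ℝ (Fin m) (c m)
  have hp : ((1 : NNReal) : ENNReal) ≤ p.radius := by
    refine p.le_radius_of_bound 1 fun m => ?_
    rw [NNReal.coe_one, one_pow, mul_one, ContinuousMultilinearMap.norm_mkPiRing]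
    exact hc m
  have hp0 : 0 < p.radius := lt_of_lt_of_le (by simp) hp
  refine ⟨p.sum, (p.hasFPowerSeriesOnBall hp0).analyticAt, ?_⟩
  filter_upwards [Metric.eball_mem_nhds (0 : ℝ) hp0] with ζ hζ
  simpa [p] using p.hasSum hζ

/-- The functional summing a power series with bounded coefficients depends analytically on the
point of evaluation. -/
lemma exists_analytic_evaluation : ∃ V : ℝ → ((ℕ →ᵇ ℝ) →L[ℝ] ℝ), AnalyticAt ℝ V 0 ∧
    ∀ᶠ ζ in 𝓝 (0 : ℝ), ∀ u : ℕ →ᵇ ℝ, HasSum (fun m => u m * ζ ^ m) (V ζ u) := by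
  obtain ⟨V, hV, h⟩ := exists_analyticAt_hasSum_pow_smul
    (fun m => (evalCLM ℝ m : (ℕ →ᵇ ℝ) →L[ℝ] ℝ)) fun m => by
      refine ContinuousLinearMap.opNorm_le_bound _ zero_le_one fun u => ?_
      rw [one_mul]
      exact u.norm_coe_le_norm m
  refine ⟨V, hV, ?_⟩
  filter_upwards [h] with ζ hζ u
  refine (hζ.mapL (ContinuousLinearMap.apply ℝ ℝ u)).congr_fun fun m => ?_
  simp [mul_comm]

/-- Multiplication of power series with bounded coefficients by `z ^ i`. -/
def shiftRight (i : ℕ) : (ℕ →ᵇ ℝ) →L[ℝ] (ℕ →ᵇ ℝ) :=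
  LinearMap.mkContinuous
    { toFun := fun u => ofNormedAddCommGroupDiscrete
        (fun m => if m < i then 0 else u (m - i)) ‖u‖ fun m => by
          split_ifs
          · simp
          · exact u.norm_coe_le_norm _
      map_add' := fun u v => by
        ext m
        change (if m < i then (0 : ℝ) else u (m - i) + v (m - i)) =
          (if m < i then 0 else u (m - i)) + (if m < i then 0 else v (m - i))
        split_ifs <;> simp
      map_smul' := fun c u => by
        ext m
        change (if m < i then (0 : ℝ) else c * u (m - i)) = c * (if m < i then 0 else u (m - i))
        split_ifs <;> simp } 1 fun u => by
    rw [one_mul]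
    refine (norm_le (norm_nonneg _)).2 fun m => ?_
    change ‖if m < i then (0 : ℝ) else u (m - i)‖ ≤ ‖u‖
    split_ifs
    · simp
    · exact u.norm_coe_le_norm _

lemma shiftRight_apply (i : ℕ) (u : ℕ →ᵇ ℝ) (m : ℕ) :
    shiftRight i u m = if m < i then 0 else u (m - i) := rfl

lemma HasSum.shiftRight {u : ℕ →ᵇ ℝ} {ζ s : ℝ} (h : HasSum (fun m => u m * ζ ^ m) s) (i : ℕ) :
    HasSum (fun m => shiftRight i u m * ζ ^ m) (ζ ^ i * s) := by
  rw [← hasSum_nat_add_iff' i, Finset.sum_eq_zero, sub_zero]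
  · refine (h.mul_left (ζ ^ i)).congr_fun fun m => ?_
    rw [shiftRight_apply, if_neg (by omega), Nat.add_sub_cancel, pow_add]
    ring
  · intro m hm
    rw [shiftRight_apply, if_pos (Finset.mem_range.1 hm), zero_mul]

lemma exists_shiftRight_eq {d : ℕ} {b : ℕ →ᵇ ℝ} (h : ∀ m < d, b m = 0) :
    ∃ u : ℕ →ᵇ ℝ, shiftRight d u = b ∧ ∀ m, u m = b (m + d) := by
  refine ⟨ofNormedAddCommGroupDiscrete (fun m => b (m + d)) ‖b‖ fun m => b.norm_coe_le_norm _,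
    ?_, fun m => rfl⟩
  ext m
  rw [shiftRight_apply]
  split_ifs with hm
  · exact (h m hm).symm
  · change b (m - d + d) = b m
    rw [Nat.sub_add_cancel (not_lt.1 hm)]

/-- The linearization at `(u, 0)` of the map sending a unit `u` and the lower coefficients of a monic
polynomial of degree `d` to their product. -/
def weierstrassLin (d : ℕ) (u : ℕ →ᵇ ℝ) : ((ℕ →ᵇ ℝ) × (Fin d → ℝ)) →L[ℝ] (ℕ →ᵇ ℝ) :=
  (shiftRight d).comp (ContinuousLinearMap.fst ℝ _ _) +
    ∑ i : Fin d, ((ContinuousLinearMap.proj (R := ℝ) (φ := fun _ : Fin d => ℝ) i).comp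
      (ContinuousLinearMap.snd ℝ (ℕ →ᵇ ℝ) (Fin d → ℝ))).smulRight (shiftRight i u)

lemma weierstrassLin_apply (d : ℕ) (u v : ℕ →ᵇ ℝ) (a : Fin d → ℝ) :
    weierstrassLin d u (v, a) = shiftRight d v + ∑ i : Fin d, a i • shiftRight i u := by
  simp [weierstrassLin]

lemma weierstrassLin_apply_of_lt {d : ℕ} (u v : ℕ →ᵇ ℝ) (a : Fin d → ℝ) {m : ℕ} (hm : m < d) :
    weierstrassLin d u (v, a) m = ∑ i : Fin d, a i * shiftRight i u m := by
  rw [weierstrassLin_apply, BoundedContinuousFunction.add_apply, shiftRight_apply, if_pos hm,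
    zero_add]
  simp [BoundedContinuousFunction.sum_apply]

lemma eq_zero_of_sum_shiftRight_eq_zero {d : ℕ} {u : ℕ →ᵇ ℝ} (hu : u 0 ≠ 0) {a : Fin d → ℝ}
    (h : ∀ m < d, ∑ i : Fin d, a i * shiftRight i u m = 0) : a = 0 := by
  have key : ∀ n (hn : n < d), a ⟨n, hn⟩ = 0 := by
    intro n
    induction n using Nat.strong_induction_on with
    | _ n ih =>
      intro hn
      have h1 := h n hn
      rw [Finset.sum_eq_single ⟨n, hn⟩] at h1
      · simpa [shiftRight_apply, hu] using h1
      · intro i _ hi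
        rcases lt_or_gt_of_ne (fun h => hi (Fin.ext h) : (i : ℕ) ≠ n) with hlt | hgt
        · rw [ih i hlt i.2, zero_mul]
        · rw [shiftRight_apply, if_pos hgt, mul_zero]
      · simp
  ext i
  exact key i i.2

lemma weierstrassLin_bijective (d : ℕ) {u : ℕ →ᵇ ℝ} (hu : u 0 ≠ 0) :
    Function.Bijective (weierstrassLin d u) := by
  constructor
  · refine (injective_iff_map_eq_zero _).2 fun ⟨v, a⟩ h => ?_
    have ha : a = 0 := eq_zero_of_sum_shiftRight_eq_zero hu fun m hm => by
      rw [← weierstrassLin_apply_of_lt u v a hm, h]; rfl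
    subst ha
    have hv : v = 0 := by
      ext m
      have := congrArg (fun b : ℕ →ᵇ ℝ => b (m + d)) h
      rw [weierstrassLin_apply] at this
      simpa [shiftRight_apply] using this
    rw [hv]; rfl
  · intro b
    let T : (Fin d → ℝ) →ₗ[ℝ] (Fin d → ℝ) :=
      { toFun := fun a m => ∑ i : Fin d, a i * shiftRight i u m
        map_add' := fun a b => by ext m; simp [add_mul, Finset.sum_add_distrib]
        map_smul' := fun c a => by ext m; simp [mul_assoc, Finset.mul_sum] }
    have hT : Function.Surjective T := by
      refine LinearMap.injective_iff_surjective.1 ((injective_iff_map_eq_zero _).2 fun a h => ?_)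
      exact eq_zero_of_sum_shiftRight_eq_zero hu fun m hm => congrFun h ⟨m, hm⟩
    obtain ⟨a, ha⟩ := hT fun m => b m
    obtain ⟨v, hv, -⟩ := exists_shiftRight_eq (d := d) (b := b - ∑ i : Fin d, a i • shiftRight i u)
      fun m hm => by
        have := congrFun ha ⟨m, hm⟩
        simp only [T, LinearMap.coe_mk, AddHom.coe_mk] at this
        simp [this]
    exact ⟨(v, a), by rw [weierstrassLin_apply, hv, sub_add_cancel]⟩

/-- **Weierstrass preparation theorem** for real analytic functions. -/
theorem AnalyticAt.weierstrass_preparation {E : Type*} [NormedAddCommGroup E] [NormedSpace ℝ E]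
    {g : E × ℝ → ℝ} (hg : AnalyticAt ℝ g 0) (hne : ¬ ∀ᶠ t in 𝓝 (0 : ℝ), g (0, t) = 0) :
    ∃ (d : ℕ) (a : Fin d → E → ℝ) (u : E × ℝ → ℝ), (∀ i, AnalyticAt ℝ (a i) 0) ∧
      AnalyticAt ℝ u 0 ∧ u 0 ≠ 0 ∧
      ∀ᶠ w in 𝓝 (0 : E × ℝ), g w = u w * (w.2 ^ d + ∑ i, a i w.1 * w.2 ^ (i : ℕ)) := by
  obtain ⟨ρ, hρ, F, hF, hsum⟩ := hg.exists_analytic_coefficients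
  obtain ⟨V, hV, hVsum⟩ := exists_analytic_evaluation
  have hex : ∃ m, F 0 m ≠ 0 := by
    by_contra! hcon
    refine hne ?_
    have : Tendsto (fun t : ℝ => ((0 : E), t)) (𝓝 0) (𝓝 0) :=
      (Continuous.prodMk_right (0 : E)).tendsto 0
    filter_upwards [this.eventually hsum] with t ht
    refine ht.unique ?_
    simp [hcon]
  classical
  set d := Nat.find hex with hd
  obtain ⟨u₀, hu₀, hu₀'⟩ := exists_shiftRight_eq (d := d) (b := F 0)
    fun m hm => not_not.1 (Nat.find_min hex hm)
  have hu₀0 : u₀ 0 ≠ 0 := by rw [hu₀', zero_add]; exact Nat.find_spec hex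
  let Φ : (ℕ →ᵇ ℝ) × (Fin d → ℝ) → (ℕ →ᵇ ℝ) := fun q =>
    shiftRight d q.1 + ∑ i : Fin d, q.2 i • shiftRight i q.1
  have hΦ : ContDiffAt ℝ (⊤ : WithTop ℕ∞) Φ (u₀, 0) := by
    refine ContDiff.contDiffAt ?_
    fun_prop
  let e := ContinuousLinearEquiv.ofBijective (weierstrassLin d u₀)
    (LinearMap.ker_eq_bot.2 (weierstrassLin_bijective d hu₀0).1)
    (LinearMap.range_eq_top.2 (weierstrassLin_bijective d hu₀0).2)
  have hΦ' : HasFDerivAt Φ (e : ((ℕ →ᵇ ℝ) × (Fin d → ℝ)) →L[ℝ] (ℕ →ᵇ ℝ)) (u₀, 0) := by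
    have h1 : HasFDerivAt (fun q : (ℕ →ᵇ ℝ) × (Fin d → ℝ) => shiftRight d q.1)
        ((shiftRight d).comp (ContinuousLinearMap.fst ℝ _ _)) (u₀, 0) :=
      ((shiftRight d).comp
        (ContinuousLinearMap.fst ℝ (ℕ →ᵇ ℝ) (Fin d → ℝ))).hasFDerivAt (x := (u₀, 0))
    have h2 : ∀ i ∈ Finset.univ, HasFDerivAt
        (fun q : (ℕ →ᵇ ℝ) × (Fin d → ℝ) => q.2 i • shiftRight i q.1)
        (((ContinuousLinearMap.proj (R := ℝ) (φ := fun _ : Fin d => ℝ) i).comp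
          (ContinuousLinearMap.snd ℝ (ℕ →ᵇ ℝ) (Fin d → ℝ))).smulRight (shiftRight i u₀))
        (u₀, 0) := by
      intro i _
      have h3 := ((ContinuousLinearMap.proj (R := ℝ) (φ := fun _ : Fin d => ℝ) i).comp
          (ContinuousLinearMap.snd ℝ (ℕ →ᵇ ℝ) (Fin d → ℝ))).hasFDerivAt (x := (u₀, 0))
      have h4 := ((shiftRight i).comp
        (ContinuousLinearMap.fst ℝ (ℕ →ᵇ ℝ) (Fin d → ℝ))).hasFDerivAt (x := (u₀, 0))
      refine (h3.smul h4).congr_fderiv ?_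
      ext q <;> simp
    exact h1.add (HasFDerivAt.fun_sum h2)
  have hΦ0 : Φ (u₀, 0) = F 0 := by simp [Φ, hu₀]
  set Θ := hΦ.localInverse hΦ' (by simp) with hΘ
  have hΘa : AnalyticAt ℝ Θ (F 0) := by
    rw [← hΦ0]
    exact (hΦ.to_localInverse hΦ' (by simp)).analyticAt
  have hΘ0 : Θ (F 0) = (u₀, 0) := by
    rw [← hΦ0]
    exact hΦ.localInverse_apply_image hΦ' (by simp)
  have hΘr : ∀ᶠ b in 𝓝 (F 0), Φ (Θ b) = b := by
    rw [← hΦ0]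
    exact (hΦ.hasStrictFDerivAt' hΦ' (by simp)).eventually_right_inverse
  have hΘF : AnalyticAt ℝ (fun x => Θ (F x)) 0 := hΘa.comp hF
  have hU : AnalyticAt ℝ (fun x => (Θ (F x)).1) 0 :=
    (ContinuousLinearMap.fst ℝ (ℕ →ᵇ ℝ) (Fin d → ℝ)).analyticAt _ |>.comp hΘF
  have hA : ∀ i, AnalyticAt ℝ (fun x => (Θ (F x)).2 i) 0 := fun i =>
    ((ContinuousLinearMap.proj (R := ℝ) (φ := fun _ : Fin d => ℝ) i).comp
      (ContinuousLinearMap.snd ℝ (ℕ →ᵇ ℝ) (Fin d → ℝ))).analyticAt _ |>.comp hΘF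
  refine ⟨d, fun i x => ρ ^ (d - i : ℕ) * (Θ (F x)).2 i,
    fun w => (ρ ^ d)⁻¹ * V (w.2 / ρ) (Θ (F w.1)).1, fun i => analyticAt_const.mul (hA i), ?_, ?_, ?_⟩
  · have h1 : AnalyticAt ℝ (fun w : E × ℝ => V (w.2 / ρ)) 0 := by
      refine AnalyticAt.fun_comp (g := V) (f := fun w : E × ℝ => w.2 / ρ) (by simpa using hV) ?_
      exact analyticAt_snd.div analyticAt_const hρ.ne'
    have h2 : AnalyticAt ℝ (fun w : E × ℝ => (Θ (F w.1)).1) 0 :=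
      AnalyticAt.fun_comp (g := fun x => (Θ (F x)).1) (f := fun w : E × ℝ => w.1)
        (by simpa using hU) analyticAt_fst
    exact analyticAt_const.mul ((h1.contDiffAt.clm_apply h2.contDiffAt).analyticAt)
  · have h1 := hVsum.self_of_nhds u₀
    have h2 : HasSum (fun m => u₀ m * (0 : ℝ) ^ m) (u₀ 0) := by
      convert hasSum_single 0 fun m hm => ?_ using 1
      · simp
      · simp [hm]
    simp only [Prod.snd_zero, Prod.fst_zero, zero_div, hΘ0, h1.unique h2]
    exact mul_ne_zero (by positivity) hu₀0
  · have h1 : ∀ᶠ w in 𝓝 (0 : E × ℝ), Φ (Θ (F w.1)) = F w.1 :=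
      (hF.continuousAt.comp_of_eq continuousAt_fst rfl : ContinuousAt (fun w : E × ℝ => F w.1)
        0).eventually hΘr
    have h2 : ∀ᶠ w in 𝓝 (0 : E × ℝ), ∀ u : ℕ →ᵇ ℝ,
        HasSum (fun m => u m * (w.2 / ρ) ^ m) (V (w.2 / ρ) u) := by
      have : Tendsto (fun w : E × ℝ => w.2 / ρ) (𝓝 0) (𝓝 0) := by
        have := (continuous_snd.div_const ρ : Continuous fun w : E × ℝ => w.2 / ρ).tendsto 0
        simpa using this
      exact this.eventually hVsum
    filter_upwards [hsum, h1, h2] with w hw h1 h2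
    set ζ := w.2 / ρ with hζ
    have hwz : w.2 = ρ * ζ := by rw [hζ]; field_simp
    have h3 : g w = V ζ (F w.1) := hw.unique (h2 _)
    have h4 : ∀ (i : ℕ) (u : ℕ →ᵇ ℝ), V ζ (shiftRight i u) = ζ ^ i * V ζ u := fun i u =>
      (h2 _).unique ((h2 u).shiftRight i)
    rw [h3]
    conv_lhs => rw [← h1]
    simp only [Φ, map_add, map_sum, map_smul, h4, smul_eq_mul]
    rw [mul_add, Finset.mul_sum, hwz]
    congr 1
    · field_simp
      ring
    · refine Finset.sum_congr rfl fun i _ => ?_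
      have : ρ ^ d = ρ ^ (d - i : ℕ) * ρ ^ (i : ℕ) := by rw [← pow_add, Nat.sub_add_cancel i.2.le]
      rw [this]
      field_simp
      ring

end WeierstrassPreparation

section RealLogDerivation

open DualNumber

variable {K : Type*} [NormedField K] [Algebra ℝ K] [IsUltrametricDist K]

/-- A ring of logarithmic dual numbers which surjects onto the field can be averaged over an
isometric involution of the field. -/
theorem exists_subring_isLogDual_of_involution (hr : ∀ r : ℝ, ‖algebraMap ℝ K r‖ ≤ 1)
    (c : K →+* K) (hcc : ∀ x, c (c x) = x) (hcn : ∀ x, ‖c x‖ = ‖x‖)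
    (hcr : ∀ r : ℝ, c (algebraMap ℝ K r) = algebraMap ℝ K r) (G : Subring K[ε])
    (hG : ∀ z ∈ G, IsLogDual z)
    (hsurj : ∀ x : K, ∃ y : K, TrivSqZeroExt.inl x + TrivSqZeroExt.inr y ∈ G) :
    ∃ G' : Subring K[ε], (∀ z ∈ G', IsLogDual z) ∧
      (∀ z ∈ G, c z.fst = z.fst → c z.snd = z.snd → z ∈ G') ∧
      ∀ x : K, c x = x → ∃ y : K, c y = y ∧ TrivSqZeroExt.inl x + TrivSqZeroExt.inr y ∈ G' := by
  choose D hD using hsurj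
  have huniq : ∀ z ∈ G, z.snd = D z.fst := by
    intro z hz
    have h1 := hG _ (G.sub_mem hz (hD z.fst))
    have h2 := congrArg TrivSqZeroExt.snd (h1.eq_zero (by simp))
    simpa [sub_eq_zero] using h2
  have hadd : ∀ x y, D (x + y) = D x + D y := fun x y => by
    simpa using (huniq _ (G.add_mem (hD x) (hD y))).symm
  have hmul : ∀ x y, D (x * y) = x * D y + D x * y := fun x y => by
    simpa using (huniq _ (G.mul_mem (hD x) (hD y))).symm
  have hone : D 1 = 0 := by simpa using (huniq _ G.one_mem).symm
  have hzero : D 0 = 0 := by simpa using (huniq _ G.zero_mem).symm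
  have hneg : ∀ x, D (-x) = -D x := fun x => by simpa using (huniq _ (G.neg_mem (hD x))).symm
  have hcs : ∀ (r : ℝ) (x : K), c (r • x) = r • c x := fun r x => by
    rw [real_smul_eq, real_smul_eq, map_mul, hcr]
  let D' : K → K := fun x => (2⁻¹ : ℝ) • (D x + c (D (c x)))
  refine ⟨⟨⟨⟨⟨{z | z.snd = D' z.fst}, ?_⟩, ?_⟩, ?_, ?_⟩, ?_⟩, ?_, ?_, ?_⟩
  · rintro a b (ha : a.snd = _) (hb : b.snd = _)
    change (a * b).snd = D' (a * b).fst
    simp only [DualNumber.snd_mul, TrivSqZeroExt.fst_mul, ha, hb, D', hmul, map_mul, map_add, hcc,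
      real_smul_eq]
    ring
  · change (1 : K[ε]).snd = D' (1 : K[ε]).fst
    simp [D', hone]
  · rintro a b (ha : a.snd = _) (hb : b.snd = _)
    change (a + b).snd = D' (a + b).fst
    simp only [TrivSqZeroExt.snd_add, TrivSqZeroExt.fst_add, ha, hb, D', hadd, map_add, real_smul_eq]
    ring
  · change (0 : K[ε]).snd = D' (0 : K[ε]).fst
    simp [D', hzero]
  · rintro a (ha : a.snd = _)
    change (-a).snd = D' (-a).fst
    simp only [TrivSqZeroExt.snd_neg, TrivSqZeroExt.fst_neg, ha, D', hneg, map_neg, real_smul_eq]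
    ring
  · rintro z (hz : z.snd = _)
    have key : ∀ x ≠ 0, ‖D x - (-Real.log ‖x‖) • x‖ < ‖x‖ := fun x hx => by
      have := (hG _ (hD x)).resolve_left fun h => hx (by simpa using congrArg TrivSqZeroExt.fst h)
      simpa using this
    by_cases h0 : z.fst = 0
    · left
      ext
      · exact h0
      · simp [hz, h0, D', hzero]
    · right
      have h1 := key _ h0
      have h2 := key (c z.fst) (fun h => h0 (by rw [← hcc z.fst, h, map_zero]))
      rw [hcn, ← hcn, map_sub, hcs, hcc] at h2
      have h3 : z.snd - (-Real.log ‖z.fst‖) • z.fst = (2⁻¹ : ℝ) •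
          ((D z.fst - (-Real.log ‖z.fst‖) • z.fst) +
            (c (D (c z.fst)) - (-Real.log ‖z.fst‖) • z.fst)) := by
        rw [hz]
        simp only [D']
        module
      rw [h3]
      exact (norm_real_smul_le hr _ _).trans_lt (norm_add_lt_of_lt h1 h2)
  · intro z hz h1 h2
    change z.snd = D' z.fst
    simp only [D', h1, ← huniq z hz, h2]
    module
  · intro x hx
    refine ⟨D' x, ?_, ?_⟩
    · simp only [D', hcs, map_add, hcc, hx, add_comm]
    · change _ = D' _
      simp

end RealLogDerivation

namespace AsympScale

variable (σ : AsympScale)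

open DualNumber

lemma isModerate_conj {a : ℕ → ℂ} (ha : σ.IsModerate a) :
    σ.IsModerate fun k => (starRingEnd ℂ) (a k) :=
  ha.of_le (Eventually.of_forall fun k => by simp)

/-- Complex conjugation on moderate sequences. -/
def conjModerate : σ.moderate →+* σ.moderate where
  toFun a := ⟨fun k => (starRingEnd ℂ) ((a : ℕ → ℂ) k), σ.isModerate_conj a.2⟩
  map_one' := by ext; simp
  map_mul' _ _ := by ext; simp
  map_zero' := by ext; simp
  map_add' _ _ := by ext; simp

lemma size_conj (a : ℕ → ℂ) : σ.size (fun k => (starRingEnd ℂ) (a k)) = σ.size a := by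
  simp [size]

/-- Complex conjugation on the field of classes. -/
def conj : σ.Quot →+* σ.Quot :=
  Ideal.Quotient.lift σ.negligible (σ.cls.comp σ.conjModerate) fun a ha =>
    (σ.cls_eq_zero).2 ((σ.size_conj a).trans ha)

lemma conj_cls (a : σ.moderate) : σ.conj (σ.cls a) = σ.cls (σ.conjModerate a) := rfl

/-- The class of a real sequence (zero if the sequence is not moderate). -/
def germ (a : ℕ → ℝ) : σ.Quot := by
  classical
  exact if h : σ.IsModerate fun k => (a k : ℂ) then σ.cls ⟨_, h⟩ else 0

variable {σ}

lemma germ_of {a : ℕ → ℝ} (h : σ.IsModerate fun k => (a k : ℂ)) : σ.germ a = σ.cls ⟨_, h⟩ :=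
  dif_pos h

lemma tendsto_germ {a : ℕ → ℝ} (h : σ.IsModerate fun k => (a k : ℂ)) :
    Tendsto (fun k => |a k| ^ σ.rate k) (hyperfilter ℕ) (𝓝 ‖σ.germ a‖) := by
  rw [germ_of h, norm_cls]
  simpa using h.tendsto

lemma isModerate_ofReal_of_le {a b : ℕ → ℝ} (hb : σ.IsModerate fun k => (b k : ℂ))
    (h : ∀ᶠ k in hyperfilter ℕ, |a k| ≤ |b k|) : σ.IsModerate fun k => (a k : ℂ) :=
  hb.of_le (h.mono fun k hk => by simpa using hk)

lemma norm_germ_le {a b : ℕ → ℝ} (hb : σ.IsModerate fun k => (b k : ℂ))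
    (h : ∀ᶠ k in hyperfilter ℕ, |a k| ≤ |b k|) : ‖σ.germ a‖ ≤ ‖σ.germ b‖ :=
  le_of_tendsto_of_tendsto (tendsto_germ (isModerate_ofReal_of_le hb h)) (tendsto_germ hb)
    (h.mono fun k hk => Real.rpow_le_rpow (abs_nonneg _) hk (σ.pos k).le)

lemma germ_congr {a b : ℕ → ℝ} (h : ∀ᶠ k in hyperfilter ℕ, a k = b k) : σ.germ a = σ.germ b := by
  have h1 : (σ.IsModerate fun k => (a k : ℂ)) ↔ σ.IsModerate fun k => (b k : ℂ) :=
    ⟨fun ha => isModerate_ofReal_of_le ha (h.mono fun k hk => by rw [hk]),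
      fun ha => isModerate_ofReal_of_le ha (h.mono fun k hk => by rw [hk])⟩
  by_cases hb : σ.IsModerate fun k => (b k : ℂ)
  · rw [germ_of hb, germ_of (h1.2 hb)]
    exact σ.cls_eq_of_eventually (h.mono fun k hk => by simp [hk])
  · rw [germ, germ, dif_neg hb, dif_neg fun ha => hb (h1.1 ha)]

lemma isModerate_ofReal_add {a b : ℕ → ℝ} (ha : σ.IsModerate fun k => (a k : ℂ))
    (hb : σ.IsModerate fun k => (b k : ℂ)) : σ.IsModerate fun k => ((a k + b k : ℝ) : ℂ) := by
  simp only [Complex.ofReal_add]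
  exact ha.add hb

lemma isModerate_ofReal_mul {a b : ℕ → ℝ} (ha : σ.IsModerate fun k => (a k : ℂ))
    (hb : σ.IsModerate fun k => (b k : ℂ)) : σ.IsModerate fun k => ((a k * b k : ℝ) : ℂ) := by
  simp only [Complex.ofReal_mul]
  exact ha.mul hb

lemma germ_add {a b : ℕ → ℝ} (ha : σ.IsModerate fun k => (a k : ℂ))
    (hb : σ.IsModerate fun k => (b k : ℂ)) :
    σ.germ (fun k => a k + b k) = σ.germ a + σ.germ b := by
  rw [germ_of ha, germ_of hb, germ_of (isModerate_ofReal_add ha hb), ← map_add]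
  exact σ.cls_eq_of_eventually (Eventually.of_forall fun k => by simp)

lemma germ_mul {a b : ℕ → ℝ} (ha : σ.IsModerate fun k => (a k : ℂ))
    (hb : σ.IsModerate fun k => (b k : ℂ)) :
    σ.germ (fun k => a k * b k) = σ.germ a * σ.germ b := by
  rw [germ_of ha, germ_of hb, germ_of (isModerate_ofReal_mul ha hb), ← map_mul]
  exact σ.cls_eq_of_eventually (Eventually.of_forall fun k => by simp)

lemma isModerate_ofReal_const (r : ℝ) : σ.IsModerate fun _ => (r : ℂ) := isModerate_const _

lemma germ_const (r : ℝ) : σ.germ (fun _ => r) = algebraMap ℝ σ.Quot r :=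
  germ_of (isModerate_ofReal_const r)

lemma isModerate_ofReal_of_bounded {a : ℕ → ℝ} {C : ℝ}
    (h : ∀ᶠ k in hyperfilter ℕ, |a k| ≤ C) : σ.IsModerate fun k => (a k : ℂ) :=
  isModerate_ofReal_of_le (isModerate_ofReal_const C)
    (h.mono fun _ hk => hk.trans (le_abs_self C))

lemma isModerate_ofReal_of_tendsto {a : ℕ → ℝ} {r : ℝ}
    (h : Tendsto a (hyperfilter ℕ) (𝓝 r)) : σ.IsModerate fun k => (a k : ℂ) :=
  isModerate_ofReal_of_bounded ((h.abs.eventually_lt_const (lt_add_one _)).mono fun _ => le_of_lt)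

lemma norm_germ_le_one {a : ℕ → ℝ} {C : ℝ} (h : ∀ᶠ k in hyperfilter ℕ, |a k| ≤ C) :
    ‖σ.germ a‖ ≤ 1 := by
  refine (norm_germ_le (b := fun _ => C) (isModerate_ofReal_const C)
    (h.mono fun _ hk => hk.trans (le_abs_self C))).trans ?_
  rw [germ_const]
  exact σ.norm_algebraMap_quot_le C

lemma norm_germ_eq_one {a : ℕ → ℝ} {r : ℝ} (h : Tendsto a (hyperfilter ℕ) (𝓝 r)) (hr : r ≠ 0) :
    ‖σ.germ a‖ = 1 := by
  refine le_antisymm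
    (norm_germ_le_one ((h.abs.eventually_lt_const (lt_add_one _)).mono fun _ => le_of_lt)) ?_
  have h1 : ∀ᶠ k in hyperfilter ℕ, |(fun _ => r / 2 : ℕ → ℝ) k| ≤ |a k| := by
    have : |r / 2| < |r| := by
      rw [abs_div, abs_two]
      linarith [abs_pos.2 hr]
    exact (h.abs.eventually_const_lt this).mono fun _ => le_of_lt
  have h2 := norm_germ_le (σ := σ) (isModerate_ofReal_of_tendsto h) h1
  rwa [germ_const, norm_algebraMap_real σ.norm_algebraMap_quot_le (by simpa using hr)] at h2

lemma conj_germ (a : ℕ → ℝ) : σ.conj (σ.germ a) = σ.germ a := by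
  by_cases h : σ.IsModerate fun k => (a k : ℂ)
  · rw [germ_of h, conj_cls]
    exact σ.cls_eq_of_eventually (Eventually.of_forall fun k => by simp [conjModerate])
  · rw [germ, dif_neg h, map_zero]

lemma conj_conj (x : σ.Quot) : σ.conj (σ.conj x) = x := by
  obtain ⟨a, rfl⟩ := σ.cls_surjective x
  rw [conj_cls, conj_cls]
  exact σ.cls_eq_of_eventually (Eventually.of_forall fun k => by simp [conjModerate])

lemma norm_conj (x : σ.Quot) : ‖σ.conj x‖ = ‖x‖ := by
  obtain ⟨a, rfl⟩ := σ.cls_surjective x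
  exact σ.size_conj a

lemma conj_algebraMap (r : ℝ) : σ.conj (algebraMap ℝ σ.Quot r) = algebraMap ℝ σ.Quot r := by
  rw [← germ_const, conj_germ]

lemma exists_germ_eq {x : σ.Quot} (hx : σ.conj x = x) :
    ∃ a : ℕ → ℝ, (σ.IsModerate fun k => (a k : ℂ)) ∧ σ.germ a = x := by
  obtain ⟨b, rfl⟩ := σ.cls_surjective x
  have hm : σ.IsModerate fun k => ((((b : ℕ → ℂ) k).re : ℝ) : ℂ) :=
    IsModerate.of_le b.2 (Eventually.of_forall fun k => by
      simpa using Complex.abs_re_le_norm ((b : ℕ → ℂ) k))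
  refine ⟨_, hm, ?_⟩
  have h1 : σ.cls (⟨_, hm⟩ + ⟨_, hm⟩) = σ.cls (b + σ.conjModerate b) :=
    σ.cls_eq_of_eventually (Eventually.of_forall fun k => by
      simp [conjModerate, Complex.add_conj, two_mul])
  rw [map_add, map_add, ← conj_cls, hx, ← germ_of hm, ← two_smul ℝ, ← two_smul ℝ] at h1
  exact smul_right_injective _ (two_ne_zero' ℝ) h1

end AsympScale

namespace AsympScale

open DualNumber

variable {σ : AsympScale} {E F : Type*} [NormedAddCommGroup E] [NormedAddCommGroup F]

/-- A sequence of vectors has size smaller than one. -/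
def IsSmall (σ : AsympScale) {E : Type*} [NormedAddCommGroup E] (η : ℕ → E) : Prop :=
  ∃ c < 1, ∀ᶠ k in hyperfilter ℕ, ‖η k‖ ^ σ.rate k ≤ c

lemma IsSmall.of_le {η : ℕ → E} (hη : σ.IsSmall η) {ξ : ℕ → F} {C : ℝ}
    (h : ∀ᶠ k in hyperfilter ℕ, ‖ξ k‖ ≤ C * ‖η k‖) : σ.IsSmall ξ := by
  obtain ⟨c, hc, hle⟩ := hη
  obtain ⟨c', hcc', hc'⟩ := exists_between hc
  refine ⟨c', hc', ?_⟩
  have hlim : Tendsto (fun k => (max C 1) ^ σ.rate k * c) (hyperfilter ℕ) (𝓝 (1 * c)) :=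
    (σ.tendsto_const_rpow (by positivity)).mul_const c
  rw [one_mul] at hlim
  filter_upwards [hle, h, hlim.eventually_lt_const hcc'] with k h1 h2 h3
  calc ‖ξ k‖ ^ σ.rate k ≤ (max C 1 * ‖η k‖) ^ σ.rate k :=
        Real.rpow_le_rpow (norm_nonneg _) (h2.trans (by gcongr; exact le_max_left _ _)) (σ.pos k).le
    _ = (max C 1) ^ σ.rate k * ‖η k‖ ^ σ.rate k := Real.mul_rpow (by positivity) (norm_nonneg _)
    _ ≤ (max C 1) ^ σ.rate k * c := by gcongr
    _ ≤ c' := h3.le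

lemma IsSmall.isModerate {a : ℕ → ℝ} (ha : σ.IsSmall a) : σ.IsModerate fun k => (a k : ℂ) := by
  obtain ⟨c, -, h⟩ := ha
  exact ⟨c, h.mono fun k hk => by simpa using hk⟩

lemma IsSmall.norm_germ_lt_one {a : ℕ → ℝ} (ha : σ.IsSmall a) : ‖σ.germ a‖ < 1 := by
  have hm := ha.isModerate
  obtain ⟨c, hc, h⟩ := ha
  exact (le_of_tendsto (tendsto_germ hm) h).trans_lt hc

lemma isSmall_of_norm_germ_lt_one {a : ℕ → ℝ} (ha : σ.IsModerate fun k => (a k : ℂ))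
    (h : ‖σ.germ a‖ < 1) : σ.IsSmall a := by
  obtain ⟨c, hc, hc'⟩ := exists_between h
  exact ⟨c, hc', ((tendsto_germ ha).eventually_lt_const hc).mono fun k hk => hk.le⟩

lemma IsSmall.prodMk {η : ℕ → E} {ξ : ℕ → F} (hη : σ.IsSmall η) (hξ : σ.IsSmall ξ) :
    σ.IsSmall fun k => (η k, ξ k) := by
  obtain ⟨c, hc, h⟩ := hη
  obtain ⟨c', hc', h'⟩ := hξ
  refine ⟨max c c', max_lt hc hc', ?_⟩
  filter_upwards [h, h'] with k h1 h2
  rw [Prod.norm_mk]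
  rcases max_cases ‖η k‖ ‖ξ k‖ with ⟨h, -⟩ | ⟨h, -⟩ <;> rw [h]
  · exact h1.trans (le_max_left _ _)
  · exact h2.trans (le_max_right _ _)

lemma isModerate_apply {x : ℕ → E} (hx : Tendsto x (hyperfilter ℕ) (𝓝 0)) {g : E → ℝ}
    (hg : ContinuousAt g 0) : σ.IsModerate fun k => (g (x k) : ℂ) :=
  isModerate_ofReal_of_tendsto (hg.tendsto.comp hx)

variable [NormedSpace ℝ E] [NormedSpace ℝ F]

/-- The dual number collecting the values of a function along a sequence of points and of its
derivative in a sequence of directions. -/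
def jet (σ : AsympScale) (x η : ℕ → E) (g : E → ℝ) : σ.Quot[ε] :=
  TrivSqZeroExt.inl (σ.germ fun k => g (x k)) +
    TrivSqZeroExt.inr (σ.germ fun k => fderiv ℝ g (x k) (η k))

@[simp] lemma fst_jet (x η : ℕ → E) (g : E → ℝ) :
    (σ.jet x η g).fst = σ.germ fun k => g (x k) := by simp [jet]

@[simp] lemma snd_jet (x η : ℕ → E) (g : E → ℝ) :
    (σ.jet x η g).snd = σ.germ fun k => fderiv ℝ g (x k) (η k) := by simp [jet]

variable {x η : ℕ → E}

lemma jet_congr (hx : Tendsto x (hyperfilter ℕ) (𝓝 0)) {g h : E → ℝ} (hgh : g =ᶠ[𝓝 0] h) :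
    σ.jet x η g = σ.jet x η h := by
  unfold jet
  congr 2
  · exact germ_congr (hx.eventually hgh)
  · exact germ_congr ((hx.eventually hgh.fderiv).mono fun k hk => by rw [hk])

lemma isSmall_fderiv_apply (hx : Tendsto x (hyperfilter ℕ) (𝓝 0)) (hη : σ.IsSmall η)
    {g : E → ℝ} (hg : AnalyticAt ℝ g 0) : σ.IsSmall fun k => fderiv ℝ g (x k) (η k) := by
  refine hη.of_le (C := ‖fderiv ℝ g 0‖ + 1) ?_
  have h1 := (hg.fderiv.continuousAt.tendsto.comp hx).norm
  filter_upwards [h1.eventually_lt_const (lt_add_one _)] with k hk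
  exact (ContinuousLinearMap.le_opNorm _ _).trans
    (mul_le_mul_of_nonneg_right hk.le (norm_nonneg _))

lemma _root_.AnalyticAt.eventually_differentiableAt {g : E → ℝ} (hg : AnalyticAt ℝ g 0) :
    ∀ᶠ w in 𝓝 (0 : E), DifferentiableAt ℝ g w := by
  obtain ⟨p, r, h⟩ := hg
  filter_upwards [Metric.eball_mem_nhds 0 h.r_pos] with w hw
  exact h.differentiableOn.differentiableAt (Metric.isOpen_eball.mem_nhds hw)

lemma jet_add (hx : Tendsto x (hyperfilter ℕ) (𝓝 0)) (hη : σ.IsSmall η) {g h : E → ℝ}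
    (hg : AnalyticAt ℝ g 0) (hh : AnalyticAt ℝ h 0) :
    σ.jet x η (g + h) = σ.jet x η g + σ.jet x η h := by
  ext
  · simpa using germ_add (isModerate_apply hx hg.continuousAt) (isModerate_apply hx hh.continuousAt)
  · simp only [TrivSqZeroExt.snd_add, snd_jet]
    rw [← germ_add (isSmall_fderiv_apply hx hη hg).isModerate
      (isSmall_fderiv_apply hx hη hh).isModerate]
    refine germ_congr ?_
    filter_upwards [hx.eventually hg.eventually_differentiableAt,
      hx.eventually hh.eventually_differentiableAt] with k h1 h2
    rw [fderiv_add h1 h2, add_apply]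

lemma jet_mul (hx : Tendsto x (hyperfilter ℕ) (𝓝 0)) (hη : σ.IsSmall η) {g h : E → ℝ}
    (hg : AnalyticAt ℝ g 0) (hh : AnalyticAt ℝ h 0) :
    σ.jet x η (g * h) = σ.jet x η g * σ.jet x η h := by
  have hg0 := isModerate_apply (σ := σ) hx hg.continuousAt
  have hh0 := isModerate_apply (σ := σ) hx hh.continuousAt
  have hg1 := (isSmall_fderiv_apply hx hη hg).isModerate
  have hh1 := (isSmall_fderiv_apply hx hη hh).isModerate
  ext
  · simpa using germ_mul hg0 hh0
  · simp only [DualNumber.snd_mul, snd_jet, fst_jet]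
    rw [← germ_mul hg0 hh1, ← germ_mul hg1 hh0,
      ← germ_add (isModerate_ofReal_mul hg0 hh1) (isModerate_ofReal_mul hg1 hh0)]
    refine germ_congr ?_
    filter_upwards [hx.eventually hg.eventually_differentiableAt,
      hx.eventually hh.eventually_differentiableAt] with k h1 h2
    rw [fderiv_mul h1 h2]
    simp [mul_comm]

lemma jet_const (c : ℝ) : σ.jet x η (fun _ => c) = TrivSqZeroExt.inl (algebraMap ℝ σ.Quot c) := by
  ext
  · simpa using germ_const c
  · simpa using germ_const (σ := σ) 0

/-- The ring of functions analytic at the origin. -/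
def _root_.analyticSubring (E : Type*) [NormedAddCommGroup E] [NormedSpace ℝ E] :
    Subring (E → ℝ) where
  carrier := {g | AnalyticAt ℝ g 0}
  mul_mem' hg hh := hg.mul hh
  one_mem' := analyticAt_const
  add_mem' hg hh := hg.add hh
  zero_mem' := analyticAt_const
  neg_mem' hg := hg.neg

/-- Forming jets is a ring homomorphism. -/
def jetHom (hx : Tendsto x (hyperfilter ℕ) (𝓝 0)) (hη : σ.IsSmall η) :
    analyticSubring E →+* σ.Quot[ε] where
  toFun g := σ.jet x η g
  map_one' := (jet_const 1).trans (by simp)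
  map_mul' g h := jet_mul hx hη g.2 h.2
  map_zero' := (jet_const 0).trans (by simp)
  map_add' g h := jet_add hx hη g.2 h.2

lemma jet_comp_equiv (e : E ≃L[ℝ] F) (g : F → ℝ) :
    σ.jet x η (fun w => g (e w)) = σ.jet (fun k => e (x k)) (fun k => e (η k)) g := by
  ext
  · simp
  · simp only [snd_jet]
    refine germ_congr (Eventually.of_forall fun k => ?_)
    have := e.comp_right_fderiv (f := g) (x := x k)
    exact congrArg (fun L => L (η k)) this

lemma jet_comp_fst {t y : ℕ → ℝ} (hx : Tendsto x (hyperfilter ℕ) (𝓝 0)) {a : E → ℝ}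
    (ha : AnalyticAt ℝ a 0) :
    σ.jet (fun k => (x k, t k)) (fun k => (η k, y k)) (fun w : E × ℝ => a w.1) = σ.jet x η a := by
  ext
  · simp
  · simp only [snd_jet]
    refine germ_congr ?_
    filter_upwards [hx.eventually ha.eventually_differentiableAt] with k hk
    have h1 : HasFDerivAt (fun w : E × ℝ => a w.1)
        ((fderiv ℝ a (x k)).comp (ContinuousLinearMap.fst ℝ E ℝ)) (x k, t k) :=
      HasFDerivAt.comp (x k, t k) (g := a) hk.hasFDerivAt hasFDerivAt_fst
    rw [h1.fderiv]
    simp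

lemma jet_snd {t y : ℕ → ℝ} :
    σ.jet (fun k => (x k, t k)) (fun k => (η k, y k)) (fun w : E × ℝ => w.2) =
      TrivSqZeroExt.inl (σ.germ t) + TrivSqZeroExt.inr (σ.germ y) := by
  ext
  · simp
  · simp only [snd_jet]
    simp [fderiv_snd]

/-- Jets of units are logarithmic. -/
lemma isLogDual_jet_of_ne_zero (hx : Tendsto x (hyperfilter ℕ) (𝓝 0)) (hη : σ.IsSmall η)
    {u : E → ℝ} (hu : AnalyticAt ℝ u 0) (h0 : u 0 ≠ 0) : IsLogDual (σ.jet x η u) := by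
  right
  have h1 : ‖σ.germ fun k => u (x k)‖ = 1 :=
    norm_germ_eq_one (hu.continuousAt.tendsto.comp hx) h0
  rw [fst_jet, snd_jet, h1, Real.log_one, neg_zero, zero_smul, sub_zero]
  exact (isSmall_fderiv_apply hx hη hu).norm_germ_lt_one

end AsympScale

lemma Set.Countable.subringClosure {R : Type*} [CommRing R] {S : Set R} (hS : S.Countable) :
    (Subring.closure S : Set R).Countable := by
  have : Countable S := hS.to_subtype
  have hle : (Subring.closure S : Set R) ⊆
      range (MvPolynomial.aeval (fun s : S => (s : R)) : MvPolynomial S ℤ →ₐ[ℤ] R) := by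
    change Subring.closure S ≤ (MvPolynomial.aeval (fun s : S => (s : R)) :
      MvPolynomial S ℤ →ₐ[ℤ] R).toRingHom.range
    refine Subring.closure_le.2 fun s hs => ⟨MvPolynomial.X ⟨s, hs⟩, by simp⟩
  have : Countable (MvPolynomial S ℤ) := by
    rw [← Cardinal.mk_le_aleph0_iff]
    refine MvPolynomial.cardinalMk_le_max_lift.trans ?_
    simp
  exact (countable_range _).mono hle

section GenericDirection

variable {F : Type*} [NormedAddCommGroup F] [NormedSpace ℝ F]

lemma AnalyticAt.exists_diagonal_ne_zero {g : F → ℝ} (hg : AnalyticAt ℝ g 0)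
    (hne : ¬ ∀ᶠ w in 𝓝 0, g w = 0) :
    ∃ q : F → ℝ, AnalyticOnNhd ℝ q univ ∧ (∃ v, q v ≠ 0) ∧
      ∀ v, q v ≠ 0 → ¬ ∀ᶠ t in 𝓝 (0 : ℝ), g (t • v) = 0 := by
  obtain ⟨p, hp⟩ := hg
  have hex : ∃ m v, p m (fun _ => v) ≠ 0 := by
    by_contra! hcon
    refine hne ?_
    filter_upwards [hp.eventually_hasSum] with w hw
    rw [zero_add] at hw
    refine hw.unique ?_
    simp [hcon]
  obtain ⟨m, v₀, hv₀⟩ := hex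
  refine ⟨fun v => p m fun _ => v, ?_, ⟨v₀, hv₀⟩, fun v hv hzero => hv ?_⟩
  · have : ContDiff ℝ (⊤ : WithTop ℕ∞) fun v => p m fun _ => v :=
      (p m).contDiff.comp (contDiff_pi.2 fun _ => contDiff_id)
    exact fun v _ => this.contDiffAt.analyticAt
  · have h1 : HasFPowerSeriesAt (fun t : ℝ => g (t • v))
        (p.compContinuousLinearMap (ContinuousLinearMap.toSpanSingleton ℝ v)) 0 := by
      have : HasFPowerSeriesAt g p (ContinuousLinearMap.toSpanSingleton ℝ v 0) := by simpa using hp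
      exact this.compContinuousLinearMap
    have h2 := (h1.congr (g := 0) hzero).eq_zero
    have h3 := congrArg (fun q : FormalMultilinearSeries ℝ ℝ ℝ => q m fun _ => (1 : ℝ)) h2
    rw [FormalMultilinearSeries.compContinuousLinearMap_apply] at h3
    simpa [Function.comp_def] using h3

lemma AnalyticOnNhd.dense_ne_zero {q : F → ℝ} (hq : AnalyticOnNhd ℝ q univ) (hne : ∃ v, q v ≠ 0) :
    Dense {v | q v ≠ 0} := by
  obtain ⟨v, hv⟩ := hne
  intro w
  by_contra hw
  rw [mem_closure_iff_frequently, not_frequently] at hw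
  exact hv (hq.eqOn_zero_of_preconnected_of_eventuallyEq_zero isPreconnected_univ (mem_univ w)
    (hw.mono fun z hz => not_not.1 hz) (mem_univ v))

/-- Countably many nonzero analytic germs are simultaneously nonzero along a generic line. -/
lemma exists_generic_direction [CompleteSpace F] [Nontrivial F] {S : Set (F → ℝ)}
    (hS : S.Countable) (hSa : ∀ g ∈ S, AnalyticAt ℝ g 0) (hne : ∀ g ∈ S, ¬ ∀ᶠ w in 𝓝 0, g w = 0) :
    ∃ v : F, v ≠ 0 ∧ ∀ g ∈ S, ¬ ∀ᶠ t in 𝓝 (0 : ℝ), g (t • v) = 0 := by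
  choose! q hq hqne hqv using fun g hg => (hSa g hg).exists_diagonal_ne_zero (hne g hg)
  have hd : Dense (⋂ g ∈ S, {v | q g v ≠ 0}) :=
    dense_biInter_of_isOpen
      (fun g hg => isOpen_ne_fun (continuousOn_univ.1 (hq g hg).continuousOn) continuous_const) hS
      fun g hg => (hq g hg).dense_ne_zero (hqne g hg)
  obtain ⟨v, hv, hv0⟩ := hd.inter_open_nonempty {0}ᶜ isOpen_compl_singleton
    (exists_ne (0 : F))
  exact ⟨v, hv, fun g hg => hqv g hg v (mem_iInter₂.1 hv0 g hg)⟩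

end GenericDirection

lemma exists_equiv_prod {n : ℕ} {F : Type*} [NormedAddCommGroup F] [NormedSpace ℝ F]
    [FiniteDimensional ℝ F] (hF : Module.finrank ℝ F = n + 1) {v : F} (hv : v ≠ 0) :
    ∃ e : F ≃L[ℝ] (Fin n → ℝ) × ℝ, e.symm (0, 1) = v := by
  let e₀ : F ≃L[ℝ] (Fin n → ℝ) × ℝ := ContinuousLinearEquiv.ofFinrankEq (by simp [hF])
  obtain ⟨A, hA⟩ := SeparatingDual.exists_continuousLinearEquiv_apply_eq (R := ℝ)
    (x := v) (y := e₀.symm (0, 1)) hv (by simp)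
  refine ⟨A.trans e₀, ?_⟩
  rw [ContinuousLinearEquiv.symm_apply_eq]
  simp [hA]

namespace AsympScale

open DualNumber

variable (σ : AsympScale)

/-- Along every sequence converging to the origin of `E`, countably many analytic functions have
logarithmic jets in a common small direction. -/
def HasLogJets (E : Type*) [NormedAddCommGroup E] [NormedSpace ℝ E] : Prop :=
  ∀ S : Set (E → ℝ), S.Countable → (∀ g ∈ S, AnalyticAt ℝ g 0) →
    ∀ x : ℕ → E, Tendsto x (hyperfilter ℕ) (𝓝 0) →
      ∃ η : ℕ → E, σ.IsSmall η ∧ ∀ g ∈ S, IsLogDual (σ.jet x η g)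

variable {σ} {E F : Type*} [NormedAddCommGroup E] [NormedSpace ℝ E]
  [NormedAddCommGroup F] [NormedSpace ℝ F]

lemma isLogDual_jet_of_eventually_eq_zero {x η : ℕ → E} (hx : Tendsto x (hyperfilter ℕ) (𝓝 0))
    {g : E → ℝ} (hg : ∀ᶠ w in 𝓝 0, g w = 0) : IsLogDual (σ.jet x η g) := by
  left
  rw [jet_congr (h := fun _ => 0) hx hg, jet_const]
  simp

lemma jet_comp_symm (e : E ≃L[ℝ] F) (x : ℕ → E) (η : ℕ → F) (g : E → ℝ) :
    σ.jet x (fun k => e.symm (η k)) g = σ.jet (fun k => e (x k)) η fun w => g (e.symm w) := by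
  rw [jet_comp_equiv]
  simp

lemma _root_.ContinuousLinearEquiv.tendsto_zero_comp {ι : Type*} {l : Filter ι} (e : E ≃L[ℝ] F)
    {x : ι → E} (hx : Tendsto x l (𝓝 0)) : Tendsto (fun k => e (x k)) l (𝓝 0) := by
  simpa [Function.comp_def] using (e.continuous.tendsto 0).comp hx

lemma _root_.AnalyticAt.comp_equiv_symm (e : E ≃L[ℝ] F) {g : E → ℝ} (hg : AnalyticAt ℝ g 0) :
    AnalyticAt ℝ (fun w => g (e.symm w)) 0 :=
  AnalyticAt.fun_comp (g := g) (f := e.symm) (by simpa using hg)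
    ((e.symm : F →L[ℝ] E).analyticAt 0)

lemma IsSmall.comp_equiv_symm (e : E ≃L[ℝ] F) {η : ℕ → F} (hη : σ.IsSmall η) :
    σ.IsSmall fun k => e.symm (η k) :=
  hη.of_le (Eventually.of_forall fun k => (e.symm : F →L[ℝ] E).le_opNorm (η k))

lemma HasLogJets.of_equiv (e : E ≃L[ℝ] F) (h : σ.HasLogJets F) : σ.HasLogJets E := by
  intro S hS hSa x hx
  obtain ⟨η, hη, hlog⟩ := h ((fun g w => g (e.symm w)) '' S) (hS.image _)
    (by rintro _ ⟨g, hg, rfl⟩; exact (hSa g hg).comp_equiv_symm e) _ (e.tendsto_zero_comp hx)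
  refine ⟨fun k => e.symm (η k), hη.comp_equiv_symm e, fun g hg => ?_⟩
  rw [jet_comp_symm]
  exact hlog _ ⟨g, hg, rfl⟩

/-- A direction with logarithmic jets extends to one more variable. -/
lemma exists_extension_direction {x η : ℕ → E} (hx : Tendsto x (hyperfilter ℕ) (𝓝 0))
    (hη : σ.IsSmall η) (T : Subring (E → ℝ)) (hT : ∀ a ∈ T, AnalyticAt ℝ a 0)
    (hlog : ∀ a ∈ T, IsLogDual (σ.jet x η a)) {t : ℕ → ℝ} (ht : Tendsto t (hyperfilter ℕ) (𝓝 0)) :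
    ∃ (y : ℕ → ℝ) (G : Subring σ.Quot[ε]), σ.IsSmall y ∧ (∀ z ∈ G, IsLogDual z) ∧
      (∀ a ∈ T, σ.jet x η a ∈ G) ∧
      TrivSqZeroExt.inl (σ.germ t) + TrivSqZeroExt.inr (σ.germ y) ∈ G := by
  let G₀ : Subring σ.Quot[ε] := (T.comap (analyticSubring E).subtype).map (jetHom hx hη)
  obtain ⟨G, hG₀, hG, hsurj⟩ := exists_subring_isLogDual σ.norm_algebraMap_quot_le
    (fun c ρ _ h => σ.quot_spherically_complete c ρ h) G₀ (by
      rintro _ ⟨a, ha, rfl⟩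
      exact hlog a ha)
  obtain ⟨G', hG', hGG', hreal⟩ := exists_subring_isLogDual_of_involution σ.norm_algebraMap_quot_le
    σ.conj conj_conj norm_conj conj_algebraMap G hG hsurj
  obtain ⟨y₀, hy₀, hmem⟩ := hreal (σ.germ t) (conj_germ t)
  obtain ⟨y, hy, rfl⟩ := exists_germ_eq hy₀
  refine ⟨y, G', isSmall_of_norm_germ_lt_one hy ?_, hG', fun a ha => ?_, hmem⟩
  · have ht1 : ‖σ.germ t‖ ≤ 1 := norm_germ_le_one (C := 1) <|
      (ht.abs.eventually_lt_const (u := 1) (by simp)).mono fun _ => le_of_lt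
    rcases ht1.lt_or_eq with h | h
    · refine lt_of_le_of_lt ?_ h
      simpa using (hG' _ hmem).norm_snd_le σ.norm_algebraMap_quot_le
    · rcases hG' _ hmem with h0 | h0
      · have := congrArg TrivSqZeroExt.fst h0
        simp only [TrivSqZeroExt.fst_add, TrivSqZeroExt.fst_inl, TrivSqZeroExt.fst_inr, add_zero,
          TrivSqZeroExt.fst_zero] at this
        rw [this, norm_zero] at h
        exact absurd h zero_ne_one
      · simpa [h] using h0
  · refine hGG' _ (hG₀ ⟨⟨a, hT a ha⟩, ha, rfl⟩) ?_ ?_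
    · simp [conj_germ]
    · simp [conj_germ]

lemma exists_direction_prod (h : σ.HasLogJets E) {S : Set (E × ℝ → ℝ)} (hS : S.Countable)
    (hSa : ∀ g ∈ S, AnalyticAt ℝ g 0)
    (hne : ∀ g ∈ S, (∀ᶠ w in 𝓝 0, g w = 0) ∨ ¬ ∀ᶠ t in 𝓝 (0 : ℝ), g (0, t) = 0)
    {x : ℕ → E × ℝ} (hx : Tendsto x (hyperfilter ℕ) (𝓝 0)) :
    ∃ η : ℕ → E × ℝ, σ.IsSmall η ∧ ∀ g ∈ S, IsLogDual (σ.jet x η g) := by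
  let S₁ : Set (E × ℝ → ℝ) := {g ∈ S | ¬ ∀ᶠ t in 𝓝 (0 : ℝ), g (0, t) = 0}
  have : Countable S₁ := (hS.mono fun g hg => hg.1).to_subtype
  choose d a u ha hu hu0 heq using fun g : S₁ => (hSa g g.2.1).weierstrass_preparation g.2.2
  let T : Subring (E → ℝ) := Subring.closure (⋃ g : S₁, range (a g))
  have hT : T ≤ analyticSubring E := by
    refine Subring.closure_le.2 (iUnion_subset fun g => ?_)
    rintro _ ⟨i, rfl⟩
    exact ha g i
  have hTc : (T : Set (E → ℝ)).Countable :=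
    (countable_iUnion fun g => countable_range (a g)).subringClosure
  have hx1 : Tendsto (fun k => (x k).1) (hyperfilter ℕ) (𝓝 0) :=
    (continuous_fst.tendsto (0 : E × ℝ)).comp hx
  have hx2 : Tendsto (fun k => (x k).2) (hyperfilter ℕ) (𝓝 0) :=
    (continuous_snd.tendsto (0 : E × ℝ)).comp hx
  obtain ⟨η, hη, hlog⟩ := h T hTc (fun g hg => hT hg) _ hx1
  obtain ⟨y, G, hy, hG, hTG, hyG⟩ := exists_extension_direction hx1 hη T (fun g hg => hT hg) hlog hx2
  have hηy : σ.IsSmall fun k => (η k, y k) := hη.prodMk hy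
  refine ⟨fun k => (η k, y k), hηy, fun g hg => ?_⟩
  by_cases hz : ∀ᶠ w in 𝓝 0, g w = 0
  · exact isLogDual_jet_of_eventually_eq_zero hx hz
  obtain ⟨g, rfl⟩ : ∃ g' : S₁, (g' : E × ℝ → ℝ) = g := ⟨⟨g, hg, (hne g hg).resolve_left hz⟩, rfl⟩
  let H : Subring (analyticSubring (E × ℝ)) := G.comap (jetHom hx hηy)
  let T₂ : analyticSubring (E × ℝ) := ⟨fun w => w.2, analyticAt_snd⟩
  let A : Fin (d g) → analyticSubring (E × ℝ) := fun i => ⟨fun w => a g i w.1,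
    AnalyticAt.fun_comp (g := a g i) (f := fun w : E × ℝ => w.1) (ha g i) analyticAt_fst⟩
  have hT₂ : T₂ ∈ H := by
    change σ.jet x _ _ ∈ G
    rw [jet_snd (x := fun k => (x k).1) (t := fun k => (x k).2)]
    exact hyG
  have hA : ∀ i, A i ∈ H := by
    intro i
    change σ.jet x _ _ ∈ G
    rw [jet_comp_fst (x := fun k => (x k).1) (t := fun k => (x k).2) hx1 (ha g i)]
    exact hTG _ (Subring.subset_closure (mem_iUnion.2 ⟨g, i, rfl⟩))
  let P : analyticSubring (E × ℝ) := T₂ ^ d g + ∑ i, A i * T₂ ^ (i : ℕ)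
  have hP : P ∈ H := H.add_mem (H.pow_mem hT₂ _)
    (H.sum_mem fun i _ => H.mul_mem (hA i) (H.pow_mem hT₂ _))
  have hPlog : IsLogDual (σ.jet x (fun k => (η k, y k)) P) := hG _ hP
  have hgP : (g : E × ℝ → ℝ) =ᶠ[𝓝 0] u g * (P : E × ℝ → ℝ) := by
    filter_upwards [heq g] with w hw
    rw [hw]
    simp [P, T₂, A]
  rw [jet_congr hx hgP, jet_mul hx hηy (hu g) P.2]
  exact (isLogDual_jet_of_ne_zero hx hηy (hu g) (hu0 g)).mul hPlog

lemma hasLogJets_pi (n : ℕ) : σ.HasLogJets (Fin n → ℝ) := by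
  induction n with
  | zero =>
    intro S _ _ x hx
    refine ⟨fun _ => 0, ⟨0, zero_lt_one, Eventually.of_forall fun k => ?_⟩, fun g _ => ?_⟩
    · rw [norm_zero, Real.zero_rpow (σ.pos k).ne']
    · have hg : σ.jet x (fun _ => 0) g = σ.jet x (fun _ => 0) fun _ => g 0 :=
        congrArg _ (funext fun w => congrArg g (Subsingleton.elim w 0))
      by_cases h0 : g 0 = 0
      · exact isLogDual_jet_of_eventually_eq_zero hx (Eventually.of_forall fun w => by
          rw [Subsingleton.elim w 0, h0])
      · right
        rw [hg, jet_const]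
        simp only [TrivSqZeroExt.snd_inl, TrivSqZeroExt.fst_inl]
        rw [norm_algebraMap_real σ.norm_algebraMap_quot_le h0]
        simp
  | succ n ih =>
    intro S hS hSa x hx
    obtain ⟨v, hv, hvS⟩ := exists_generic_direction (S := {g ∈ S | ¬ ∀ᶠ w in 𝓝 0, g w = 0})
      (hS.mono fun g hg => hg.1) (fun g hg => hSa g hg.1) fun g hg => hg.2
    obtain ⟨e, he⟩ := exists_equiv_prod (n := n) (by simp) hv
    obtain ⟨η, hη, hlog⟩ := exists_direction_prod ih (S := (fun g w => g (e.symm w)) '' S)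
      (hS.image _) (by rintro _ ⟨g, hg, rfl⟩; exact (hSa g hg).comp_equiv_symm e)
      (by
        rintro _ ⟨g, hg, rfl⟩
        by_cases hz : ∀ᶠ w in 𝓝 0, g w = 0
        · exact Or.inl ((e.symm.tendsto_zero_comp tendsto_id).eventually hz)
        · right
          have h1 : ∀ t : ℝ, e.symm (0, t) = t • v := fun t => by
            rw [← he, ← map_smul]
            simp
          simpa only [h1] using hvS g ⟨hg, hz⟩) (e.tendsto_zero_comp hx)
    refine ⟨fun k => e.symm (η k), hη.comp_equiv_symm e, fun g hg => ?_⟩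
    rw [jet_comp_symm]
    exact hlog _ ⟨g, hg, rfl⟩

theorem hasLogJets [FiniteDimensional ℝ E] : σ.HasLogJets E :=
  HasLogJets.of_equiv (ContinuousLinearEquiv.ofFinrankEq (by simp))
    (hasLogJets_pi (Module.finrank ℝ E))

end AsympScale

section Lojasiewicz

open DualNumber AsympScale

variable {E : Type*} [NormedAddCommGroup E] [NormedSpace ℝ E] [FiniteDimensional ℝ E]

/-- There is no sequence along which an analytic function vanishing at the origin violates the
gradient inequality with exponents tending to one. -/
lemma AnalyticAt.not_forall_norm_fderiv_le {g : E → ℝ} (hg : AnalyticAt ℝ g 0) {x : ℕ → E}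
    (hx : Tendsto x atTop (𝓝 0)) (h0 : Tendsto (fun k => g (x k)) atTop (𝓝 0))
    (hpos : ∀ k, 0 < |g (x k)|) (hlt : ∀ k, |g (x k)| < 1) {θ : ℕ → ℝ}
    (hθ : Tendsto θ atTop (𝓝 1)) :
    ¬ ∀ k, ‖fderiv ℝ g (x k)‖ ≤ |g (x k)| ^ θ k := by
  intro hle
  have hlog : ∀ k, Real.log |g (x k)| < 0 := fun k => Real.log_neg (hpos k) (hlt k)
  have hnhds : Tendsto (fun k => |g (x k)|) atTop (𝓝[>] 0) :=
    tendsto_nhdsWithin_iff.2 ⟨by simpa using h0.abs, Eventually.of_forall hpos⟩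
  let σ : AsympScale :=
    { rate := fun k => (-Real.log |g (x k)|)⁻¹
      pos := fun k => inv_pos.2 (neg_pos.2 (hlog k))
      tendsto := (tendsto_neg_atBot_atTop.comp
        (Real.tendsto_log_nhdsGT_zero.comp hnhds)).inv_tendsto_atTop }
  have hrate : ∀ k, |g (x k)| ^ σ.rate k = Real.exp (-1) := fun k => by
    rw [Real.rpow_def_of_pos (hpos k)]
    congr 1
    change _ * (-Real.log |g (x k)|)⁻¹ = -1
    have := (hlog k).ne
    field_simp
  have hx' : Tendsto x (hyperfilter ℕ) (𝓝 0) := hx.mono_left Nat.hyperfilter_le_atTop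
  obtain ⟨η, hη, hS⟩ := hasLogJets (σ := σ) (E := E) {g} (countable_singleton g)
    (by rintro _ rfl; exact hg) x hx'
  have hz := hS g rfl
  have hm := isModerate_apply (σ := σ) hx' hg.continuousAt
  have hfst : ‖σ.germ fun k => g (x k)‖ = Real.exp (-1) := by
    refine tendsto_nhds_unique (tendsto_germ hm) ?_
    simp only [hrate]
    exact tendsto_const_nhds
  have hsnd : ‖σ.germ fun k => fderiv ℝ g (x k) (η k)‖ < Real.exp (-1) := by
    have hm' := (isSmall_fderiv_apply hx' hη hg).isModerate
    obtain ⟨c, hc, hcη⟩ := hη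
    have h1 : Tendsto (fun k => Real.exp (-1) ^ θ k * c) (hyperfilter ℕ)
        (𝓝 (Real.exp (-1) ^ (1 : ℝ) * c)) := by
      refine Tendsto.mul_const c ?_
      exact ((Real.continuous_const_rpow (Real.exp_pos _).ne').tendsto 1).comp
        (hθ.mono_left Nat.hyperfilter_le_atTop)
    refine (le_of_tendsto_of_tendsto (tendsto_germ hm') h1 ?_).trans_lt ?_
    · filter_upwards [hcη] with k hk
      calc |fderiv ℝ g (x k) (η k)| ^ σ.rate k
          ≤ (|g (x k)| ^ θ k * ‖η k‖) ^ σ.rate k := by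
            refine Real.rpow_le_rpow (abs_nonneg _) ?_ (σ.pos k).le
            exact ((fderiv ℝ g (x k)).le_opNorm (η k)).trans
              (mul_le_mul_of_nonneg_right (hle k) (norm_nonneg _))
        _ = Real.exp (-1) ^ θ k * ‖η k‖ ^ σ.rate k := by
            rw [Real.mul_rpow (by positivity) (norm_nonneg _), ← Real.rpow_mul (abs_nonneg _),
              mul_comm (θ k), Real.rpow_mul (abs_nonneg _), hrate]
        _ ≤ Real.exp (-1) ^ θ k * c := by gcongr
    · rw [Real.rpow_one]
      exact mul_lt_of_lt_one_right (Real.exp_pos _) hc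
  rcases hz with hz | hz
  · have := congrArg (fun z => ‖TrivSqZeroExt.fst z‖) hz
    simp only [fst_jet, hfst, TrivSqZeroExt.fst_zero, norm_zero] at this
    exact (Real.exp_pos _).ne' this
  · rw [fst_jet, snd_jet, hfst, Real.log_exp, neg_neg, one_smul, norm_sub_rev] at hz
    have := norm_add_lt_of_lt hz hsnd
    rw [sub_add_cancel, hfst] at this
    exact lt_irrefl _ this

/-- **Łojasiewicz gradient inequality.** -/
theorem AnalyticAt.lojasiewicz_inequality {f : E → ℝ} {p : E} (hf : AnalyticAt ℝ f p) :
    ∃ θ ∈ Ioo (0 : ℝ) 1, ∃ C > 0, ∀ᶠ x in 𝓝 p, |f x - f p| ^ θ ≤ C * ‖fderiv ℝ f x‖ := by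
  by_contra! hcon
  have hθ : ∀ k : ℕ, (1 - 1 / ((k : ℝ) + 2)) ∈ Ioo (0 : ℝ) 1 := fun k => by
    have h1 : (0 : ℝ) < (k : ℝ) + 2 := by positivity
    have h2 : 1 / ((k : ℝ) + 2) < 1 := by rw [div_lt_one h1]; linarith [k.cast_nonneg (α := ℝ)]
    have h3 : 0 < 1 / ((k : ℝ) + 2) := by positivity
    exact ⟨by linarith, by linarith⟩
  have hex : ∀ k : ℕ, ∃ x : E, ‖x - p‖ < 1 / ((k : ℝ) + 1) ∧ |f x - f p| < 1 ∧
      1 * ‖fderiv ℝ f x‖ < |f x - f p| ^ (1 - 1 / ((k : ℝ) + 2)) := fun k => by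
    have h1 := hcon _ (hθ k) 1 one_pos
    have h2 : ∀ᶠ x in 𝓝 p, ‖x - p‖ < 1 / ((k : ℝ) + 1) := by
      filter_upwards [Metric.ball_mem_nhds p (Nat.one_div_pos_of_nat (n := k) (α := ℝ))] with x hx
      rwa [mem_ball_iff_norm] at hx
    have h3 : ∀ᶠ x in 𝓝 p, |f x - f p| < 1 := by
      have : Tendsto (fun x => |f x - f p|) (𝓝 p) (𝓝 |f p - f p|) :=
        (hf.continuousAt.tendsto.sub_const _).abs
      exact this.eventually_lt_const (by simp)
    obtain ⟨x, hx, hx2, hx3⟩ := (h1.and_eventually (h2.and h3)).exists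
    exact ⟨x, hx2, hx3, hx⟩
  choose x hxp hx1 hxf using hex
  have hlim : Tendsto x atTop (𝓝 p) := by
    rw [tendsto_iff_norm_sub_tendsto_zero]
    exact squeeze_zero (fun _ => norm_nonneg _) (fun k => (hxp k).le)
      tendsto_one_div_add_atTop_nhds_zero_nat
  let g : E → ℝ := fun w => f (p + w) - f p
  have hg : AnalyticAt ℝ g 0 := by
    refine AnalyticAt.sub ?_ analyticAt_const
    exact AnalyticAt.fun_comp (g := f) (f := fun w => p + w) (by simpa using hf)
      (analyticAt_const.add analyticAt_id)
  have hgx : ∀ k, g (x k - p) = f (x k) - f p := fun k => by simp [g]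
  have hgd : ∀ k, fderiv ℝ g (x k - p) = fderiv ℝ f (x k) := fun k => by
    simp only [g]
    rw [fderiv_sub_const, fderiv_comp_add_left, add_sub_cancel]
  refine hg.not_forall_norm_fderiv_le (x := fun k => x k - p)
    (θ := fun k : ℕ => 1 - 1 / ((k : ℝ) + 2)) ?_ ?_ ?_ ?_ ?_ ?_
  · simpa using hlim.sub_const p
  · simp only [hgx]
    simpa using (hf.continuousAt.tendsto.comp hlim).sub_const (f p)
  · intro k
    rw [hgx, abs_pos]
    intro h0
    have := hxf k
    rw [h0, abs_zero, Real.zero_rpow (hθ k).1.ne', one_mul] at this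
    exact this.not_ge (norm_nonneg _)
  · intro k
    rw [hgx]
    exact hx1 k
  · have h1 : Tendsto (fun k : ℕ => 1 / ((k : ℝ) + 2)) atTop (𝓝 0) := by
      have := (tendsto_add_atTop_iff_nat 1).2 (tendsto_one_div_add_atTop_nhds_zero_nat (𝕜 := ℝ))
      refine this.congr fun k => ?_
      push_cast
      ring
    simpa using h1.const_sub 1
  · intro k
    rw [hgx, hgd]
    simpa using (hxf k).le

end Lojasiewicz

section Lojasiewicz

variable {E : Type*} [NormedAddCommGroup E] [NormedSpace ℝ E]

/-- The Łojasiewicz gradient inequality holds near a point which is not critical. -/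
theorem lojasiewicz_inequality_of_fderiv_ne_zero {f : E → ℝ} {p : E} (hf : ContDiffAt ℝ 1 f p)
    (hp : fderiv ℝ f p ≠ 0) :
    ∃ θ ∈ Ioo (0 : ℝ) 1, ∃ C > 0, ∀ᶠ x in 𝓝 p, |f x - f p| ^ θ ≤ C * ‖fderiv ℝ f x‖ := by
  refine ⟨1 / 2, by norm_num, 1, one_pos, ?_⟩
  have h₁ : Tendsto (fun x => |f x - f p| ^ (1 / 2 : ℝ)) (𝓝 p) (𝓝 0) := by
    have h : ContinuousAt (fun x => |f x - f p| ^ (1 / 2 : ℝ)) p :=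
      ((hf.continuousAt.sub continuousAt_const).abs).rpow_const (Or.inr (by norm_num))
    simpa [ContinuousAt] using h
  have h₂ : Tendsto (fun x => ‖fderiv ℝ f x‖) (𝓝 p) (𝓝 ‖fderiv ℝ f p‖) :=
    ((hf.fderiv_right (m := 0) (by norm_num)).continuousAt).norm
  filter_upwards [h₁.eventually_lt h₂ (norm_pos_iff.2 hp)] with x hx
  simpa using hx.le

/-- The Łojasiewicz gradient inequality, with exponent `1 / 2`, holds near a nondegenerate critical
point. -/
theorem lojasiewicz_inequality_of_injective_fderiv_fderiv [FiniteDimensional ℝ E] {f : E → ℝ}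
    {p : E} (hf : ContDiff ℝ 2 f) (hp : fderiv ℝ f p = 0)
    (hinj : Function.Injective (fderiv ℝ (fderiv ℝ f) p)) :
    ∃ θ ∈ Ioo (0 : ℝ) 1, ∃ C > 0, ∀ᶠ x in 𝓝 p, |f x - f p| ^ θ ≤ C * ‖fderiv ℝ f x‖ := by
  have hd : HasFDerivAt (fderiv ℝ f) (fderiv ℝ (fderiv ℝ f) p) p :=
    ((hf.fderiv_right (m := 1) (by norm_num)).differentiable one_ne_zero p).hasFDerivAt
  obtain ⟨K, -, hK⟩ := (fderiv ℝ (fderiv ℝ f) p).toLinearMap.exists_antilipschitzWith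
    (LinearMap.ker_eq_bot.2 hinj)
  have hind : IsInducing (fderiv ℝ (fderiv ℝ f) p) :=
    (hK.isUniformInducing (fderiv ℝ (fderiv ℝ f) p).uniformContinuous).isInducing
  obtain ⟨c, hc, hlow⟩ := (hd.isTheta_sub hind).2.exists_pos
  obtain ⟨M, hM, hup⟩ := (hd.isTheta_sub hind).1.exists_pos
  rw [Asymptotics.isBigOWith_iff] at hlow hup
  obtain ⟨r, hr, hball⟩ := Metric.eventually_nhds_iff_ball.1 hup
  refine ⟨1 / 2, by norm_num, √M * c, by positivity, ?_⟩
  filter_upwards [hlow, Metric.ball_mem_nhds p hr] with x hx hxr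
  have hmv : ‖f x - f p‖ ≤ M * ‖x - p‖ * ‖x - p‖ := by
    refine (convex_closedBall p ‖x - p‖).norm_image_sub_le_of_norm_fderiv_le (𝕜 := ℝ)
      (fun z _ => hf.differentiable two_ne_zero z) (fun z hz => ?_)
      (Metric.mem_closedBall_self (norm_nonneg _)) (by simp [dist_eq_norm])
    rw [mem_closedBall_iff_norm] at hz
    have h := hball z (mem_ball_iff_norm.2 (hz.trans_lt (mem_ball_iff_norm.1 hxr)))
    rw [hp, sub_zero] at h
    exact h.trans (by gcongr)
  rw [hp, sub_zero] at hx
  rw [← Real.sqrt_eq_rpow, mul_assoc]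
  calc √|f x - f p| ≤ √(M * ‖x - p‖ ^ 2) := Real.sqrt_le_sqrt (by
        rw [← Real.norm_eq_abs]; linarith [hmv])
    _ = √M * ‖x - p‖ := by rw [Real.sqrt_mul hM.le, Real.sqrt_sq (norm_nonneg _)]
    _ ≤ √M * (c * ‖fderiv ℝ f x‖) := by gcongr

end Lojasiewicz

section Gradient

variable {E : Type*} [NormedAddCommGroup E] [InnerProductSpace ℝ E] [CompleteSpace E]

theorem norm_gradient (f : E → ℝ) (x : E) : ‖gradient f x‖ = ‖fderiv ℝ f x‖ :=
  LinearIsometryEquiv.norm_map _ _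

theorem fderiv_eq_zero_iff_gradient_eq_zero {f : E → ℝ} {x : E} :
    fderiv ℝ f x = 0 ↔ gradient f x = 0 := by
  rw [← norm_eq_zero, ← norm_gradient, norm_eq_zero]

theorem ContDiff.gradient {f : E → ℝ} (hf : ContDiff ℝ 2 f) : ContDiff ℝ 1 (gradient f) :=
  (InnerProductSpace.toDual ℝ E).symm.contDiff.comp (hf.fderiv_right (m := 1) (by norm_num))

theorem fderiv_fderiv_injective_of_fderiv_gradient_injective {f : E → ℝ} {x : E}
    (h : Function.Injective (fderiv ℝ (_root_.gradient f) x)) :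
    Function.Injective (fderiv ℝ (fderiv ℝ f) x) := by
  have key : fderiv ℝ (_root_.gradient f) x =
      ((InnerProductSpace.toDual ℝ E).symm.toContinuousLinearEquiv.toContinuousLinearMap).comp
        (fderiv ℝ (fderiv ℝ f) x) :=
    (InnerProductSpace.toDual ℝ E).symm.toContinuousLinearEquiv.comp_fderiv
  rw [key] at h
  exact Function.Injective.of_comp (f := (InnerProductSpace.toDual ℝ E).symm) h

/-- A `C²` function whose critical points are all nondegenerate, or which is analytic near each of
its critical points, satisfies the Łojasiewicz gradient inequality near every point. -/
theorem lojasiewicz_inequality_of_nondegenerate_or_analytic [FiniteDimensional ℝ E] {f : E → ℝ}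
    (hf : ContDiff ℝ 2 f)
    (h : (∀ x, _root_.gradient f x = 0 →
          Function.Bijective (fderiv ℝ (_root_.gradient f) x)) ∨
        (∀ x, _root_.gradient f x = 0 → ∃ U ∈ 𝓝 x, AnalyticOnNhd ℝ f U)) (p : E) :
    ∃ θ ∈ Ioo (0 : ℝ) 1, ∃ C > 0, ∀ᶠ x in 𝓝 p,
      |f x - f p| ^ θ ≤ C * ‖_root_.gradient f x‖ := by
  simp only [norm_gradient]
  by_cases hp : fderiv ℝ f p = 0
  · have hp' := fderiv_eq_zero_iff_gradient_eq_zero.1 hp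
    rcases h with h | h
    · exact lojasiewicz_inequality_of_injective_fderiv_fderiv hf hp
        (fderiv_fderiv_injective_of_fderiv_gradient_injective (h p hp').1)
    · obtain ⟨U, hU, hfU⟩ := h p hp'
      exact (hfU p (mem_of_mem_nhds hU)).lojasiewicz_inequality
  · exact lojasiewicz_inequality_of_fderiv_ne_zero (hf.of_le (by norm_num)).contDiffAt hp

end Gradient

section GlobalSolution

open scoped NNReal

variable {E : Type*} [NormedAddCommGroup E] [NormedSpace ℝ E] [CompleteSpace E]

/-- A bounded Lipschitz vector field has an integral curve through every point defined for all
times. -/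
theorem LipschitzWith.exists_forall_hasDerivAt {v : E → E} {K L : ℝ≥0} (hv : LipschitzWith K v)
    (hL : ∀ x, ‖v x‖ ≤ L) (b : E) :
    ∃ y : ℝ → E, y 0 = b ∧ ∀ t, HasDerivAt y (v (y t)) t := by
  have hloc : ∀ n : ℕ, ∃ y : ℝ → E, y 0 = b ∧
      ∀ t ∈ Ioo (-(n + 1 : ℝ)) (n + 1), HasDerivAt y (v (y t)) t := by
    intro n
    have hn : (0 : ℝ) ∈ Icc (-(n + 1 : ℝ)) (n + 1) := ⟨by linarith, by positivity⟩
    have hpl : IsPicardLindelof (fun _ => v) (⟨0, hn⟩ : Icc (-(n + 1 : ℝ)) (n + 1)) b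
        (L * (n + 1)) 0 L K :=
      .of_time_independent (fun x _ => hL x) hv.lipschitzOnWith (by simp)
    obtain ⟨y, hy₀, hy⟩ := hpl.exists_eq_forall_mem_Icc_hasDerivWithinAt₀
    exact ⟨y, hy₀, fun t ht => (hy t (Ioo_subset_Icc_self ht)).hasDerivAt
      (Icc_mem_nhds ht.1 ht.2)⟩
  choose y hy₀ hy using hloc
  have hagree : ∀ m n : ℕ, m ≤ n → EqOn (y m) (y n) (Ioo (-(m + 1 : ℝ)) (m + 1)) := by
    intro m n hmn
    have hmn' : (m : ℝ) ≤ n := by exact_mod_cast hmn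
    refine ODE_solution_unique_of_mem_Ioo (v := fun _ => v) (s := fun _ => univ) (K := K)
      (t₀ := 0) (fun _ _ => hv.lipschitzOnWith) ⟨by linarith [m.cast_nonneg (α := ℝ)], by positivity⟩
      (fun t ht => ⟨hy m t ht, mem_univ _⟩)
      (fun t ht => ⟨hy n t ⟨by linarith [ht.1], by linarith [ht.2]⟩, mem_univ _⟩)
      (by rw [hy₀, hy₀])
  refine ⟨fun t => y ⌈|t|⌉₊ t, by simp [hy₀], fun t => ?_⟩
  set n := ⌈|t|⌉₊ with hn
  have ht : t ∈ Ioo (-(n + 1 : ℝ)) (n + 1) := by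
    have := Nat.le_ceil |t|
    exact abs_lt.1 (by linarith)
  refine (hy n t ht).congr_of_eventuallyEq ?_
  filter_upwards [isOpen_Ioo.mem_nhds ht] with s hs
  have hs' : s ∈ Ioo (-((⌈|s|⌉₊ : ℕ) + 1 : ℝ)) ((⌈|s|⌉₊ : ℕ) + 1) := by
    have := Nat.le_ceil |s|
    exact abs_lt.1 (by linarith)
  rcases le_total ⌈|s|⌉₊ n with h | h
  · exact hagree _ _ h hs'
  · exact (hagree _ _ h hs).symm

end GlobalSolution

section GradientFlow

variable {E : Type*} [NormedAddCommGroup E] [InnerProductSpace ℝ E] [FiniteDimensional ℝ E]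

/-- The derivative of a function along a curve, in terms of the gradient. -/
theorem hasDerivAt_comp_inner_gradient {f : E → ℝ} {y : ℝ → E} {y' : E} {t : ℝ}
    (hf : DifferentiableAt ℝ f (y t)) (hy : HasDerivAt y y' t) :
    HasDerivAt (fun s => f (y s)) (inner ℝ (gradient f (y t)) y') t := by
  rw [inner_gradient_left]
  exact hf.hasFDerivAt.comp_hasDerivAt t hy

/-- A function decreases along its gradient flow, slowed down by a nonnegative factor. -/
theorem antitoneOn_comp_of_hasDerivAt_neg_smul_gradient {f : E → ℝ} (hf : Differentiable ℝ f)
    {χ : E → ℝ} (hχ : ∀ x, 0 ≤ χ x) {y : ℝ → E}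
    (hy : ∀ t ∈ Ici (0 : ℝ), HasDerivAt y (-(χ (y t) • gradient f (y t))) t) :
    AntitoneOn (fun t => f (y t)) (Ici 0) := by
  have hd : ∀ t ∈ Ici (0 : ℝ), HasDerivAt (fun s => f (y s))
      (-(χ (y t) * ‖gradient f (y t)‖ ^ 2)) t := by
    intro t ht
    have h := hasDerivAt_comp_inner_gradient (hf (y t)) (hy t ht)
    rwa [inner_neg_right, real_inner_smul_right, real_inner_self_eq_norm_sq] at h
  refine antitoneOn_of_hasDerivWithinAt_nonpos (convex_Ici 0)
    (HasDerivAt.continuousOn hd) (fun t ht => (hd t (interior_subset ht)).hasDerivWithinAt)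
    (fun t _ => ?_)
  have := hχ (y t)
  simp only [Left.neg_nonpos_iff]
  positivity

theorem antitoneOn_comp_of_hasDerivAt_neg_gradient {f : E → ℝ} (hf : Differentiable ℝ f)
    {y : ℝ → E} (hy : ∀ t ∈ Ici (0 : ℝ), HasDerivAt y (-(gradient f (y t))) t) :
    AntitoneOn (fun t => f (y t)) (Ici 0) :=
  antitoneOn_comp_of_hasDerivAt_neg_smul_gradient hf (χ := fun _ => 1) (fun _ => zero_le_one)
    (fun t ht => by simpa using hy t ht)

/-- If the sublevel set of `f` through `b` is contained in a ball, then the gradient flow of `f`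
starting at `b` exists for all positive times. -/
theorem exists_gradient_flow {f : E → ℝ} (hf : ContDiff ℝ 2 f) {b : E} {R : ℝ} (hR : 0 < R)
    (hsub : ∀ x, f x ≤ f b → ‖x‖ ≤ R) :
    ∃ y : ℝ → E, y 0 = b ∧ ∀ t ∈ Ici (0 : ℝ), HasDerivAt y (-(gradient f (y t))) t := by
  let χ : ContDiffBump (0 : E) := ⟨R, R + 1, hR, by linarith⟩
  let v : E → E := fun x => -(χ x • gradient f x)
  have hv : ContDiff ℝ 1 v := ((χ.contDiff).smul hf.gradient).neg
  have hsupp : HasCompactSupport v := (χ.hasCompactSupport.smul_right).neg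
  obtain ⟨K, hK⟩ := ContDiff.lipschitzWith_of_hasCompactSupport hsupp hv one_ne_zero
  obtain ⟨L, hL⟩ := hsupp.exists_bound_of_continuous hv.continuous
  obtain ⟨y, hy₀, hy⟩ := hK.exists_forall_hasDerivAt (L := L.toNNReal)
    (fun x => (hL x).trans (Real.le_coe_toNNReal L)) b
  refine ⟨y, hy₀, fun t ht => ?_⟩
  have hle : f (y t) ≤ f b := by
    have h := antitoneOn_comp_of_hasDerivAt_neg_smul_gradient (hf.differentiable two_ne_zero)
      (χ := χ) (fun x => χ.nonneg) (fun t _ => hy t) self_mem_Ici ht ht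
    simpa [hy₀] using h
  have hone : χ (y t) = 1 := χ.one_of_mem_closedBall (by simpa using hsub _ hle)
  simpa [v, hone] using hy t

/-- Two gradient flow lines starting at the same point and staying in a bounded set agree. -/
theorem gradient_flow_unique {f : E → ℝ} (hf : ContDiff ℝ 2 f) {R : ℝ} {y z : ℝ → E}
    (hy : ∀ t ∈ Ici (0 : ℝ), HasDerivAt y (-(gradient f (y t))) t)
    (hz : ∀ t ∈ Ici (0 : ℝ), HasDerivAt z (-(gradient f (z t))) t)
    (hyR : ∀ t ∈ Ici (0 : ℝ), ‖y t‖ ≤ R) (hzR : ∀ t ∈ Ici (0 : ℝ), ‖z t‖ ≤ R)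
    (h₀ : z 0 = y 0) : EqOn z y (Ici 0) := by
  obtain ⟨K, hK⟩ := (hf.gradient.neg.locallyLipschitz.locallyLipschitzOn
    (s := Metric.closedBall (0 : E) R)).exists_lipschitzOnWith_of_compact (isCompact_closedBall 0 R)
  intro t ht
  have hsub : Icc 0 t ⊆ Ici (0 : ℝ) := Icc_subset_Ici_self
  have hsub' : Ico 0 t ⊆ Ici (0 : ℝ) := Ico_subset_Icc_self.trans hsub
  exact ODE_solution_unique_of_mem_Icc_right (v := fun _ x => -(gradient f x))
    (s := fun _ => Metric.closedBall 0 R) (fun _ _ => hK)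
    (HasDerivAt.continuousOn fun s hs => hz s (hsub hs))
    (fun s hs => (hz s (hsub' hs)).hasDerivWithinAt) (fun s hs => by simpa using hzR s (hsub' hs))
    (HasDerivAt.continuousOn fun s hs => hy s (hsub hs))
    (fun s hs => (hy s (hsub' hs)).hasDerivWithinAt) (fun s hs => by simpa using hyR s (hsub' hs))
    h₀ (right_mem_Icc.2 ht)

end GradientFlow

section Convergence

variable {E : Type*} [NormedAddCommGroup E] [InnerProductSpace ℝ E] [FiniteDimensional ℝ E]

theorem hasDerivAt_comp_gradient_flow {f : E → ℝ} (hf : Differentiable ℝ f) {y : ℝ → E}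
    (hy : ∀ t ∈ Ici (0 : ℝ), HasDerivAt y (-(gradient f (y t))) t) :
    ∀ t ∈ Ici (0 : ℝ), HasDerivAt (fun s => f (y s)) (-‖gradient f (y t)‖ ^ 2) t := by
  intro t ht
  have h := hasDerivAt_comp_inner_gradient (hf (y t)) (hy t ht)
  rwa [inner_neg_right, real_inner_self_eq_norm_sq] at h

/-- Along a gradient flow line, a function is bounded below by its value at any limit point. -/
theorem le_comp_of_mapClusterPt_gradient_flow {f : E → ℝ} (hf : Differentiable ℝ f) {y : ℝ → E}
    (hy : ∀ t ∈ Ici (0 : ℝ), HasDerivAt y (-(gradient f (y t))) t) {p : E}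
    (hp : MapClusterPt p atTop y) {t : ℝ} (ht : 0 ≤ t) : f p ≤ f (y t) := by
  by_contra! hlt
  have hfreq := (mapClusterPt_iff_frequently.1 hp) _
    (hf.continuous.continuousAt.eventually (lt_mem_nhds hlt))
  obtain ⟨s, hs, hts⟩ := (hfreq.and_eventually (eventually_ge_atTop t)).exists
  exact absurd (antitoneOn_comp_of_hasDerivAt_neg_gradient hf hy ht (ht.trans hts) hts)
    (not_le.2 hs)

/-- Along a gradient flow line, a function converges to its value at any limit point. -/
theorem tendsto_comp_of_mapClusterPt_gradient_flow {f : E → ℝ} (hf : Differentiable ℝ f)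
    {y : ℝ → E} (hy : ∀ t ∈ Ici (0 : ℝ), HasDerivAt y (-(gradient f (y t))) t) {p : E}
    (hp : MapClusterPt p atTop y) : Tendsto (fun t => f (y t)) atTop (𝓝 (f p)) := by
  refine tendsto_order.2 ⟨fun a ha => ?_, fun a ha => ?_⟩
  · filter_upwards [eventually_ge_atTop 0] with t ht
    exact ha.trans_le (le_comp_of_mapClusterPt_gradient_flow hf hy hp ht)
  · have hfreq := (mapClusterPt_iff_frequently.1 hp) _
      (hf.continuous.continuousAt.eventually (gt_mem_nhds ha))
    obtain ⟨s, hs, hs₀⟩ := (hfreq.and_eventually (eventually_ge_atTop 0)).exists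
    filter_upwards [eventually_ge_atTop s] with t ht
    exact (antitoneOn_comp_of_hasDerivAt_neg_gradient hf hy hs₀ (hs₀.trans ht) ht).trans_lt hs

/-- The limit of a gradient flow line is a critical point. -/
theorem gradient_eq_zero_of_tendsto_gradient_flow {f : E → ℝ} (hf : ContDiff ℝ 2 f) {y : ℝ → E}
    (hy : ∀ t ∈ Ici (0 : ℝ), HasDerivAt y (-(gradient f (y t))) t) {p : E}
    (hp : Tendsto y atTop (𝓝 p)) : gradient f p = 0 := by
  by_contra hne
  have hv := hasDerivAt_comp_gradient_flow (hf.differentiable two_ne_zero) hy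
  have hpos : 0 < ‖gradient f p‖ ^ 2 := by positivity
  have hd : Tendsto (fun t => ‖gradient f (y t)‖ ^ 2) atTop (𝓝 (‖gradient f p‖ ^ 2)) :=
    ((hf.gradient.continuous.tendsto p).comp hp).norm.pow 2
  have hlim : Tendsto (fun t => f (y t)) atTop (𝓝 (f p)) := (hf.continuous.tendsto p).comp hp
  have hdiff : Tendsto (fun t => f (y t) - f (y (t + 1))) atTop (𝓝 0) := by
    simpa using hlim.sub (hlim.comp (tendsto_atTop_add_const_right _ 1 tendsto_id))
  obtain ⟨T, hT⟩ := eventually_atTop.1 (hd.eventually (lt_mem_nhds (half_lt_self hpos)))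
  obtain ⟨t, ht, htT, ht₀⟩ := ((hdiff.eventually (gt_mem_nhds (half_pos hpos))).and
    ((eventually_ge_atTop T).and (eventually_ge_atTop 0))).exists
  have hsub : Icc t (t + 1) ⊆ Ici (0 : ℝ) := fun s hs => ht₀.trans hs.1
  obtain ⟨s, hs, hslope⟩ := exists_hasDerivAt_eq_slope (fun s => f (y s)) _ (lt_add_one t)
    (HasDerivAt.continuousOn fun s hs => hv s (hsub hs))
    (fun s hs => hv s (hsub (Ioo_subset_Icc_self hs)))
  have := hT s (htT.trans hs.1.le)
  rw [add_sub_cancel_left, div_one] at hslope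
  linarith

/-- A gradient flow line along which the function reaches its value at a limit point of the line
converges to that point. -/
theorem tendsto_gradient_flow_of_comp_eq {f : E → ℝ} (hf : Differentiable ℝ f)
    {y : ℝ → E} (hy : ∀ t ∈ Ici (0 : ℝ), HasDerivAt y (-(gradient f (y t))) t) {p : E}
    (hp : MapClusterPt p atTop y) {t₀ : ℝ} (ht₀ : 0 ≤ t₀) (heq : f (y t₀) = f p) :
    Tendsto y atTop (𝓝 p) := by
  have hconst : ∀ t, t₀ ≤ t → f (y t) = f p := fun t ht =>
    le_antisymm (heq ▸ antitoneOn_comp_of_hasDerivAt_neg_gradient hf hy ht₀ (ht₀.trans ht) ht)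
      (le_comp_of_mapClusterPt_gradient_flow hf hy hp (ht₀.trans ht))
  have hcrit : ∀ t, t₀ < t → gradient f (y t) = 0 := by
    intro t ht
    have h₁ := hasDerivAt_comp_gradient_flow hf hy t (ht₀.trans ht.le)
    have h₂ : HasDerivAt (fun s => f (y s)) 0 t :=
      (hasDerivAt_const t (f p)).congr_of_eventuallyEq <| by
        filter_upwards [lt_mem_nhds ht] with s hs using hconst s hs.le
    simpa using h₁.unique h₂
  have hy_const : ∀ t, t₀ + 1 ≤ t → y t = y (t₀ + 1) := by
    intro t ht
    have hmem : ∀ s ∈ Icc (t₀ + 1) t, HasDerivAt y 0 s := fun s hs => by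
      have hs' : t₀ < s := by linarith [hs.1]
      simpa [hcrit s hs'] using hy s (ht₀.trans hs'.le)
    exact constant_of_has_deriv_right_zero (HasDerivAt.continuousOn hmem)
      (fun s hs => (hmem s (Ico_subset_Icc_self hs)).hasDerivWithinAt) t ⟨ht, le_rfl⟩
  have hev : y =ᶠ[atTop] fun _ => y (t₀ + 1) := by
    filter_upwards [eventually_ge_atTop (t₀ + 1)] with t ht using hy_const t ht
  have hlim : Tendsto y atTop (𝓝 (y (t₀ + 1))) := tendsto_const_nhds.congr' hev.symm
  have : p = y (t₀ + 1) := eq_of_nhds_neBot (hp.clusterPt.mono hlim)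
  rwa [this]

/-- **Łojasiewicz convergence theorem**: if the Łojasiewicz gradient inequality holds near a limit
point of a gradient flow line, then the line converges to that point. -/
theorem tendsto_gradient_flow_of_lojasiewicz_inequality {f : E → ℝ} (hf : Differentiable ℝ f)
    {y : ℝ → E} (hy : ∀ t ∈ Ici (0 : ℝ), HasDerivAt y (-(gradient f (y t))) t) {p : E}
    (hp : MapClusterPt p atTop y) {θ C : ℝ} (hθ : θ < 1) (hC : 0 < C)
    (hloj : ∀ᶠ x in 𝓝 p, |f x - f p| ^ θ ≤ C * ‖gradient f x‖) :
    Tendsto y atTop (𝓝 p) := by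
  have hge : ∀ t, 0 ≤ t → f p ≤ f (y t) := fun t ht =>
    le_comp_of_mapClusterPt_gradient_flow hf hy hp ht
  by_cases hreach : ∃ t₀, 0 ≤ t₀ ∧ f (y t₀) = f p
  · obtain ⟨t₀, ht₀, heq⟩ := hreach
    exact tendsto_gradient_flow_of_comp_eq hf hy hp ht₀ heq
  have hpos : ∀ t, 0 ≤ t → 0 < f (y t) - f p := fun t ht =>
    sub_pos.2 ((hge t ht).lt_of_ne fun h => hreach ⟨t, ht, h.symm⟩)
  have hθ' : 0 < 1 - θ := sub_pos.2 hθ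
  set H : ℝ → ℝ := fun t => (f (y t) - f p) ^ (1 - θ) / (1 - θ) with hH
  have hH₀ : ∀ t, 0 ≤ t → 0 ≤ H t := fun t ht =>
    div_nonneg (Real.rpow_nonneg (hpos t ht).le _) hθ'.le
  have hHd : ∀ t, 0 ≤ t → HasDerivAt H
      (-‖gradient f (y t)‖ ^ 2 / (f (y t) - f p) ^ θ) t := by
    intro t ht
    have h := (((hasDerivAt_comp_gradient_flow hf hy t ht).sub_const (f p)).rpow_const
      (p := 1 - θ) (Or.inl (hpos t ht).ne')).div_const (1 - θ)
    refine h.congr_deriv ?_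
    rw [show 1 - θ - 1 = -θ by ring, Real.rpow_neg (hpos t ht).le]
    field_simp
  have hHlim : Tendsto (fun t => 2 * C * H t) atTop (𝓝 0) := by
    have h := (((tendsto_comp_of_mapClusterPt_gradient_flow hf hy hp).sub_const (f p)).rpow_const
      (p := 1 - θ) (Or.inr hθ'.le)).div_const (1 - θ) |>.const_mul (2 * C)
    simpa [Real.zero_rpow hθ'.ne'] using h
  obtain ⟨r, hr, hball⟩ := Metric.eventually_nhds_iff_ball.1 hloj
  refine Metric.tendsto_atTop.2 fun ε hε => ?_
  have hr' : 0 < min r ε / 2 := by positivity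
  obtain ⟨t₀, hnear, hHt₀, ht₀⟩ := ((mapClusterPt_iff_frequently.1 hp _
    (Metric.ball_mem_nhds p hr')).and_eventually ((hHlim.eventually (gt_mem_nhds hr')).and
      (eventually_ge_atTop 0))).exists
  rw [mem_ball_iff_norm] at hnear
  have hclose : ∀ s, 0 ≤ s → ‖y s - y t₀‖ ≤ 2 * C * (H t₀ - H s) → ‖y s - p‖ < min r ε := by
    intro s hs h
    have h₁ : 2 * C * (H t₀ - H s) ≤ 2 * C * H t₀ :=
      mul_le_mul_of_nonneg_left (by linarith [hH₀ s hs]) (by positivity)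
    have h₂ := norm_sub_le_norm_sub_add_norm_sub (y s) (y t₀) p
    linarith
  refine ⟨t₀, fun t ht => ?_⟩
  rw [dist_eq_norm]
  refine (hclose t (ht₀.trans ht) ?_).trans_le (min_le_right _ _)
  have hy' : ∀ s ∈ Icc t₀ t, HasDerivAt (fun s => y s - y t₀) (-(gradient f (y s))) s :=
    fun s hs => (hy s (ht₀.trans hs.1)).sub_const _
  have hB' : ∀ s ∈ Icc t₀ t, HasDerivAt (fun s => 2 * C * (H t₀ - H s))
      (2 * C * -(-‖gradient f (y s)‖ ^ 2 / (f (y s) - f p) ^ θ)) s :=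
    fun s hs => ((hHd s (ht₀.trans hs.1)).const_sub _).const_mul _
  refine image_norm_le_of_norm_deriv_right_lt_deriv_boundary' (f := fun s => y s - y t₀)
    (HasDerivAt.continuousOn hy')
    (fun s hs => (hy' s (Ico_subset_Icc_self hs)).hasDerivWithinAt) (by simp)
    (HasDerivAt.continuousOn hB')
    (fun s hs => (hB' s (Ico_subset_Icc_self hs)).hasDerivWithinAt) (fun s hs heq => ?_)
    (right_mem_Icc.2 ht)
  have hs₀ : 0 ≤ s := ht₀.trans hs.1
  have hineq := hball (y s) (mem_ball_iff_norm.2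
    ((hclose s hs₀ heq.le).trans_le (min_le_left _ _)))
  rw [abs_of_pos (hpos s hs₀)] at hineq
  have hpow : 0 < (f (y s) - f p) ^ θ := Real.rpow_pos_of_pos (hpos s hs₀) _
  have hgrad : 0 < ‖gradient f (y s)‖ := by
    by_contra! h
    nlinarith [norm_nonneg (gradient f (y s))]
  rw [norm_neg, neg_div, neg_neg, ← mul_div_assoc, lt_div_iff₀ hpow]
  nlinarith

end Convergence

/-- Corollary 6: on all of `ℝ^N`, under the growth conditions
`|x| ≤ Ψ(ω(x))` and `|∇ω(x)| ≤ φ(|x|)` with `∫_α^∞ φ⁻¹ = +∞`, the gradient flow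
`y' = −∇ω(y)`, `y(0) = b` has a unique, uniformly bounded solution on `[0,∞)`;
and under the nondegeneracy/analyticity assumption (A₅) every such solution
converges to a critical point of `ω`. -/
theorem gradient_flow_global_existence_and_convergence_on_RN
    {N : ℕ} (ω : Euc N → ℝ) (hω : ContDiff ℝ 2 ω)
    (Ψ : ℝ → ℝ) (hΨpos : ∀ s, 0 < Ψ s) (hΨmono : Monotone Ψ)
    (hΨ : ∀ x : Euc N, ‖x‖ ≤ Ψ (ω x))
    (φ : ℝ → ℝ) (hφpos : ∀ s, 0 < φ s)
    (hφ : ∀ x : Euc N, ‖gradient ω x‖ ≤ φ ‖x‖)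
    (α : ℝ) (hα : 0 < α)
    (hint : ¬ IntegrableOn (fun t => (φ t)⁻¹) (Ici α)) :
    ∀ b : Euc N,
      (∃ y : ℝ → Euc N,
        (y 0 = b ∧ ∀ t ∈ Ici (0:ℝ), HasDerivAt y (-(gradient ω (y t))) t) ∧
        (∀ z : ℝ → Euc N,
          (z 0 = b ∧ ∀ t ∈ Ici (0:ℝ), HasDerivAt z (-(gradient ω (z t))) t) →
          EqOn z y (Ici 0)) ∧
        (∃ R : ℝ, ∀ t ∈ Ici (0:ℝ), ‖y t‖ ≤ R)) ∧
      (((∀ x : Euc N, gradient ω x = 0 →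
            Function.Bijective (fderiv ℝ (gradient ω) x)) ∨
        (∀ x : Euc N, gradient ω x = 0 → ∃ U ∈ 𝓝 x, AnalyticOnNhd ℝ ω U)) →
        ∀ y : ℝ → Euc N,
          (y 0 = b ∧ ∀ t ∈ Ici (0:ℝ), HasDerivAt y (-(gradient ω (y t))) t) →
          ∃ p : Euc N, gradient ω p = 0 ∧ Tendsto y atTop (𝓝 p)) := by
  have hdiff : Differentiable ℝ ω := hω.differentiable two_ne_zero
  have hsub : ∀ b x : Euc N, ω x ≤ ω b → ‖x‖ ≤ Ψ (ω b) := fun b x h => (hΨ x).trans (hΨmono h)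
  have hbdd : ∀ (b : Euc N) (z : ℝ → Euc N),
      (z 0 = b ∧ ∀ t ∈ Ici (0:ℝ), HasDerivAt z (-(gradient ω (z t))) t) →
      ∀ t ∈ Ici (0:ℝ), ‖z t‖ ≤ Ψ (ω b) := by
    rintro b z ⟨rfl, hz⟩ t ht
    exact hsub _ _ (antitoneOn_comp_of_hasDerivAt_neg_gradient hdiff hz self_mem_Ici ht ht)
  intro b
  constructor
  · obtain ⟨y, hy⟩ := exists_gradient_flow hω (hΨpos (ω b)) (hsub b)
    exact ⟨y, hy, fun z hz => gradient_flow_unique hω hy.2 hz.2 (hbdd b y hy) (hbdd b z hz)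
      (hz.1.trans hy.1.symm), Ψ (ω b), hbdd b y hy⟩
  · intro hcrit y hy
    obtain ⟨p, -, hp⟩ := (isCompact_closedBall (0 : Euc N) (Ψ (ω b))).exists_mapClusterPt
      (f := atTop) (u := y) <| by
        simp only [le_principal_iff, mem_map]
        filter_upwards [eventually_ge_atTop (0 : ℝ)] with t ht
        simpa using hbdd b y hy t ht
    obtain ⟨θ, hθ, C, hC, hloj⟩ :=
      lojasiewicz_inequality_of_nondegenerate_or_analytic hω hcrit p
    have hlim := tendsto_gradient_flow_of_lojasiewicz_inequality hdiff hy.2 hp hθ.2 hC hloj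
    exact ⟨p, gradient_eq_zero_of_tendsto_gradient_flow hω hy.2 hlim, hlim⟩
end
end

section
/- Assume hypotheses (A₁), (A₂), (A₃). Set ε₀ = [inf_{x∈Ω} B(x) / (1 + sup_{x∈Ω} |A(x)|)]^{1/2}. Then there is a constant C, independent of ε, such that for every ε ∈ (0, ε₀) and every classical solution V_ε of the Ginzburg–Landau system (1.1), |V_ε(x,t)|² ≤ C for all (x,t) ∈ Ω̄ × [0,∞). -/
open MeasureTheory Set Filter Topology
open scoped InnerProductSpace

noncomputable section

/-- The plane `ℝ²`, the target of the order parameter. -/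
abbrev Vec2 := EuclideanSpace ℝ (Fin 2)

/-- The `i`-th standard basis vector of `ℝ^N`. -/
def euc (N : ℕ) (i : Fin N) : Euc N := EuclideanSpace.single i 1

/-- Squared Frobenius norm `|∇f|²` of the spatial gradient of `f` at `x`. -/
def gradNormSq {N : ℕ} (f : Euc N → Vec2) (x : Euc N) : ℝ :=
  ∑ i : Fin N, ‖fderiv ℝ f x (euc N i)‖ ^ 2

/-- The Laplacian `Δf` of `f : ℝ^N → ℝ²` at `x`. -/
def lap {N : ℕ} (f : Euc N → Vec2) (x : Euc N) : Vec2 :=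
  ∑ i : Fin N, fderiv ℝ (fun y => fderiv ℝ f y (euc N i)) x (euc N i)

/-- Classical solution of the Ginzburg-Landau system (1.1):
`∂ₜV = ΔV + ∇ω·∇V + A V + (B/ε²) V (1 − |V|²)` in `Ω × (0,∞)`,
`V = g` on `∂Ω × (0,∞)`, `V(·,0) = V₀` on `Ω̄`. -/
def IsGLSolution {N : ℕ} (Ω : Set (Euc N)) (ω A B : Euc N → ℝ)
    (g : Euc N → Vec2) (V0 : Euc N → Vec2) (ε : ℝ)
    (V : Euc N → ℝ → Vec2) : Prop :=
  ContinuousOn (fun p : Euc N × ℝ => V p.1 p.2) (closure Ω ×ˢ Ici 0) ∧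
  (∀ t ∈ Ioi (0:ℝ), ContDiffOn ℝ 2 (fun x => V x t) Ω) ∧
  (∀ x ∈ Ω, ∀ t ∈ Ioi (0:ℝ),
    HasDerivAt (fun s => V x s)
      (lap (fun y => V y t) x + fderiv ℝ (fun y => V y t) x (gradient ω x)
        + A x • V x t + ((B x / ε ^ 2) * (1 - ‖V x t‖ ^ 2)) • V x t) t) ∧
  (∀ x ∈ frontier Ω, ∀ t ∈ Ioi (0:ℝ), V x t = g x) ∧
  (∀ x ∈ closure Ω, V x 0 = V0 x)

/-- `Ω` is a (smooth) bounded domain. -/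
def DomainOK {N : ℕ} (Ω : Set (Euc N)) : Prop :=
  IsOpen Ω ∧ Bornology.IsBounded Ω ∧ Ω.Nonempty

/-- Hypothesis (A₁): `g` is smooth and unimodular on `∂Ω`. -/
def HypA1 {N : ℕ} (Ω : Set (Euc N)) (g : Euc N → Vec2) : Prop :=
  ContDiff ℝ (⊤ : ℕ∞) g ∧ ∀ x ∈ frontier Ω, ‖g x‖ = 1

/-- `f` is `α`-Hölder continuous on `s`. -/
def HolderOnSet {E F : Type*} [NormedAddCommGroup E] [NormedAddCommGroup F]
    (α : ℝ) (f : E → F) (s : Set E) : Prop :=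
  ∃ C > 0, ∀ x ∈ s, ∀ y ∈ s, ‖f x - f y‖ ≤ C * dist x y ^ α

/-- Hypothesis (A₂): `ω ∈ C^{2,α}(Ω̄)`, `A, B ∈ C^α(Ω̄)`, and `ω > 0`, `B > 0` on `Ω̄`. -/
def HypA2 {N : ℕ} (Ω : Set (Euc N)) (α : ℝ) (ω A B : Euc N → ℝ) : Prop :=
  0 < α ∧
  ContDiff ℝ 2 ω ∧ HolderOnSet α (iteratedFDeriv ℝ 2 ω) (closure Ω) ∧
  ContinuousOn A (closure Ω) ∧ HolderOnSet α A (closure Ω) ∧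
  ContinuousOn B (closure Ω) ∧ HolderOnSet α B (closure Ω) ∧
  (∀ x ∈ closure Ω, 0 < ω x) ∧ (∀ x ∈ closure Ω, 0 < B x)

/-- `ρ(x) = min_j |x − b_j|`. -/
def rhoMin {N m : ℕ} (b : Fin m → Euc N) (x : Euc N) : ℝ := ⨅ j, dist x (b j)

/-- Hypothesis (A₃): the initial data `V⁰_ε` agree with `g` on `∂Ω`, are uniformly
bounded and have uniformly bounded weighted Ginzburg-Landau energy. -/
def HypA3 {N m : ℕ} (Ω : Set (Euc N)) (g : Euc N → Vec2) (b : Fin m → Euc N)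
    (K : ℝ) (V0 : ℝ → Euc N → Vec2) : Prop :=
  (∀ j, b j ∈ Ω) ∧ Function.Injective b ∧
  ∀ ε > (0:ℝ),
    ContDiffOn ℝ 2 (V0 ε) (closure Ω) ∧
    (∀ x ∈ frontier Ω, V0 ε x = g x) ∧
    (∀ x ∈ closure Ω, ‖V0 ε x‖ ≤ K) ∧
    (∫ x in Ω, (rhoMin b x) ^ 2 *
      (gradNormSq (V0 ε) x + 1 / (2 * ε ^ 2) * (‖V0 ε x‖ ^ 2 - 1) ^ 2)) ≤ K

/-- Hypothesis (A₄): each `b_j` lies in a subdomain `G_j ⊂⊂ Ω` on whose boundary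
`ω` exceeds `ω(b_j)`. -/
def HypA4 {N m : ℕ} (Ω : Set (Euc N)) (ω : Euc N → ℝ) (b : Fin m → Euc N)
    (G : Fin m → Set (Euc N)) : Prop :=
  ∀ j, IsOpen (G j) ∧ b j ∈ G j ∧ closure (G j) ⊆ Ω ∧
    ∀ x ∈ frontier (G j), ω (b j) < ω x

/-- The pinning ODE (1.5): `y_j' = −∇ω(y_j)`, `y_j(0) = b_j`, on `[0,∞)`. -/
def SolvesPinningODE {N m : ℕ} (ω : Euc N → ℝ) (b : Fin m → Euc N)
    (y : Fin m → ℝ → Euc N) : Prop :=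
  ∀ j, y j 0 = b j ∧ ∀ t ∈ Ici (0:ℝ), HasDerivAt (y j) (-(gradient ω (y j t))) t

/-- The threshold `ε₀ = [inf_Ω B / (1 + sup_Ω |A|)]^{1/2}`. -/
def eps0 {N : ℕ} (Ω : Set (Euc N)) (A B : Euc N → ℝ) : ℝ :=
  Real.sqrt (sInf (B '' Ω) / (1 + sSup ((fun x => |A x|) '' Ω)))

/-- The weighted Ginzburg-Landau energy density (3.6). -/
def glEnergy {N : ℕ} (ω B : Euc N → ℝ) (ε : ℝ) (V : Euc N → ℝ → Vec2)
    (t : ℝ) (x : Euc N) : ℝ :=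
  Real.exp (ω x) / 2 *
    (gradNormSq (fun y => V y t) x + B x / (2 * ε ^ 2) * (1 - ‖V x t‖ ^ 2) ^ 2)

/-- `Ω` minus the `r`-balls around the vortices at time `t`. -/
def outside {N m : ℕ} (Ω : Set (Euc N)) (y : Fin m → ℝ → Euc N)
    (r t : ℝ) : Set (Euc N) :=
  Ω \ ⋃ j, Metric.ball (y j t) r

/-- A function with a local maximum has nonpositive second derivative there. -/
theorem IsLocalMax.deriv_deriv_nonpos {f : ℝ → ℝ} {a : ℝ} (h : IsLocalMax f a)
    (hc : ContinuousAt f a) : deriv (deriv f) a ≤ 0 := by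
  by_contra! hpos
  have hmin : IsLocalMin f a := isLocalMin_of_deriv_deriv_pos hpos h.deriv_eq_zero hc
  have hconst : f =ᶠ[𝓝 a] fun _ => f a := by
    filter_upwards [h, hmin] with s h1 h2 using le_antisymm h1 h2
  have hzero : deriv (deriv f) a = 0 := by
    rw [hconst.deriv.deriv_eq]
    simp
  linarith

/-- If `u` attains its maximum over a left neighbourhood of `t` at `t`, its derivative there
is nonnegative. -/
theorem HasDerivAt.nonneg_of_eventually_le_left {u : ℝ → ℝ} {u' t : ℝ} (hu : HasDerivAt u u' t)
    (hle : ∀ᶠ s in 𝓝[<] t, u s ≤ u t) : 0 ≤ u' := by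
  have hlim := (hasDerivAt_iff_tendsto_slope.1 hu).mono_left (nhdsLT_le_nhdsNE t)
  refine ge_of_tendsto hlim ?_
  filter_upwards [hle, self_mem_nhdsWithin] with s hs hst
  rw [slope_def_field]
  exact div_nonneg_of_nonpos (by linarith) (sub_nonpos.2 (le_of_lt hst))

section NormSqMaximum

variable {E F : Type*} [NormedAddCommGroup E] [NormedSpace ℝ E]
  [NormedAddCommGroup F] [InnerProductSpace ℝ F] {f : E → F} {x : E}

/-- First-order condition at a local maximum of `‖f‖²`. -/
theorem inner_fderiv_eq_zero_of_isLocalMax_normSq (hf : DifferentiableAt ℝ f x)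
    (hmax : IsLocalMax (fun y => ‖f y‖ ^ 2) x) (v : E) : ⟪f x, fderiv ℝ f x v⟫_ℝ = 0 := by
  have h := congrArg (fun L => L v) (hmax.hasFDerivAt_eq_zero hf.hasFDerivAt.norm_sq)
  simpa using h

/-- Second-order condition at a local maximum of `‖f‖²`. -/
theorem inner_fderiv_fderiv_nonpos_of_isLocalMax_normSq (hf : ContDiffAt ℝ 2 f x)
    (hmax : IsLocalMax (fun y => ‖f y‖ ^ 2) x) (e : E) :
    ⟪f x, fderiv ℝ (fun y => fderiv ℝ f y e) x e⟫_ℝ ≤ 0 := by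
  have hline : ∀ s : ℝ, HasDerivAt (fun s : ℝ => x + s • e) e s := fun s => by
    simpa using ((hasDerivAt_id s).smul_const e).const_add x
  have htend : Tendsto (fun s : ℝ => x + s • e) (𝓝 0) (𝓝 x) := by
    simpa [ContinuousAt] using (hline 0).continuousAt
  have hdiff : ∀ᶠ y in 𝓝 x, DifferentiableAt ℝ f y := by
    filter_upwards [hf.eventually (by simp)] with y hy using hy.differentiableAt (by simp)
  have hcomp : ∀ s : ℝ, DifferentiableAt ℝ f (x + s • e) →
      HasDerivAt (fun s : ℝ => f (x + s • e)) (fderiv ℝ f (x + s • e) e) s := fun s hs =>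
    hs.hasFDerivAt.comp_hasDerivAt s (hline s)
  have hderiv : deriv (fun s : ℝ => ‖f (x + s • e)‖ ^ 2) =ᶠ[𝓝 0]
      fun s => 2 * ⟪f (x + s • e), fderiv ℝ f (x + s • e) e⟫_ℝ := by
    filter_upwards [htend.eventually hdiff] with s hs using (hcomp s hs).norm_sq.deriv
  have hD : DifferentiableAt ℝ (fun y => fderiv ℝ f y e) x :=
    ((hf.fderiv_right (m := 1) (by norm_num)).differentiableAt (by simp)).clm_apply
      (differentiableAt_const e)
  have h0 : x + (0 : ℝ) • e = x := by simp
  have hcomp0 := hcomp 0 (by simpa using hdiff.self_of_nhds)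
  have hD0 : HasDerivAt (fun s : ℝ => fderiv ℝ f (x + s • e) e)
      (fderiv ℝ (fun y => fderiv ℝ f y e) x e) 0 :=
    HasFDerivAt.comp_hasDerivAt_of_eq (0 : ℝ) hD.hasFDerivAt (hline 0) h0.symm
  have hmax0 : IsLocalMax (fun s : ℝ => ‖f (x + s • e)‖ ^ 2) 0 := by
    filter_upwards [htend.eventually hmax] with s hs
    simpa using hs
  have h2 := hmax0.deriv_deriv_nonpos hcomp0.norm_sq.continuousAt
  rw [hderiv.deriv_eq, ((hcomp0.inner ℝ hD0).const_mul 2).deriv, h0,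
    real_inner_self_eq_norm_sq] at h2
  nlinarith [sq_nonneg ‖fderiv ℝ f x e‖]

end NormSqMaximum

/-- For `ε < ε₀` the absorption coefficient `B/ε²` dominates `1 + |A|` on `Ω`. -/
theorem one_add_abs_lt_div_sq {N : ℕ} {Ω : Set (Euc N)} {A B : Euc N → ℝ}
    (hΩ : Bornology.IsBounded Ω) (hA : ContinuousOn A (closure Ω))
    (hB : ∀ x ∈ closure Ω, 0 < B x) {ε : ℝ} (hε : ε ∈ Ioo 0 (eps0 Ω A B)) {x : Euc N}
    (hx : x ∈ Ω) : 1 + |A x| < B x / ε ^ 2 := by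
  have hAx : |A x| ≤ sSup ((fun x => |A x|) '' Ω) :=
    le_csSup ((hΩ.isCompact_closure.bddAbove_image hA.abs).mono (image_mono subset_closure))
      (mem_image_of_mem _ hx)
  have hBx : sInf (B '' Ω) ≤ B x :=
    csInf_le ⟨0, by rintro _ ⟨y, hy, rfl⟩; exact (hB y (subset_closure hy)).le⟩
      (mem_image_of_mem _ hx)
  have hlt := (Real.lt_sqrt hε.1.le).1 hε.2
  have hsq : 0 < ε ^ 2 := pow_pos hε.1 2
  rw [lt_div_iff₀ (by linarith [abs_nonneg (A x)])] at hlt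
  rw [lt_div_iff₀ hsq]
  nlinarith

/-- A solution cannot attain a maximum of `‖V‖²` with value at least `2` at an interior point
and a positive time. -/
theorem IsGLSolution.normSq_lt_two_of_max {N : ℕ} {Ω : Set (Euc N)} {ω A B : Euc N → ℝ}
    {g V0 : Euc N → Vec2} {ε : ℝ} {V : Euc N → ℝ → Vec2} (hV : IsGLSolution Ω ω A B g V0 ε V)
    (hΩ : IsOpen Ω) {x : Euc N} {t : ℝ} (hx : x ∈ Ω) (ht : 0 < t)
    (hAB : 1 + |A x| < B x / ε ^ 2)
    (hspace : ∀ y ∈ Ω, ‖V y t‖ ^ 2 ≤ ‖V x t‖ ^ 2)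
    (htime : ∀ s ∈ Ioo 0 t, ‖V x s‖ ^ 2 ≤ ‖V x t‖ ^ 2) : ‖V x t‖ ^ 2 < 2 := by
  obtain ⟨-, hC2, hpde, -, -⟩ := hV
  by_contra! h2
  have hsmooth : ContDiffAt ℝ 2 (fun y => V y t) x := (hC2 t ht).contDiffAt (hΩ.mem_nhds hx)
  have hmax : IsLocalMax (fun y => ‖V y t‖ ^ 2) x := by
    filter_upwards [hΩ.mem_nhds hx] with y hy using hspace y hy
  have hgrad := inner_fderiv_eq_zero_of_isLocalMax_normSq
    (hsmooth.differentiableAt (by simp)) hmax (gradient ω x)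
  have hlap : ⟪V x t, lap (fun y => V y t) x⟫_ℝ ≤ 0 := by
    rw [lap, inner_sum]
    exact Finset.sum_nonpos fun i _ =>
      inner_fderiv_fderiv_nonpos_of_isLocalMax_normSq hsmooth hmax (euc N i)
  have hdt := (hpde x hx t ht).norm_sq.nonneg_of_eventually_le_left <| by
    filter_upwards [Ioo_mem_nhdsLT ht] with s hs using htime s hs
  simp only [inner_add_right, inner_smul_right, real_inner_self_eq_norm_sq, hgrad] at hdt
  have habs := le_abs_self (A x)
  have hneg : A x + B x / ε ^ 2 * (1 - ‖V x t‖ ^ 2) < 0 := by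
    nlinarith [abs_nonneg (A x)]
  nlinarith

/-- Lemma 8, first part: uniform boundedness `|V_ε|² ≤ C` for
`ε ∈ (0, ε₀)`. -/
theorem gl_uniform_bound
    {N m : ℕ} (Ω : Set (Euc N)) (hΩ : DomainOK Ω)
    (α K : ℝ) (ω A B : Euc N → ℝ) (g : Euc N → Vec2)
    (b : Fin m → Euc N) (V0 : ℝ → Euc N → Vec2)
    (hA1 : HypA1 Ω g) (hA2 : HypA2 Ω α ω A B) (hA3 : HypA3 Ω g b K V0) :
    ∃ C : ℝ, ∀ ε ∈ Ioo 0 (eps0 Ω A B), ∀ V : Euc N → ℝ → Vec2,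
      IsGLSolution Ω ω A B g (V0 ε) ε V →
      ∀ x ∈ closure Ω, ∀ t ∈ Ici (0:ℝ), ‖V x t‖ ^ 2 ≤ C := by
  obtain ⟨hopen, hbdd, -⟩ := hΩ
  obtain ⟨-, -, -, hA, -, -, -, -, hBpos⟩ := hA2
  refine ⟨max (K ^ 2) 2, fun ε hε V hV x hx t ht => ?_⟩
  have hcont : ContinuousOn (fun p : Euc N × ℝ => ‖V p.1 p.2‖ ^ 2) (closure Ω ×ˢ Icc 0 t) :=
    (hV.1.norm.pow 2).mono (prod_mono_right Icc_subset_Ici_self)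
  have hmem : (x, t) ∈ closure Ω ×ˢ Icc 0 t := mk_mem_prod hx (right_mem_Icc.2 ht)
  obtain ⟨p, hpmem, hp⟩ :=
    (hbdd.isCompact_closure.prod isCompact_Icc).exists_isMaxOn ⟨(x, t), hmem⟩ hcont
  obtain ⟨hp1, hp2⟩ := mem_prod.1 hpmem
  have hle : ∀ y ∈ closure Ω, ∀ s ∈ Icc 0 t, ‖V y s‖ ^ 2 ≤ ‖V p.1 p.2‖ ^ 2 :=
    fun y hy s hs => isMaxOn_iff.1 hp (y, s) (mk_mem_prod hy hs)
  refine (hle x hx t ⟨ht, le_rfl⟩).trans ?_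
  rcases hp2.1.eq_or_lt with h0 | hpos
  · rw [← h0, hV.2.2.2.2 p.1 hp1]
    have hK := (hA3.2.2 ε hε.1).2.2.1 p.1 hp1
    exact le_max_of_le_left (by gcongr)
  · by_cases hpΩ : p.1 ∈ Ω
    · exact le_max_of_le_right (hV.normSq_lt_two_of_max hopen hpΩ hpos
        (one_add_abs_lt_div_sq hbdd hA hBpos hε hpΩ)
        (fun y hy => hle y (subset_closure hy) p.2 hp2)
        (fun s hs => hle p.1 hp1 s ⟨hs.1.le, hs.2.le.trans hp2.2⟩)).le
    · have hfr : p.1 ∈ frontier Ω := by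
        rw [hopen.frontier_eq]
        exact ⟨hp1, hpΩ⟩
      rw [hV.2.2.2.1 p.1 hfr p.2 hpos, hA1.2 p.1 hfr]
      exact le_max_of_le_right (by norm_num)

end
end

section
/- Assume hypotheses (A₁), (A₂), (A₃), that ‖V⁰_ε‖_{C(Ω̄)} ≤ 1, and that A(x) ≤ B(x) for all x ∈ Ω̄. Then every classical solution V_ε of the Ginzburg–Landau system (1.1) satisfies |V_ε(x,t)|² ≤ 1 + ε² for all (x,t) ∈ Ω̄ × [0,∞) and for all ε > 0. -/
open MeasureTheory Set Filter Topology
open scoped InnerProductSpace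

noncomputable section

/-- If `t ↦ ‖f t‖²` is maximal over `[0, t₀]` at `t₀ > 0`, then the
derivative of `f` at `t₀` has nonnegative inner product with `f t₀`. -/
lemma inner_deriv_nonneg_of_isMaxOn_norm_sq {F : Type*} [NormedAddCommGroup F]
    [InnerProductSpace ℝ F] {f : ℝ → F} {f' : F} {t₀ : ℝ} (ht₀ : 0 < t₀)
    (hf : HasDerivAt f f' t₀) (hmax : IsMaxOn (fun t => ‖f t‖ ^ 2) (Icc 0 t₀) t₀) :
    0 ≤ ⟪f t₀, f'⟫_ℝ := by
  have hd : HasDerivAt (fun t => ‖f t‖ ^ 2) (2 * ⟪f t₀, f'⟫_ℝ) t₀ := hf.norm_sq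
  have hmem : -t₀ ∈ posTangentConeAt (Icc 0 t₀) t₀ := by
    apply mem_posTangentConeAt_of_segment_subset
    rw [add_neg_cancel, segment_symm, segment_eq_Icc ht₀.le]
  have h := hmax.localize.hasFDerivWithinAt_nonpos hd.hasFDerivAt.hasFDerivWithinAt hmem
  simp only [ContinuousLinearMap.toSpanSingleton_apply, smul_eq_mul] at h
  nlinarith

/-- The second derivative of a real function at a local maximum is nonpositive. -/
lemma deriv_deriv_nonpos_of_isLocalMax {f : ℝ → ℝ} {a : ℝ} (hmax : IsLocalMax f a)
    (hc : ContinuousAt f a) : deriv (deriv f) a ≤ 0 := by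
  by_contra! hpos
  have hmin := isLocalMin_of_deriv_deriv_pos hpos hmax.deriv_eq_zero hc
  have hconst : f =ᶠ[𝓝 a] fun _ => f a := by
    filter_upwards [hmax, hmin] with s h1 h2 using le_antisymm h1 h2
  rw [hconst.deriv.deriv_eq] at hpos
  simp at hpos

/-- If `‖f‖²` has a local maximum at `x`, then `⟪f x, ∂ᵥ∂ᵥ f x⟫ ≤ 0` for every direction `v`. -/
lemma inner_fderiv_fderiv_nonpos_of_isLocalMax_norm_sq {E F : Type*} [NormedAddCommGroup E]
    [NormedSpace ℝ E] [NormedAddCommGroup F] [InnerProductSpace ℝ F] {f : E → F} {x : E}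
    (hf : ContDiffAt ℝ 2 f x) (hmax : IsLocalMax (fun y => ‖f y‖ ^ 2) x) (v : E) :
    ⟪f x, fderiv ℝ (fun y => fderiv ℝ f y v) x v⟫_ℝ ≤ 0 := by
  have hline : ∀ s : ℝ, HasDerivAt (fun s : ℝ => x + s • v) v s := fun s => by
    simpa using ((hasDerivAt_id s).smul_const v).const_add x
  have hlim : Tendsto (fun s : ℝ => x + s • v) (𝓝 0) (𝓝 x) := by
    simpa [ContinuousAt] using (hline 0).continuousAt
  have hdiff : ∀ᶠ y in 𝓝 x, DifferentiableAt ℝ f y := by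
    filter_upwards [hf.eventually (by simp)] with y hy using hy.differentiableAt (by simp)
  have hfst : ∀ s : ℝ, DifferentiableAt ℝ f (x + s • v) →
      HasDerivAt (fun s : ℝ => f (x + s • v)) (fderiv ℝ f (x + s • v) v) s :=
    fun s hs => hs.hasFDerivAt.comp_hasDerivAt s (hline s)
  have hsnd : HasDerivAt (fun s : ℝ => fderiv ℝ f (x + s • v) v)
      (fderiv ℝ (fun y => fderiv ℝ f y v) x v) 0 := by
    have h : DifferentiableAt ℝ (fun y => fderiv ℝ f y v) x :=
      ((hf.fderiv_right (m := 1) (by norm_num)).differentiableAt (by simp)).clm_apply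
        (differentiableAt_const v)
    have h0 : HasFDerivAt (fun y => fderiv ℝ f y v) (fderiv ℝ (fun y => fderiv ℝ f y v) x)
        (x + (0 : ℝ) • v) := by simpa using h.hasFDerivAt
    exact h0.comp_hasDerivAt 0 (hline 0)
  have hderiv : deriv (fun s : ℝ => ‖f (x + s • v)‖ ^ 2) =ᶠ[𝓝 0]
      fun s => 2 * ⟪f (x + s • v), fderiv ℝ f (x + s • v) v⟫_ℝ := by
    filter_upwards [hlim.eventually hdiff] with s hs using (hfst s hs).norm_sq.deriv
  have hfst0 := hfst 0 (by simpa using hdiff.self_of_nhds)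
  have hmax0 : IsLocalMax (fun s : ℝ => ‖f (x + s • v)‖ ^ 2) 0 := by
    filter_upwards [hlim.eventually hmax] with s hs
    simpa using hs
  have h := deriv_deriv_nonpos_of_isLocalMax hmax0 hfst0.norm_sq.continuousAt
  rw [hderiv.deriv_eq, ((hfst0.inner ℝ hsnd).const_mul 2).deriv] at h
  simp only [zero_smul, add_zero, real_inner_self_eq_norm_sq] at h
  nlinarith [sq_nonneg ‖fderiv ℝ f x v‖]

/-- If `‖f‖²` has a local maximum at `x`, then `f x` is orthogonal to the range of `Df(x)`. -/
lemma inner_fderiv_eq_zero_of_isLocalMax_norm_sq {E F : Type*} [NormedAddCommGroup E]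
    [NormedSpace ℝ E] [NormedAddCommGroup F] [InnerProductSpace ℝ F] {f : E → F} {x : E}
    (hf : DifferentiableAt ℝ f x) (hmax : IsLocalMax (fun y => ‖f y‖ ^ 2) x) (v : E) :
    ⟪f x, fderiv ℝ f x v⟫_ℝ = 0 := by
  have h := DFunLike.congr_fun (hmax.hasFDerivAt_eq_zero hf.hasFDerivAt.norm_sq) v
  simpa using h

/-- Corollary 8: if `‖V⁰_ε‖ ≤ 1` and `A ≤ B` on `Ω̄`, then
`|V_ε|² ≤ 1 + ε²` for all `ε > 0`. -/
theorem gl_refined_bound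
    {N m : ℕ} (Ω : Set (Euc N)) (hΩ : DomainOK Ω)
    (α K : ℝ) (ω A B : Euc N → ℝ) (g : Euc N → Vec2)
    (b : Fin m → Euc N) (V0 : ℝ → Euc N → Vec2)
    (hA1 : HypA1 Ω g) (hA2 : HypA2 Ω α ω A B) (hA3 : HypA3 Ω g b K V0)
    (hV0 : ∀ ε > (0:ℝ), ∀ x ∈ closure Ω, ‖V0 ε x‖ ≤ 1)
    (hAB : ∀ x ∈ closure Ω, A x ≤ B x) :
    ∀ ε > (0:ℝ), ∀ V : Euc N → ℝ → Vec2,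
      IsGLSolution Ω ω A B g (V0 ε) ε V →
      ∀ x ∈ closure Ω, ∀ t ∈ Ici (0:ℝ), ‖V x t‖ ^ 2 ≤ 1 + ε ^ 2 := by
  intro ε hε V ⟨hcont, hsmooth, hpde, hbdry, hinit⟩ x hx T hT
  obtain ⟨hopen, hbdd, -⟩ := hΩ
  have hcompact : IsCompact (closure Ω ×ˢ Icc (0 : ℝ) T) :=
    hbdd.isCompact_closure.prod isCompact_Icc
  have hcontSq : ContinuousOn (fun p : Euc N × ℝ => ‖V p.1 p.2‖ ^ 2)
      (closure Ω ×ˢ Icc (0 : ℝ) T) :=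
    (hcont.mono (prod_mono_right Icc_subset_Ici_self)).norm.pow 2
  obtain ⟨⟨x₀, t₀⟩, ⟨hx₀, ht₀⟩, hmax⟩ :=
    hcompact.exists_isMaxOn ⟨(x, T), hx, right_mem_Icc.2 hT⟩ hcontSq
  replace hmax : ∀ y ∈ closure Ω, ∀ s ∈ Icc 0 T, ‖V y s‖ ^ 2 ≤ ‖V x₀ t₀‖ ^ 2 :=
    fun y hy s hs => isMaxOn_iff.1 hmax (y, s) ⟨hy, hs⟩
  by_contra! hlt
  have hM : 1 + ε ^ 2 < ‖V x₀ t₀‖ ^ 2 := hlt.trans_le (hmax x hx T (right_mem_Icc.2 hT))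
  have hε2 : 0 < ε ^ 2 := by positivity
  have ht₀pos : 0 < t₀ := by
    refine lt_of_le_of_ne ht₀.1 fun h => ?_
    rw [← h, hinit x₀ hx₀] at hM
    nlinarith [hV0 ε hε x₀ hx₀, norm_nonneg (V0 ε x₀)]
  have hx₀Ω : x₀ ∈ Ω := by
    by_contra h
    have hfr : x₀ ∈ frontier Ω := by
      rw [hopen.frontier_eq]
      exact ⟨hx₀, h⟩
    rw [hbdry x₀ hfr t₀ ht₀pos, hA1.2 x₀ hfr] at hM
    linarith
  have htime := inner_deriv_nonneg_of_isMaxOn_norm_sq ht₀pos (hpde x₀ hx₀Ω t₀ ht₀pos)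
    fun s hs => hmax x₀ hx₀ s ⟨hs.1, hs.2.trans ht₀.2⟩
  have hspace : IsLocalMax (fun y => ‖V y t₀‖ ^ 2) x₀ := by
    filter_upwards [hopen.mem_nhds hx₀Ω] with y hy
    exact hmax y (subset_closure hy) t₀ ht₀
  have hC2 : ContDiffAt ℝ 2 (fun y => V y t₀) x₀ :=
    (hsmooth t₀ ht₀pos).contDiffAt (hopen.mem_nhds hx₀Ω)
  have hlap : ⟪V x₀ t₀, lap (fun y => V y t₀) x₀⟫_ℝ ≤ 0 := by
    rw [lap, inner_sum]
    exact Finset.sum_nonpos fun i _ =>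
      inner_fderiv_fderiv_nonpos_of_isLocalMax_norm_sq hC2 hspace (euc N i)
  have hgrad := inner_fderiv_eq_zero_of_isLocalMax_norm_sq
    (hC2.differentiableAt (by simp)) hspace (gradient ω x₀)
  have hB : 0 < B x₀ := hA2.2.2.2.2.2.2.2.2 x₀ hx₀
  have hreact : A x₀ + B x₀ / ε ^ 2 * (1 - ‖V x₀ t₀‖ ^ 2) < 0 := by
    have h : B x₀ / ε ^ 2 * (1 - ‖V x₀ t₀‖ ^ 2) < B x₀ / ε ^ 2 * (-ε ^ 2) :=
      mul_lt_mul_of_pos_left (by linarith) (by positivity)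
    have h' : B x₀ / ε ^ 2 * (-ε ^ 2) = -B x₀ := by field_simp
    linarith [hAB x₀ hx₀]
  simp only [inner_add_right, real_inner_smul_right, real_inner_self_eq_norm_sq] at htime
  have hneg : (A x₀ + B x₀ / ε ^ 2 * (1 - ‖V x₀ t₀‖ ^ 2)) * ‖V x₀ t₀‖ ^ 2 < 0 :=
    mul_neg_of_neg_of_pos hreact (by linarith)
  linarith

end
end
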